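/- The set of critical values of the Ginzburg–Landau energy is finite: the set {E(a,φ) : (a,φ) a degree-d GL solution} is a finite subset of ℝ. -/

import Mathlib

open MeasureTheory Complex

noncomputable section

/-- Partial derivative in the first coordinate direction. -/
def pd1 {E : Type*} [NormedAddCommGroup E] [NormedSpace ℝ E]
    (f : ℝ × ℝ → E) (x : ℝ × ℝ) : E := fderiv ℝ f x (1, 0)

/-- Partial derivative in the second coordinate direction. -/
def pd2 {E : Type*} [NormedAddCommGroup E] [NormedSpace ℝ E]
    (f : ℝ × ℝ → E) (x : ℝ × ℝ) : E := fderiv ℝ f x (0, 1)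

/-- Covariant derivative `D₁φ = ∂₁φ + i a₁ φ`. -/
def D1 (a1 : ℝ × ℝ → ℝ) (φ : ℝ × ℝ → ℂ) : ℝ × ℝ → ℂ :=
  fun x => pd1 φ x + Complex.I * (a1 x : ℂ) * φ x

/-- Covariant derivative `D₂φ = ∂₂φ + i a₂ φ`. -/
def D2 (a2 : ℝ × ℝ → ℝ) (φ : ℝ × ℝ → ℂ) : ℝ × ℝ → ℂ :=
  fun x => pd2 φ x + Complex.I * (a2 x : ℂ) * φ x

/-- Curvature `F(a) = ∂₁a₂ − ∂₂a₁`. -/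
def curv (a1 a2 : ℝ × ℝ → ℝ) : ℝ × ℝ → ℝ :=
  fun x => pd1 a2 x - pd2 a1 x

/-- The fundamental domain `[0,1]²`. -/
def unitSquare : Set (ℝ × ℝ) := Set.Icc (0, 0) (1, 1)

/-- A degree-`d` field pair on the torus: smooth quasi-periodic `(a, φ)`. -/
structure FieldPair (d : ℤ) where
  a1 : ℝ × ℝ → ℝ
  a2 : ℝ × ℝ → ℝ
  φ : ℝ × ℝ → ℂ
  smooth_a1 : ContDiff ℝ (⊤ : ℕ∞) a1
  smooth_a2 : ContDiff ℝ (⊤ : ℕ∞) a2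
  smooth_φ : ContDiff ℝ (⊤ : ℕ∞) φ
  per1_a1 : ∀ x : ℝ × ℝ, a1 (x.1 + 1, x.2) = a1 x
  per1_a2 : ∀ x : ℝ × ℝ, a2 (x.1 + 1, x.2) = a2 x
  per1_φ : ∀ x : ℝ × ℝ, φ (x.1 + 1, x.2) = φ x
  per2_a2 : ∀ x : ℝ × ℝ, a2 (x.1, x.2 + 1) = a2 x
  per2_a1 : ∀ x : ℝ × ℝ, a1 (x.1, x.2 + 1) = a1 x - 2 * Real.pi * d
  per2_φ : ∀ x : ℝ × ℝ, φ (x.1, x.2 + 1) =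
      Complex.exp (2 * Real.pi * Complex.I * (d : ℂ) * (x.1 : ℂ)) * φ x

/-- The smooth ℤ²-periodic external field with `∫_{[0,1]²} F₀ = 2πd`. -/
def ExternalField (d : ℤ) (F₀ : ℝ × ℝ → ℝ) : Prop :=
  ContDiff ℝ (⊤ : ℕ∞) F₀ ∧ (∀ x : ℝ × ℝ, F₀ (x.1 + 1, x.2) = F₀ x) ∧
    (∀ x : ℝ × ℝ, F₀ (x.1, x.2 + 1) = F₀ x) ∧
    (∫ x in unitSquare, F₀ x) = 2 * Real.pi * d

/-- The Ginzburg–Landau free energy. -/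
def energy (α β : ℝ) (F₀ : ℝ × ℝ → ℝ) {d : ℤ} (P : FieldPair d) : ℝ :=
  (1 / 2) * ∫ x in unitSquare,
    ((curv P.a1 P.a2 x - F₀ x) ^ 2 + ‖D1 P.a1 P.φ x‖ ^ 2 + ‖D2 P.a2 P.φ x‖ ^ 2
      - α * ‖P.φ x‖ ^ 2 + (β / 2) * ‖P.φ x‖ ^ 4)

/-- The Ginzburg–Landau equations. -/
def IsGLSolution (α β : ℝ) (F₀ : ℝ × ℝ → ℝ) {d : ℤ} (P : FieldPair d) : Prop :=
  (∀ x : ℝ × ℝ,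
      pd2 (fun y => curv P.a1 P.a2 y - F₀ y) x
        + ((starRingEnd ℂ) (P.φ x) * D1 P.a1 P.φ x).im = 0) ∧
  (∀ x : ℝ × ℝ,
      -pd1 (fun y => curv P.a1 P.a2 y - F₀ y) x
        + ((starRingEnd ℂ) (P.φ x) * D2 P.a2 P.φ x).im = 0) ∧
  (∀ x : ℝ × ℝ,
      -(D1 P.a1 (D1 P.a1 P.φ) x + D2 P.a2 (D2 P.a2 P.φ) x)
        = (α : ℂ) * P.φ x - (β : ℂ) * (‖P.φ x‖ : ℂ) ^ 2 * P.φ x)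

/-- The set of energies of all degree-`d` field pairs. -/
def energySet (α β : ℝ) (F₀ : ℝ × ℝ → ℝ) (d : ℤ) : Set ℝ :=
  { t : ℝ | ∃ P : FieldPair d, t = energy α β F₀ P }

/-- `λ₁`, the lowest eigenvalue of the covariant Laplacian among connections
with curvature `F₀`. -/
def lambda1 (d : ℤ) (F₀ : ℝ × ℝ → ℝ) : ℝ :=
  sInf { t : ℝ | ∃ P : FieldPair d,
    (∀ x : ℝ × ℝ, curv P.a1 P.a2 x = F₀ x) ∧
    (∫ x in unitSquare, ‖P.φ x‖ ^ 2) = 1 ∧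
    t = ∫ x in unitSquare, (‖D1 P.a1 P.φ x‖ ^ 2 + ‖D2 P.a2 P.φ x‖ ^ 2) }

section

open scoped ContDiff Topology
open Filter Set

/-- The extension of a real power series in `N` variables to a real Banach algebra. -/
def algExt {N : ℕ} (B : Type*) [NormedRing B] [NormedAlgebra ℝ B]
    (p : FormalMultilinearSeries ℝ (Fin N → ℝ) ℝ) : FormalMultilinearSeries ℝ (Fin N → B) B :=
  fun k => ∑ i : Fin k → Fin N, p k (fun j => Pi.single (i j) 1) •
    (ContinuousMultilinearMap.mkPiAlgebraFin ℝ k B).compContinuousLinearMap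
      (fun j => ContinuousLinearMap.proj (i j))

lemma algExt_apply {N : ℕ} (B : Type*) [NormedRing B] [NormedAlgebra ℝ B]
    (p : FormalMultilinearSeries ℝ (Fin N → ℝ) ℝ) (k : ℕ) (a : Fin N → B) :
    algExt B p k (fun _ => a) = ∑ i : Fin k → Fin N, p k (fun j => Pi.single (i j) 1) •
      (List.ofFn fun j => a (i j)).prod := by
  simp [algExt]

lemma algExt_radius_pos {N : ℕ} (B : Type*) [NormedRing B] [NormedAlgebra ℝ B] [NormOneClass B]
    (p : FormalMultilinearSeries ℝ (Fin N → ℝ) ℝ) (hp : 0 < p.radius) :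
    0 < (algExt B p).radius := by
  obtain ⟨r, hr0, hr⟩ := ENNReal.lt_iff_exists_nnreal_btwn.1 hp
  have hr0' : 0 < r := by exact_mod_cast hr0
  obtain ⟨C, hC, hb⟩ := p.norm_mul_pow_le_of_lt_radius hr
  have hs : (0 : NNReal) < r / (N + 1) := by positivity
  refine lt_of_lt_of_le (by exact_mod_cast hs : (0 : ENNReal) < (r / (N + 1) : NNReal)) ?_
  refine (algExt B p).le_radius_of_bound C fun k => ?_
  have h1 : ‖algExt B p k‖ ≤ (N + 1 : ℝ) ^ k * ‖p k‖ := by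
    calc ‖algExt B p k‖ ≤ ∑ i : Fin k → Fin N, ‖p k‖ := by
          unfold algExt
          refine norm_sum_le_of_le (E := ContinuousMultilinearMap ℝ (fun _ : Fin k => Fin N → B) B) _ fun i _ => ?_
          refine (ContinuousMultilinearMap.opNorm_smul_le _ _).trans ?_
          have e1 : ‖p k (fun j => Pi.single (i j) 1)‖ ≤ ‖p k‖ := by
            refine ((p k).le_opNorm _).trans ?_
            simp [Pi.norm_single]
          have e2 : ‖(ContinuousMultilinearMap.mkPiAlgebraFin ℝ k B).compContinuousLinearMap
              (fun j => (ContinuousLinearMap.proj (i j) : (Fin N → B) →L[ℝ] B))‖ ≤ 1 := by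
            refine (ContinuousMultilinearMap.norm_compContinuousLinearMap_le _ _).trans ?_
            rw [ContinuousMultilinearMap.norm_mkPiAlgebraFin, one_mul]
            refine Finset.prod_le_one (fun _ _ => norm_nonneg _) fun j _ => ?_
            refine ContinuousLinearMap.opNorm_le_bound _ zero_le_one fun x => ?_
            simpa using norm_le_pi_norm x (i j)
          calc _ ≤ ‖p k‖ * 1 := by gcongr
            _ = _ := mul_one _
      _ = (N : ℝ) ^ k * ‖p k‖ := by simp
      _ ≤ _ := by gcongr; linarith
  calc ‖algExt B p k‖ * ((r / (N + 1) : NNReal) : ℝ) ^ k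
      ≤ ((N + 1 : ℝ) ^ k * ‖p k‖) * ((r / (N + 1) : NNReal) : ℝ) ^ k := by gcongr
    _ = ‖p k‖ * r ^ k := by
        push_cast
        rw [div_pow]
        field_simp
    _ ≤ C := hb k

lemma eval_prod_ofFn {N : ℕ} {E : Type*} [NormedAddCommGroup E] [NormedSpace ℝ E]
    (ev : E →L[ℝ] ℝ) (a : Fin N → (E →L[ℝ] E)) (v : Fin N → ℝ)
    (h : ∀ i e, ev (a i e) = v i * ev e) (k : ℕ) (i : Fin k → Fin N) (e : E) :
    ev ((List.ofFn fun j => a (i j)).prod e) = (∏ j, v (i j)) * ev e := by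
  induction k with
  | zero => simp
  | succ k ih =>
    rw [List.ofFn_succ, List.prod_cons, Fin.prod_univ_succ, mul_apply_eq_comp, h,
      ih (fun j => i j.succ), mul_assoc]

lemma multilinear_diag_expand {N : ℕ} (p : FormalMultilinearSeries ℝ (Fin N → ℝ) ℝ) (k : ℕ)
    (v : Fin N → ℝ) : p k (fun _ => v) =
      ∑ i : Fin k → Fin N, p k (fun j => Pi.single (i j) 1) * ∏ j, v (i j) := by
  have hv : v = ∑ i, v i • (Pi.single i 1 : Fin N → ℝ) := by
    ext j; simp [Finset.sum_apply, Pi.single_apply]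
  conv_lhs => rw [hv]
  rw [ContinuousMultilinearMap.map_sum]
  refine Finset.sum_congr rfl fun i _ => ?_
  rw [ContinuousMultilinearMap.map_smul_univ, smul_eq_mul, mul_comm]

lemma eval_algExt_sum {N : ℕ} {E : Type*} [NormedAddCommGroup E] [NormedSpace ℝ E] [CompleteSpace E]
    (p : FormalMultilinearSeries ℝ (Fin N → ℝ) ℝ)
    (ev : E →L[ℝ] ℝ) (a : Fin N → (E →L[ℝ] E)) (v : Fin N → ℝ)
    (h : ∀ i e, ev (a i e) = v i * ev e)
    (ha : a ∈ Metric.eball (0 : Fin N → (E →L[ℝ] E)) (algExt (E →L[ℝ] E) p).radius)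
    (hv : v ∈ Metric.eball (0 : Fin N → ℝ) p.radius) (e : E) :
    ev ((algExt (E →L[ℝ] E) p).sum a e) = p.sum v * ev e := by
  have h1 := (algExt (E →L[ℝ] E) p).hasSum ha
  have h2 := (p.hasSum hv).mul_right (ev e)
  have h3 := ((ev.comp (ContinuousLinearMap.apply ℝ E e)).hasSum h1)
  refine h3.unique (h2.congr_fun fun k => ?_)
  simp only [ContinuousLinearMap.comp_apply, ContinuousLinearMap.apply_apply, algExt_apply,
    multilinear_diag_expand p k v, map_sum, Finset.sum_mul]
  refine Finset.sum_congr rfl fun i _ => ?_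
  rw [smul_apply, map_smul, eval_prod_ofFn ev a v h, smul_eq_mul, mul_assoc]

end

section

open scoped ContDiff Topology BoundedContinuousFunction
open Filter Set

/-- The backward shift on bounded sequences. -/
def bshift : (ℕ →ᵇ ℝ) →L[ℝ] (ℕ →ᵇ ℝ) :=
  LinearMap.mkContinuous
    { toFun := fun a => a.compContinuous ⟨fun k => k + 1, continuous_of_discreteTopology⟩
      map_add' := fun a b => by ext; simp
      map_smul' := fun c a => by ext; simp } 1 fun a => by
    rw [one_mul]
    exact (BoundedContinuousFunction.norm_le (norm_nonneg _)).2 fun k => a.norm_coe_le_norm (k + 1)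

/-- The forward shift on bounded sequences. -/
def fshift : (ℕ →ᵇ ℝ) →L[ℝ] (ℕ →ᵇ ℝ) :=
  LinearMap.mkContinuous
    { toFun := fun a => BoundedContinuousFunction.ofNormedAddCommGroupDiscrete
        (fun k => Nat.casesOn k 0 fun j => a j) ‖a‖ (fun k => by
          cases k with
          | zero => simp
          | succ j => exact a.norm_coe_le_norm j)
      map_add' := fun a b => by ext k; cases k <;> simp
      map_smul' := fun c a => by ext k; cases k <;> simp } 1 fun a => by
    rw [one_mul]
    refine (BoundedContinuousFunction.norm_le (norm_nonneg _)).2 fun k => ?_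
    cases k with
    | zero => simp
    | succ j => exact a.norm_coe_le_norm j

/-- The first unit sequence. -/
def unitSeq : ℕ →ᵇ ℝ :=
  BoundedContinuousFunction.ofNormedAddCommGroupDiscrete
    (fun k => Nat.casesOn k 1 fun _ => 0) 1 (fun k => by cases k <;> simp)

/-- Evaluation at index zero. -/
def headSeq : (ℕ →ᵇ ℝ) →L[ℝ] ℝ := BoundedContinuousFunction.evalCLM ℝ 0

lemma bshift_fshift (a : ℕ →ᵇ ℝ) : bshift (fshift a) = a := by
  ext k; rfl

lemma headSeq_fshift (a : ℕ →ᵇ ℝ) : headSeq (fshift a) = 0 := rfl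

lemma headSeq_unitSeq : headSeq unitSeq = 1 := rfl

lemma bshift_unitSeq : bshift unitSeq = 0 := by
  ext k; rfl

lemma seq_decomp (a : ℕ →ᵇ ℝ) : a = headSeq a • unitSeq + fshift (bshift a) := by
  ext k
  cases k with
  | zero =>
    have : (fshift (bshift a)) 0 = 0 := rfl
    have h2 : unitSeq 0 = 1 := rfl
    simp [this, h2]; rfl
  | succ j =>
    have : (fshift (bshift a)) (j + 1) = a (j + 1) := rfl
    have h2 : unitSeq (j + 1) = 0 := rfl
    simp [this, h2]

lemma norm_fshift_le : ‖fshift‖ ≤ 1 := LinearMap.mkContinuous_norm_le _ zero_le_one _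

/-- A Banach space of sequences with forward and backward shifts. -/
structure ShiftSpace (E : Type*) [NormedAddCommGroup E] [NormedSpace ℝ E] where
  fwd : E →L[ℝ] E
  bwd : E →L[ℝ] E
  unit : E
  head : E →L[ℝ] ℝ
  bwd_fwd : ∀ a, bwd (fwd a) = a
  head_fwd : ∀ a, head (fwd a) = 0
  head_unit : head unit = 1
  bwd_unit : bwd unit = 0
  decomp : ∀ a, a = head a • unit + fwd (bwd a)
  norm_fwd_le : ‖fwd‖ ≤ 1

/-- Bounded sequences form a shift space. -/
def boundedShiftSpace : ShiftSpace (ℕ →ᵇ ℝ) where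
  fwd := fshift
  bwd := bshift
  unit := unitSeq
  head := headSeq
  bwd_fwd := bshift_fshift
  head_fwd := headSeq_fshift
  head_unit := headSeq_unitSeq
  bwd_unit := bshift_unitSeq
  decomp := seq_decomp
  norm_fwd_le := norm_fshift_le

namespace ShiftSpace

variable {E : Type*} [NormedAddCommGroup E] [NormedSpace ℝ E] (X : ShiftSpace E)

/-- The map `(q, r) ↦ S ^ m q + ∑ r_i S ^ i e`. -/
def shiftDiv (S : E →L[ℝ] E) (m : ℕ) (q : E) (r : Fin m → ℝ) : E :=
  (S ^ m) q + ∑ i : Fin m, r i • (S ^ (i : ℕ)) X.unit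

lemma shiftDiv_succ (S : E →L[ℝ] E) (m : ℕ) (q : E) (r : Fin (m + 1) → ℝ) :
    X.shiftDiv S (m + 1) q r = r 0 • X.unit + S (X.shiftDiv S m q (fun i => r i.succ)) := by
  simp only [shiftDiv, Fin.sum_univ_succ, pow_succ', map_add, map_sum, map_smul, Fin.val_zero,
    pow_zero, Fin.val_succ, mul_apply_eq_comp, one_apply_eq_self]
  abel

lemma shiftDiv_inj {ρ : ℝ} (hρ : ρ ≠ 0) (m : ℕ) (q : E) (r : Fin m → ℝ)
    (h : X.shiftDiv (ρ • X.fwd) m q r = 0) : q = 0 ∧ r = 0 := by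
  induction m with
  | zero =>
    constructor
    · simpa [shiftDiv] using h
    · exact Subsingleton.elim _ _
  | succ m ih =>
    rw [shiftDiv_succ] at h
    have h0 : r 0 = 0 := by
      have := congrArg X.head h
      simpa [X.head_fwd, X.head_unit] using this
    have h1 : X.shiftDiv (ρ • X.fwd) m q (fun i => r i.succ) = 0 := by
      have := congrArg X.bwd h
      simpa [X.bwd_unit, X.bwd_fwd, h0, hρ] using this
    obtain ⟨hq, hr⟩ := ih _ h1
    refine ⟨hq, funext fun i => ?_⟩
    refine Fin.cases h0 (fun j => congrFun hr j) i

lemma shiftDiv_surj {ρ : ℝ} (hρ : ρ ≠ 0) (m : ℕ) (a : E) :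
    ∃ q r, X.shiftDiv (ρ • X.fwd) m q r = a := by
  induction m generalizing a with
  | zero => exact ⟨a, 0, by simp [shiftDiv]⟩
  | succ m ih =>
    obtain ⟨q, r, h⟩ := ih (ρ⁻¹ • X.bwd a)
    refine ⟨q, Fin.cons (X.head a) r, ?_⟩
    rw [shiftDiv_succ]
    simp only [Fin.cons_zero, Fin.cons_succ]
    rw [h]
    simp only [smul_apply, map_smul, smul_smul, inv_mul_cancel₀ hρ, one_smul]
    exact (X.decomp a).symm

variable [CompleteSpace E]

/-- Evaluation of the sequence `a` as a power series in `t`. -/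
def eval (t : ℝ) : E →L[ℝ] ℝ := X.head ∘L Ring.inverse (1 - t • X.bwd)

lemma eval_eventually :
    ∀ᶠ t : ℝ in 𝓝 0, ∀ a, X.eval t a = X.head a + t * X.eval t (X.bwd a) := by
  have hc : ContinuousAt (fun t : ℝ => (1 - t • X.bwd)) 0 := by fun_prop
  have h1 : ∀ᶠ t : ℝ in 𝓝 0, IsUnit (1 - t • X.bwd) :=
    hc.eventually_mem (Units.isOpen.mem_nhds (by simp))
  filter_upwards [h1] with t ht a
  have h2 : Ring.inverse (1 - t • X.bwd) = 1 + t • (Ring.inverse (1 - t • X.bwd) * X.bwd) := by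
    have := Ring.inverse_mul_cancel _ ht
    rw [mul_sub, mul_one, mul_smul_comm] at this
    exact sub_eq_iff_eq_add.1 this
  have h3 := congrArg (fun T => X.head (T a)) h2
  simpa [eval] using h3

lemma eval_analyticAt : AnalyticAt ℝ X.eval 0 := by
  have h1 : AnalyticAt ℝ (fun t : ℝ => (1 - t • X.bwd)) 0 := by fun_prop
  have h2 : AnalyticAt ℝ (Ring.inverse : (E →L[ℝ] E) → _) (1 - (0:ℝ) • X.bwd) := by
    have := analyticAt_inverse (𝕜 := ℝ) (1 : (E →L[ℝ] E)ˣ)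
    simpa using this
  have h3 := h2.comp_of_eq h1 rfl
  exact ((ContinuousLinearMap.compL ℝ E E ℝ X.head).analyticAt _).comp h3

lemma eval_fwd {ρ : ℝ} (hρ : ρ ≠ 0) : ∀ᶠ x : ℝ in 𝓝 0, (∀ a, X.eval (x / ρ) ((ρ • X.fwd) a) =
    x * X.eval (x / ρ) a) ∧ X.eval (x / ρ) X.unit = 1 := by
  have h : Tendsto (fun x : ℝ => x / ρ) (𝓝 0) (𝓝 0) := by
    have : ContinuousAt (fun x : ℝ => x / ρ) 0 := by fun_prop
    simpa [ContinuousAt] using this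
  filter_upwards [h.eventually X.eval_eventually] with x hx
  refine ⟨fun a => ?_, ?_⟩
  · rw [hx]
    simp only [smul_apply, map_smul, X.head_fwd, X.bwd_fwd, smul_eq_mul]
    field_simp
    ring
  · rw [hx, X.bwd_unit, X.head_unit]; simp

end ShiftSpace

end

section

open scoped ContDiff Topology BoundedContinuousFunction
open Filter Set

lemma eventually_hasSum_pow_mul_unit {B : Type*} [NormedRing B] [NormedAlgebra ℝ B]
    [NormOneClass B] [CompleteSpace B] {c : ℕ → ℝ} {r : NNReal} (hr : 0 < r) {C : ℝ}
    (hC : ∀ k, ‖c k‖ * (r : ℝ) ^ k ≤ C) {m : ℕ} (hm : c m ≠ 0) (hlt : ∀ k < m, c k = 0) :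
    ∀ᶠ S in 𝓝 (0 : B), ∃ U, IsUnit U ∧ HasSum (fun k => c k • S ^ k) (S ^ m * U) := by
  set u := FormalMultilinearSeries.ofScalars B (fun j => c (m + j)) with hu
  have hrad : (r : ENNReal) ≤ u.radius := by
    refine u.le_radius_of_bound (C / (r : ℝ) ^ m) fun k => ?_
    rw [hu, FormalMultilinearSeries.ofScalars_norm, le_div_iff₀ (by positivity)]
    calc _ = ‖c (m + k)‖ * (r : ℝ) ^ (m + k) := by rw [pow_add]; ring
      _ ≤ C := hC _
  have hpos : 0 < u.radius := lt_of_lt_of_le (by exact_mod_cast hr) hrad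
  have hball := u.hasFPowerSeriesOnBall hpos
  have hcont : ContinuousAt u.sum 0 := hball.continuousOn.continuousAt (Metric.eball_mem_nhds _ hpos)
  have h0 : u.sum 0 = c m • 1 := by
    have := FormalMultilinearSeries.ofScalarsSum_zero (E := B) (fun j => c (m + j))
    simpa [FormalMultilinearSeries.ofScalarsSum] using this
  have hunit : IsUnit (u.sum 0) := by
    rw [h0, ← Algebra.algebraMap_eq_smul_one]
    exact (IsUnit.mk0 _ hm).map _
  filter_upwards [hcont.eventually_mem (Units.isOpen.mem_nhds hunit), Metric.eball_mem_nhds _ hpos]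
    with S hS hSr
  refine ⟨u.sum S, hS, ?_⟩
  have h1 := (u.hasSum hSr).mul_left (S ^ m)
  simp only [hu, FormalMultilinearSeries.ofScalars_apply_eq, mul_smul_comm, ← pow_add] at h1
  rw [← hu] at h1
  have h2 := (hasSum_nat_add_iff' (f := fun k => c k • S ^ k) m
    (g := S ^ m * u.sum S)).1 
  refine h2 ?_
  rw [Finset.sum_eq_zero (fun k hk => by rw [hlt k (Finset.mem_range.1 hk), zero_smul]), sub_zero]
  simpa only [add_comm m] using h1

lemma algExt_cons_zero {n : ℕ} (B : Type*) [NormedRing B] [NormedAlgebra ℝ B]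
    (p : FormalMultilinearSeries ℝ (Fin (n + 1) → ℝ) ℝ) (k : ℕ) (S : B) :
    algExt B p k (fun _ => (Fin.cons S 0 : Fin (n + 1) → B)) =
      p k (fun _ => Pi.single 0 1) • S ^ k := by
  rw [algExt_apply, Finset.sum_eq_single (fun _ => 0)]
  · simp
  · intro i _ hi
    obtain ⟨j, hj⟩ := Function.ne_iff.1 hi
    have : (List.ofFn fun j => (Fin.cons S 0 : Fin (n + 1) → B) (i j)).prod = 0 := by
      have hmem : (0 : B) ∈ List.ofFn fun j => (Fin.cons S 0 : Fin (n + 1) → B) (i j) := by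
        rw [List.mem_ofFn]
        obtain ⟨l, hl⟩ := Fin.exists_succ_eq_of_ne_zero hj
        exact ⟨j, by simp [← hl]⟩
      exact List.prod_eq_zero hmem
    rw [this, smul_zero]
  · simp

lemma analyticAt_algExt_cons {n : ℕ} {B : Type*} [NormedRing B] [NormedAlgebra ℝ B]
    [CompleteSpace B] (p : FormalMultilinearSeries ℝ (Fin (n + 1) → ℝ) ℝ) {S : B}
    (hS : ‖S‖ₑ < (algExt B p).radius) :
    AnalyticAt ℝ (fun y : Fin n → ℝ => (algExt B p).sum
      (Fin.cons S (fun j => y j • 1) : Fin (n + 1) → B)) 0 ∧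
    ∀ᶠ y : Fin n → ℝ in 𝓝 0, (Fin.cons S (fun j => y j • 1) : Fin (n + 1) → B) ∈
      Metric.eball 0 (algExt B p).radius := by
  have hpos : 0 < (algExt B p).radius := lt_of_le_of_lt (zero_le) hS
  have haff : AnalyticAt ℝ (fun y : Fin n → ℝ =>
      (Fin.cons S (fun j => y j • 1) : Fin (n + 1) → B)) 0 := by
    rw [analyticAt_pi_iff]
    intro i
    refine Fin.cases ?_ (fun j => ?_) i
    · simp only [Fin.cons_zero]; fun_prop
    · simp only [Fin.cons_succ]
      exact ((ContinuousLinearMap.proj (R := ℝ) (φ := fun _ : Fin n => ℝ) j).analyticAt 0).smul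
        analyticAt_const
  have hmem : (Fin.cons S (fun j => (0 : Fin n → ℝ) j • 1) : Fin (n + 1) → B) ∈
      Metric.eball 0 (algExt B p).radius := by
    rw [Metric.mem_eball, edist_zero_right]
    have : (Fin.cons S (fun j => (0 : Fin n → ℝ) j • 1) : Fin (n + 1) → B) = Pi.single 0 S := by
      ext i
      refine Fin.cases ?_ (fun j => ?_) i <;> simp
    rw [this]
    rwa [Pi.enorm_single]
  refine ⟨?_, haff.continuousAt.eventually_mem (Metric.isOpen_eball.mem_nhds hmem)⟩
  exact AnalyticAt.comp (g := (algExt B p).sum)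
    (f := fun y : Fin n → ℝ => (Fin.cons S (fun j => y j • 1) : Fin (n + 1) → B))
    (((algExt B p).hasFPowerSeriesOnBall hpos).analyticAt_of_mem hmem) haff

/-- The partial sums of power series coefficients along the first axis detect vanishing. -/
lemma exists_axis_coeff_ne_zero {n : ℕ} {g : (Fin (n + 1) → ℝ) → ℝ}
    {p : FormalMultilinearSeries ℝ (Fin (n + 1) → ℝ) ℝ} (hp : HasFPowerSeriesAt g p 0)
    (hg : ¬ ∀ᶠ t : ℝ in 𝓝 0, g (Pi.single 0 t) = 0) :
    ∃ m, p m (fun _ => Pi.single 0 1) ≠ 0 := by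
  by_contra! h
  apply hg
  have ht : Tendsto (fun t : ℝ => (Pi.single 0 t : Fin (n + 1) → ℝ)) (𝓝 0) (𝓝 0) := by
    have : ContinuousAt (fun t : ℝ => (Pi.single 0 t : Fin (n + 1) → ℝ)) 0 := by
      exact (continuous_single 0).continuousAt
    simpa [ContinuousAt] using this
  filter_upwards [ht.eventually hp.eventually_hasSum] with t h1
  rw [zero_add] at h1
  refine h1.unique ?_
  convert hasSum_zero with k
  have : (Pi.single 0 t : Fin (n + 1) → ℝ) = t • Pi.single 0 1 := by
    rw [← Pi.single_smul]; simp
  rw [this, ContinuousMultilinearMap.map_smul_univ, h k, smul_zero]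

lemma AnalyticAt.clm_apply' {V E F : Type*} [NormedAddCommGroup V] [NormedSpace ℝ V]
    [NormedAddCommGroup E] [NormedSpace ℝ E] [NormedAddCommGroup F] [NormedSpace ℝ F]
    {T : V → E →L[ℝ] F} {u : V → E} {x : V} (hT : AnalyticAt ℝ T x) (hu : AnalyticAt ℝ u x) :
    AnalyticAt ℝ (fun v => T v (u v)) x :=
  (ContinuousLinearMap.analyticAt_bilinear (ContinuousLinearMap.id ℝ (E →L[ℝ] F)) (T x, u x)).comp
    (f := fun v => (T v, u v)) (hT.prod hu)

lemma ShiftSpace.division {E : Type*} [NormedAddCommGroup E] [NormedSpace ℝ E] [CompleteSpace E]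
    (X : ShiftSpace E) {n : ℕ} {f g : (Fin (n + 1) → ℝ) → ℝ}
    {pf pg : FormalMultilinearSeries ℝ (Fin (n + 1) → ℝ) ℝ} (hpf : HasFPowerSeriesAt f pf 0)
    (hpg : HasFPowerSeriesAt g pg 0) {m : ℕ} (hm : pg m (fun _ => Pi.single 0 1) ≠ 0)
    (hlt : ∀ k < m, pg k (fun _ => Pi.single 0 1) = 0) :
    ∃ (q : (Fin (n + 1) → ℝ) → ℝ) (r : Fin m → (Fin n → ℝ) → ℝ), AnalyticAt ℝ q 0 ∧
        (∀ i, AnalyticAt ℝ (r i) 0) ∧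
        ∀ᶠ v in 𝓝 0, f v = q v * g v + ∑ i, r i (Fin.tail v) * v 0 ^ (i : ℕ) := by
  have hne : X.unit ≠ 0 := fun h => by simpa [h] using X.head_unit
  have : Nontrivial E := ⟨⟨_, _, hne⟩⟩
  -- choice of the scale
  obtain ⟨R, hR0, hR⟩ := ENNReal.lt_iff_exists_nnreal_btwn.1 hpg.radius_pos
  obtain ⟨C, -, hC⟩ := pg.norm_mul_pow_le_of_lt_radius hR
  have hC' : ∀ k, ‖pg k (fun _ => Pi.single 0 1)‖ * (R : ℝ) ^ k ≤ C := fun k => by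
    refine le_trans ?_ (hC k)
    gcongr
    refine ((pg k).le_opNorm _).trans ?_
    simp [Pi.norm_single]
  have hfr := algExt_radius_pos (E →L[ℝ] E) pf hpf.radius_pos
  have hgr := algExt_radius_pos (E →L[ℝ] E) pg hpg.radius_pos
  have hev : ∀ᶠ S in 𝓝 (0 : E →L[ℝ] E), ‖S‖ₑ < (algExt (E →L[ℝ] E) pf).radius ∧
      ‖S‖ₑ < (algExt (E →L[ℝ] E) pg).radius ∧ ∃ U, IsUnit U ∧
        HasSum (fun k => pg k (fun _ => Pi.single 0 1) • S ^ k) (S ^ m * U) := by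
    refine Eventually.and ?_ (Eventually.and ?_ (eventually_hasSum_pow_mul_unit
      (by exact_mod_cast hR0) hC' hm hlt))
    · filter_upwards [Metric.eball_mem_nhds (0 : E →L[ℝ] E) hfr] with S hS
      simpa [Metric.mem_eball] using hS
    · filter_upwards [Metric.eball_mem_nhds (0 : E →L[ℝ] E) hgr] with S hS
      simpa [Metric.mem_eball] using hS
  have hlim : Tendsto (fun ρ : ℝ => ρ • X.fwd) (𝓝[≠] 0) (𝓝 0) := by
    have : ContinuousAt (fun ρ : ℝ => ρ • X.fwd) 0 := by fun_prop
    have h2 := this.tendsto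
    rw [zero_smul] at h2
    exact h2.mono_left nhdsWithin_le_nhds
  obtain ⟨ρ, ⟨hSf, hSg, U, hU, hsum⟩, hρ⟩ :=
    ((hlim.eventually hev).and self_mem_nhdsWithin).exists
  replace hρ : ρ ≠ 0 := hρ
  set S := ρ • X.fwd with hS
  obtain ⟨hFa, hFm⟩ := analyticAt_algExt_cons pf hSf
  obtain ⟨hGa, hGm⟩ := analyticAt_algExt_cons pg hSg
  set F := fun y : Fin n → ℝ => (algExt (E →L[ℝ] E) pf).sum
      (Fin.cons S (fun j => y j • 1) : Fin (n + 1) → (E →L[ℝ] E)) with hF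
  set G := fun y : Fin n → ℝ => (algExt (E →L[ℝ] E) pg).sum
      (Fin.cons S (fun j => y j • 1) : Fin (n + 1) → (E →L[ℝ] E)) with hG
  have hG0 : G 0 = S ^ m * U := by
    have h1 := (algExt (E →L[ℝ] E) pg).hasSum hGm.self_of_nhds
    have h2 : (Fin.cons S (fun j => (0 : Fin n → ℝ) j • 1) : Fin (n + 1) → (E →L[ℝ] E)) =
        Fin.cons S 0 := by
      ext i
      refine Fin.cases ?_ (fun j => ?_) i <;> simp
    have h3 : G 0 = (algExt (E →L[ℝ] E) pg).sum
      (Fin.cons S 0 : Fin (n + 1) → (E →L[ℝ] E)) := by rw [← h2]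
    rw [h2] at h1
    simp only [algExt_cons_zero] at h1
    rw [h3]
    exact h1.unique hsum
  -- the division operator
  let ι : (Fin m → ℝ) →L[ℝ] E := LinearMap.toContinuousLinearMap
    { toFun := fun r => ∑ i : Fin m, r i • (S ^ (i : ℕ)) X.unit
      map_add' := fun a b => by simp [add_smul, Finset.sum_add_distrib]
      map_smul' := fun c a => by simp [Finset.smul_sum, smul_smul] }
  have hι : ∀ r, ι r = ∑ i : Fin m, r i • (S ^ (i : ℕ)) X.unit := fun r => rfl
  let T : (Fin n → ℝ) → (E × (Fin m → ℝ)) →L[ℝ] E := fun y =>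
    (G y) ∘L (ContinuousLinearMap.fst ℝ E (Fin m → ℝ)) + ι ∘L (ContinuousLinearMap.snd ℝ E (Fin m → ℝ))
  have hT : ∀ y q r, T y (q, r) = G y q + ι r := fun y q r => rfl
  have hTa : AnalyticAt ℝ T 0 := by
    refine AnalyticAt.add ?_ analyticAt_const
    exact (((ContinuousLinearMap.compL ℝ (E × (Fin m → ℝ)) E E).flip
      (ContinuousLinearMap.fst ℝ E (Fin m → ℝ))).analyticAt _).comp hGa
  have hT0 : ∀ q r, T 0 (q, r) = X.shiftDiv S m (U q) r := fun q r => by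
    rw [hT, hG0, hι, ShiftSpace.shiftDiv]; rfl
  obtain ⟨U', rfl⟩ := hU
  have hker : LinearMap.ker (T 0 : (E × (Fin m → ℝ)) →ₗ[ℝ] E) = ⊥ := by
    rw [LinearMap.ker_eq_bot']
    rintro ⟨q, r⟩ h
    obtain ⟨h1, h2⟩ := X.shiftDiv_inj hρ m _ r ((hT0 q r).symm.trans h)
    have h3 : q = (↑(U'⁻¹) : E →L[ℝ] E) ((U' : E →L[ℝ] E) q) := by
      rw [← mul_apply_eq_comp, Units.inv_mul]; rfl
    rw [h1, map_zero] at h3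
    rw [h3, h2]; rfl
  have hrange : LinearMap.range (T 0 : (E × (Fin m → ℝ)) →ₗ[ℝ] E) = ⊤ := by
    rw [LinearMap.range_eq_top]
    intro a
    obtain ⟨q, r, h⟩ := X.shiftDiv_surj hρ m a
    refine ⟨((↑(U'⁻¹) : E →L[ℝ] E) q, r), ?_⟩
    refine (hT0 _ r).trans ?_
    rw [← mul_apply_eq_comp, Units.mul_inv]
    exact h
  let e := ContinuousLinearEquiv.ofBijective (T 0) hker hrange
  have he : (e : (E × (Fin m → ℝ)) →L[ℝ] E) = T 0 := by ext x <;> rfl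
  have hInv : AnalyticAt ℝ (fun y => ContinuousLinearMap.inverse (T y)) 0 := by
    have h1 : AnalyticAt ℝ (ContinuousLinearMap.inverse : ((E × (Fin m → ℝ)) →L[ℝ] E) → _) (T 0) := by
      rw [← he]
      exact ContDiffAt.analyticAt (contDiffAt_map_inverse e)
    exact h1.comp hTa
  have hTi : ∀ᶠ y in 𝓝 0, ∃ e' : (E × (Fin m → ℝ)) ≃L[ℝ] E, (e' : _ →L[ℝ] E) = T y := by
    have := e.nhds
    rw [he] at this
    exact hTa.continuousAt.eventually_mem this
  set Z := fun y => ContinuousLinearMap.inverse (T y) (F y X.unit) with hZ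
  have hZa : AnalyticAt ℝ Z 0 := by
    have h1 : AnalyticAt ℝ (fun y => F y X.unit) 0 :=
      ((ContinuousLinearMap.apply ℝ E X.unit).analyticAt _).comp hFa
    exact AnalyticAt.clm_apply' hInv h1
  have htail : ContinuousAt (fun v : Fin (n + 1) → ℝ => Fin.tail v) 0 :=
    (continuous_pi fun i => continuous_apply _).continuousAt
  have htail' : Tendsto (fun v : Fin (n + 1) → ℝ => Fin.tail v) (𝓝 0) (𝓝 0) := htail
  have hhead : Tendsto (fun v : Fin (n + 1) → ℝ => v 0) (𝓝 0) (𝓝 0) :=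
    (continuous_apply (A := fun _ : Fin (n + 1) => ℝ) 0).continuousAt
  have htaila : AnalyticAt ℝ (fun v : Fin (n + 1) → ℝ => Fin.tail v) 0 := by
    rw [analyticAt_pi_iff]
    intro i
    exact (ContinuousLinearMap.proj (R := ℝ) (φ := fun _ : Fin (n + 1) => ℝ) i.succ).analyticAt 0
  have hheada : AnalyticAt ℝ (fun v : Fin (n + 1) → ℝ => v 0 / ρ) 0 :=
    ((ContinuousLinearMap.proj (R := ℝ) (φ := fun _ : Fin (n + 1) => ℝ) 0).analyticAt 0).div_const
  refine ⟨fun v => X.eval (v 0 / ρ) (Z (Fin.tail v)).1, fun i y => (Z y).2 i, ?_, ?_, ?_⟩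
  · have h1 : AnalyticAt ℝ (fun v : Fin (n + 1) → ℝ => X.eval (v 0 / ρ)) 0 :=
      X.eval_analyticAt.comp_of_eq hheada (by simp)
    have h2 : AnalyticAt ℝ (fun v : Fin (n + 1) → ℝ => Z (Fin.tail v)) 0 := hZa.comp_of_eq htaila rfl
    exact AnalyticAt.clm_apply' h1 (((ContinuousLinearMap.fst ℝ E (Fin m → ℝ)).analyticAt _).comp h2)
  · intro i
    exact (((ContinuousLinearMap.proj (R := ℝ) (φ := fun _ : Fin m => ℝ) i) ∘L
      (ContinuousLinearMap.snd ℝ E (Fin m → ℝ))).analyticAt _).comp hZa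
  · filter_upwards [hhead.eventually (X.eval_fwd hρ), htail'.eventually hTi, htail'.eventually hFm,
      htail'.eventually hGm, hpf.eventually_hasSum, hpg.eventually_hasSum,
      Metric.eball_mem_nhds (0 : Fin (n + 1) → ℝ) hpf.radius_pos,
      Metric.eball_mem_nhds (0 : Fin (n + 1) → ℝ) hpg.radius_pos]
      with v hx hTv hFv hGv hfv hgv hvf hvg
    obtain ⟨hx1, hx2⟩ := hx
    obtain ⟨e', he'⟩ := hTv
    have hi : T (Fin.tail v) (Z (Fin.tail v)) = F (Fin.tail v) X.unit := by
      rw [hZ]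
      simp only
      rw [← he', ContinuousLinearMap.inverse_equiv]
      simp
    have hcons : ∀ i a, X.eval (v 0 / ρ)
        ((Fin.cons S (fun j => (Fin.tail v) j • 1) : Fin (n + 1) → (E →L[ℝ] E)) i a) =
        v i * X.eval (v 0 / ρ) a := by
      intro i a
      refine Fin.cases ?_ (fun j => ?_) i
      · exact hx1 a
      · simp [Fin.tail]
    have e1 := eval_algExt_sum pf (X.eval (v 0 / ρ)) _ v hcons hFv hvf X.unit
    have e2 := eval_algExt_sum pg (X.eval (v 0 / ρ)) _ v hcons hGv hvg (Z (Fin.tail v)).1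
    have e3 : f v = pf.sum v := by
      rw [zero_add] at hfv
      exact hfv.tsum_eq.symm
    have e4 : g v = pg.sum v := by
      rw [zero_add] at hgv
      exact hgv.tsum_eq.symm
    have e5 : ∀ k : ℕ, X.eval (v 0 / ρ) ((S ^ k) X.unit) = v 0 ^ k := by
      intro k
      induction k with
      | zero => simpa using hx2
      | succ k ih => rw [pow_succ', mul_apply_eq_comp, hx1, ih, pow_succ']
    have e6 := congrArg (X.eval (v 0 / ρ)) hi
    have e7 : T (Fin.tail v) (Z (Fin.tail v)) =
      G (Fin.tail v) (Z (Fin.tail v)).1 + ι (Z (Fin.tail v)).2 := hT _ _ _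
    rw [e7, map_add, e1, e2, hι, map_sum] at e6
    simp only [map_smul, e5, smul_eq_mul, hx2, mul_one] at e6
    rw [e3, e4, ← e6]
    ring

/-- Weierstrass division (existence) for real-analytic germs. -/
theorem weierstrass_division {n : ℕ} {g : (Fin (n + 1) → ℝ) → ℝ} (hg : AnalyticAt ℝ g 0)
    (hreg : ¬ ∀ᶠ t : ℝ in 𝓝 0, g (Pi.single 0 t) = 0) :
    ∃ m : ℕ, ∀ f : (Fin (n + 1) → ℝ) → ℝ, AnalyticAt ℝ f 0 →
      ∃ (q : (Fin (n + 1) → ℝ) → ℝ) (r : Fin m → (Fin n → ℝ) → ℝ), AnalyticAt ℝ q 0 ∧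
        (∀ i, AnalyticAt ℝ (r i) 0) ∧
        ∀ᶠ v in 𝓝 0, f v = q v * g v + ∑ i, r i (Fin.tail v) * v 0 ^ (i : ℕ) := by
  classical
  obtain ⟨pg, hpg⟩ := hg
  have hex := exists_axis_coeff_ne_zero hpg hreg
  set m := Nat.find hex with hmdef
  refine ⟨m, fun f hf => ?_⟩
  obtain ⟨pf, hpf⟩ := hf
  have hm : pg m (fun _ => Pi.single 0 1) ≠ 0 := Nat.find_spec hex
  have hlt : ∀ k < m, pg k (fun _ => Pi.single 0 1) = 0 := fun k hk => by
    simpa using Nat.find_min hex hk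
  exact boundedShiftSpace.division hpf hpg hm hlt

end

section

open scoped ContDiff Topology
open Filter Set

section Germs

variable {V : Type*} [NormedAddCommGroup V] [NormedSpace ℝ V]

variable (V) in
/-- The algebra of functions that are real-analytic at the origin. -/
def analyticAlg : Subalgebra ℝ (V → ℝ) where
  carrier := {f | AnalyticAt ℝ f 0}
  mul_mem' := fun h1 h2 => AnalyticAt.mul h1 h2
  add_mem' := fun h1 h2 => AnalyticAt.add h1 h2
  algebraMap_mem' := fun _ => analyticAt_const

/-- The derivative in the direction `v`. -/
def dirDeriv (v : V) (f : analyticAlg V) : analyticAlg V :=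
  ⟨fun x => fderiv ℝ (f : V → ℝ) x v, by
    obtain ⟨f, hf⟩ := f
    exact ((ContinuousLinearMap.apply ℝ ℝ v).analyticAt _).comp (AnalyticAt.fderiv hf)⟩

lemma eventually_differentiableAt (f : analyticAlg V) :
    ∀ᶠ x in 𝓝 (0 : V), DifferentiableAt ℝ (f : V → ℝ) x := by
  have hf : AnalyticAt ℝ (f : V → ℝ) 0 := f.2
  filter_upwards [hf.eventually_analyticAt] with x hx using hx.differentiableAt

/-- A ring homomorphism on analytic functions that only depends on germs at the origin. -/
structure GermHom (V : Type*) [NormedAddCommGroup V] [NormedSpace ℝ V] (K : Type*) [Field K]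
    [Algebra ℝ K] where
  ev : analyticAlg V →ₐ[ℝ] K
  germ : ∀ f : analyticAlg V, (∀ᶠ x in 𝓝 0, (f : V → ℝ) x = 0) → ev f = 0

namespace GermHom

variable {K : Type*} [Field K] [Algebra ℝ K] (φ : GermHom V K)

lemma congr {f g : analyticAlg V} (h : ∀ᶠ x in 𝓝 0, (f : V → ℝ) x = (g : V → ℝ) x) :
    φ.ev f = φ.ev g := by
  rw [← sub_eq_zero, ← map_sub]
  exact φ.germ _ (h.mono fun x hx => sub_eq_zero.2 hx)

lemma dirDeriv_congr {f g : analyticAlg V} (h : ∀ᶠ x in 𝓝 0, (f : V → ℝ) x = (g : V → ℝ) x)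
    (v : V) : φ.ev (dirDeriv v f) = φ.ev (dirDeriv v g) := by
  refine φ.congr ?_
  filter_upwards [h.eventually_nhds] with x hx
  have : (f : V → ℝ) =ᶠ[𝓝 x] (g : V → ℝ) := hx
  simp only [dirDeriv]
  rw [this.fderiv_eq]

lemma dirDeriv_add (v : V) (f g : analyticAlg V) :
    φ.ev (dirDeriv v (f + g)) = φ.ev (dirDeriv v f) + φ.ev (dirDeriv v g) := by
  rw [← map_add]
  refine φ.congr ?_
  filter_upwards [eventually_differentiableAt f, eventually_differentiableAt g] with x hf hg
  have := fderiv_add hf hg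
  exact congrArg (fun L => L v) this

lemma dirDeriv_mul (v : V) (f g : analyticAlg V) :
    φ.ev (dirDeriv v (f * g)) = φ.ev f * φ.ev (dirDeriv v g) + φ.ev g * φ.ev (dirDeriv v f) := by
  rw [← map_mul, ← map_mul, ← map_add]
  refine φ.congr ?_
  filter_upwards [eventually_differentiableAt f, eventually_differentiableAt g] with x hf hg
  have := fderiv_mul hf hg
  exact congrArg (fun L => L v) this

lemma dirDeriv_algebraMap (v : V) (c : ℝ) :
    dirDeriv v (algebraMap ℝ (analyticAlg V) c) = 0 := by
  apply Subtype.ext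
  funext x
  show fderiv ℝ (fun _ => c) x v = 0
  simp

/-- Derivations of `K` compatible with directional derivatives of germs. -/
def Compatible (δ : Derivation ℝ K K) : Prop :=
  ∃ (ι : Type) (_ : Fintype ι) (c : ι → K) (v : ι → V),
    ∀ h, δ (φ.ev h) = ∑ i, c i * φ.ev (dirDeriv (v i) h)

/-- Every element killed by all compatible derivations is algebraic over `ℝ`. -/
def ConstAlgebraic : Prop :=
  ∀ z : K, (∀ δ, φ.Compatible δ → δ z = 0) → IsAlgebraic ℝ z

end GermHom

/-- Uniqueness of solutions of `w du = u dw`. -/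
lemma eventually_eq_const_mul [FiniteDimensional ℝ V] {u w : V → ℝ} (hu : AnalyticAt ℝ u 0)
    (hw : AnalyticAt ℝ w 0)
    (hw0 : ¬ ∀ᶠ x in 𝓝 0, w x = 0)
    (h : ∀ᶠ x in 𝓝 0, w x • fderiv ℝ u x = u x • fderiv ℝ w x) :
    ∃ c : ℝ, ∀ᶠ x in 𝓝 0, u x = c * w x := by
  obtain ⟨ε, hε, hball⟩ := Metric.eventually_nhds_iff_ball.1
    (h.and (hu.eventually_analyticAt.and hw.eventually_analyticAt))
  obtain ⟨x0, hx0, hwx0⟩ : ∃ x ∈ Metric.ball (0 : V) ε, w x ≠ 0 := by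
    by_contra! hc
    exact hw0 (Metric.eventually_nhds_iff_ball.2 ⟨ε, hε, hc⟩)
  have hne : ∀ᶠ x in 𝓝 x0, w x ≠ 0 ∧ x ∈ Metric.ball (0 : V) ε :=
    ((hball x0 hx0).2.2.continuousAt.eventually_ne hwx0).and
      (Metric.isOpen_ball.mem_nhds hx0)
  obtain ⟨η, hη, hη'⟩ := Metric.eventually_nhds_iff_ball.1 hne
  set c := u x0 / w x0
  refine ⟨c, ?_⟩
  have hq : ∀ x ∈ Metric.ball x0 η, u x / w x = c := by
    have hder : ∀ y ∈ Metric.ball x0 η, HasFDerivAt (fun y => u y * (w y)⁻¹) (0 : V →L[ℝ] ℝ) y := by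
      intro y hy
      obtain ⟨h1, h2⟩ := hη' y hy
      obtain ⟨h5, h3, h4⟩ := hball y h2
      have := h3.differentiableAt.hasFDerivAt.mul
        ((hasDerivAt_inv h1).comp_hasFDerivAt y h4.differentiableAt.hasFDerivAt)
      refine this.congr_fderiv ?_
      have h6 : fderiv ℝ u y = (w y)⁻¹ • (u y • fderiv ℝ w y) := by
        rw [← h5, smul_smul, inv_mul_cancel₀ h1, one_smul]
      rw [h6]
      ext v
      simp
      field_simp
      ring
    intro x hx
    exact Metric.isOpen_ball.is_const_of_fderiv_eq_zero (𝕜 := ℝ) (f := fun y => u y * (w y)⁻¹)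
      (convex_ball x0 η).isPreconnected
      (fun y hy => (hder y hy).differentiableAt.differentiableWithinAt)
      (fun y hy => (hder y hy).fderiv) hx (Metric.mem_ball_self hη)
  have hd : AnalyticOnNhd ℝ (fun x => u x - c * w x) (Metric.ball 0 ε) := fun x hx =>
    (hball x hx).2.1.sub (analyticAt_const.mul (hball x hx).2.2)
  have hz : (fun x => u x - c * w x) =ᶠ[𝓝 x0] 0 := by
    filter_upwards [Metric.ball_mem_nhds x0 hη] with x hx
    have h1 := hq x hx
    rw [div_eq_iff (hη' x hx).1] at h1
    simp [h1]
  have := hd.eqOn_zero_of_preconnected_of_eventuallyEq_zero (convex_ball 0 ε).isPreconnected hx0 hz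
  filter_upwards [Metric.ball_mem_nhds 0 hε] with x hx
  exact sub_eq_zero.1 (this hx)

end Germs

end

section

open scoped ContDiff Topology
open Filter Set

/-- Derivations extend along algebraic extensions into fields of characteristic zero. -/
lemma exists_derivation_extend {R K : Type*} [CommRing R] [IsDomain R] [Field K] [Algebra ℝ R]
    [Algebra ℝ K] [Algebra R K] [IsScalarTower ℝ R K] [FaithfulSMul R K] [Algebra.IsAlgebraic R K]
    (d : Derivation ℝ R K) : ∃ δ : Derivation ℝ K K, ∀ r, δ (algebraMap R K r) = d r := by
  let _ : Algebra (FractionRing R) K := FractionRing.liftAlgebra R K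
  have : IsScalarTower R (FractionRing R) K := FractionRing.isScalarTower_liftAlgebra R K
  have : CharZero R := charZero_of_injective_algebraMap (algebraMap ℝ R).injective
  have : CharZero (FractionRing R) :=
    charZero_of_injective_algebraMap (IsFractionRing.injective R (FractionRing R))
  have : Algebra.IsAlgebraic (FractionRing R) K :=
    (IsFractionRing.comap_isAlgebraic_iff (A := R)).1 inferInstance
  have : Algebra.FormallyEtale (FractionRing R) K := Algebra.FormallyEtale.of_isSeparable _ _
  have : Algebra.FormallyEtale R K := Algebra.FormallyEtale.comp R (FractionRing R) K
  let e := KaehlerDifferential.tensorKaehlerEquivOfFormallyEtale ℝ R K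
  let l : TensorProduct R K (Ω[R⁄ℝ]) →ₗ[K] K := LinearMap.liftBaseChange K d.liftKaehlerDifferential
  refine ⟨(l ∘ₗ e.symm.toLinearMap).compDer (KaehlerDifferential.D ℝ K), fun r => ?_⟩
  have h := KaehlerDifferential.tensorKaehlerEquivOfFormallyEtale_symm_D_algebraMap ℝ R K r
  refine (congrArg l h).trans ?_
  simp [l]

namespace GermHom

variable {V : Type*} [NormedAddCommGroup V] [NormedSpace ℝ V]
variable {K : Type*} [Field K] [Algebra ℝ K] (φ : GermHom V K)

/-- The homomorphism only kills vanishing germs. -/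
def GermInjective : Prop := ∀ f, φ.ev f = 0 → ∀ᶠ x in 𝓝 0, (f : V → ℝ) x = 0

lemma exists_derivation (hinj : φ.GermInjective) (halg : Algebra.IsAlgebraic φ.ev.range K) (v : V) :
    ∃ δ : Derivation ℝ K K, ∀ h, δ (φ.ev h) = φ.ev (dirDeriv v h) := by
  have hcongr : ∀ f g, φ.ev f = φ.ev g → φ.ev (dirDeriv v f) = φ.ev (dirDeriv v g) := by
    intro f g h
    refine φ.dirDeriv_congr ?_ v
    have := hinj (f - g) (by rw [map_sub, h, sub_self])
    exact this.mono fun x hx => sub_eq_zero.1 hx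
  have hsurj : ∀ r : φ.ev.range, ∃ f, φ.ev f = r := fun r => r.2
  choose s hs using hsurj
  have hs' : ∀ f : analyticAlg V, φ.ev (dirDeriv v (s ⟨φ.ev f, f, rfl⟩)) = φ.ev (dirDeriv v f) :=
    fun f => hcongr _ _ (hs _)
  let d : Derivation ℝ φ.ev.range K := Derivation.mk'
    { toFun := fun r => φ.ev (dirDeriv v (s r))
      map_add' := fun a b => by
        rw [← φ.dirDeriv_add]
        exact hcongr _ _ (by rw [hs, map_add, hs, hs]; rfl)
      map_smul' := fun c a => by
        have h1 : φ.ev (dirDeriv v (s (c • a))) =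
            φ.ev (dirDeriv v (algebraMap ℝ (analyticAlg V) c * s a)) :=
          hcongr _ _ (by rw [hs, map_mul, hs, AlgHom.commutes, ← Algebra.smul_def]; rfl)
        rw [h1, dirDeriv_mul, dirDeriv_algebraMap, map_zero, mul_zero, add_zero,
          AlgHom.commutes, ← Algebra.smul_def]; rfl } (fun a b => by
      have h1 : φ.ev (dirDeriv v (s (a * b))) = φ.ev (dirDeriv v (s a * s b)) :=
        hcongr _ _ (by rw [hs, map_mul, hs, hs]; rfl)
      have h2 := φ.dirDeriv_mul v (s a) (s b)
      rw [hs, hs] at h2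
      exact h1.trans h2)
  obtain ⟨δ, hδ⟩ := exists_derivation_extend d
  refine ⟨δ, fun h => ?_⟩
  exact (hδ ⟨φ.ev h, h, rfl⟩).trans (hs' h)

lemma constAlgebraic_of_injective [FiniteDimensional ℝ V] (hinj : φ.GermInjective)
    (halg : Algebra.IsAlgebraic φ.ev.range K) : φ.ConstAlgebraic := by
  classical
  intro z hz
  choose δ hδ using φ.exists_derivation hinj halg
  have hzδ : ∀ v, δ v z = 0 := fun v => hz _
    ⟨Unit, inferInstance, fun _ => 1, fun _ => v, fun h => by simp [hδ]⟩
  have hex : ∃ N : ℕ, ∃ u : ℕ → analyticAlg V, φ.ev (u N) ≠ 0 ∧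
      ∑ i ∈ Finset.range (N + 1), φ.ev (u i) * z ^ i = 0 := by
    obtain ⟨p, hp, hpz⟩ := halg.isAlgebraic z
    have hsurj : ∀ i, ∃ f, φ.ev f = p.coeff i := fun i => (p.coeff i).2
    choose u hu using hsurj
    refine ⟨p.natDegree, u, ?_, ?_⟩
    · rw [hu]
      simpa using hp
    · rw [Polynomial.aeval_eq_sum_range] at hpz
      rw [← hpz]
      refine Finset.sum_congr rfl fun i _ => ?_
      rw [hu, Algebra.smul_def]; rfl
  obtain ⟨u, huN, hsum⟩ := Nat.find_spec hex
  set N := Nat.find hex with hN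
  have hmin : ∀ q : ℕ → analyticAlg V, ∑ i ∈ Finset.range N, φ.ev (q i) * z ^ i = 0 →
      ∀ i < N, φ.ev (q i) = 0 := by
    intro q hq
    by_contra! hc
    have hne : ((Finset.range N).filter (fun i => φ.ev (q i) ≠ 0)).Nonempty := by
      obtain ⟨i, hi, h⟩ := hc
      exact ⟨i, by simp [hi, h]⟩
    set M := ((Finset.range N).filter (fun i => φ.ev (q i) ≠ 0)).max' hne with hM
    have hMm := Finset.max'_mem _ hne
    rw [← hM] at hMm
    simp only [Finset.mem_filter, Finset.mem_range] at hMm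
    refine Nat.find_min hex hMm.1 ⟨q, hMm.2, ?_⟩
    rw [← hq]
    refine Finset.sum_subset (fun i hi => ?_) fun i hi hi' => ?_
    · simp only [Finset.mem_range] at hi ⊢; omega
    · by_contra h0
      have h1 : φ.ev (q i) ≠ 0 := fun h => h0 (by rw [h, zero_mul])
      have h2 := Finset.le_max' ((Finset.range N).filter (fun i => φ.ev (q i) ≠ 0)) i
        (by simp only [Finset.mem_filter]; exact ⟨hi, h1⟩)
      simp only [Finset.mem_range] at hi'
      rw [← hM] at h2
      omega
  set w := u N with hw
  have hderiv : ∀ v, ∑ i ∈ Finset.range (N + 1), φ.ev (dirDeriv v (u i)) * z ^ i = 0 := by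
    intro v
    have h1 := congrArg (δ v) hsum
    rw [map_sum, map_zero] at h1
    rw [← h1]
    refine Finset.sum_congr rfl fun i _ => ?_
    rw [Derivation.leibniz, Derivation.leibniz_pow, hzδ, hδ]
    simp [mul_comm]
  have hcomm : ∀ v, ∀ i < N, φ.ev (w * dirDeriv v (u i) - u i * dirDeriv v w) = 0 := by
    intro v
    refine hmin (fun i => w * dirDeriv v (u i) - u i * dirDeriv v w) ?_
    have h1 := hderiv v
    rw [Finset.sum_range_succ] at h1
    have h2 := hsum
    rw [Finset.sum_range_succ] at h2
    have e1 : ∑ i ∈ Finset.range N, φ.ev (w * dirDeriv v (u i) - u i * dirDeriv v w) * z ^ i =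
        φ.ev w * ∑ i ∈ Finset.range N, φ.ev (dirDeriv v (u i)) * z ^ i -
        φ.ev (dirDeriv v w) * ∑ i ∈ Finset.range N, φ.ev (u i) * z ^ i := by
      rw [Finset.mul_sum, Finset.mul_sum, ← Finset.sum_sub_distrib]
      refine Finset.sum_congr rfl fun i _ => ?_
      rw [map_sub, map_mul, map_mul]; ring
    rw [e1, eq_neg_of_add_eq_zero_left h1, eq_neg_of_add_eq_zero_left h2, hw]
    ring
  have hw0 : ¬ ∀ᶠ x in 𝓝 0, (w : V → ℝ) x = 0 := fun h => huN (φ.germ _ h)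
  have hconst : ∀ i < N, ∃ c : ℝ, φ.ev (u i) = algebraMap ℝ K c * φ.ev w := by
    intro i hi
    have key : ∀ᶠ x in 𝓝 0, (w : V → ℝ) x • fderiv ℝ (u i : V → ℝ) x =
        (u i : V → ℝ) x • fderiv ℝ (w : V → ℝ) x := by
      let b := Module.finBasis ℝ V
      have h1 : ∀ j, ∀ᶠ x in 𝓝 (0 : V), (w : V → ℝ) x * fderiv ℝ (u i : V → ℝ) x (b j) -
          (u i : V → ℝ) x * fderiv ℝ (w : V → ℝ) x (b j) = 0 := fun j => hinj _ (hcomm (b j) i hi)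
      filter_upwards [eventually_all.2 h1] with x hx
      have : ((w : V → ℝ) x • fderiv ℝ (u i : V → ℝ) x : V →ₗ[ℝ] ℝ) =
        ((u i : V → ℝ) x • fderiv ℝ (w : V → ℝ) x : V →ₗ[ℝ] ℝ) :=
        b.ext fun j => sub_eq_zero.1 (hx j)
      ext y
      exact LinearMap.congr_fun this y
    obtain ⟨c, hc⟩ := eventually_eq_const_mul (u i).2 w.2 hw0 key
    refine ⟨c, ?_⟩
    rw [← φ.ev.commutes, ← map_mul]
    exact φ.congr hc
  choose! c hc using hconst
  refine ⟨∑ i ∈ Finset.range N, Polynomial.monomial i (c i) + Polynomial.X ^ N, ?_, ?_⟩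
  · intro h
    have := congrArg (fun p => Polynomial.coeff p N) h
    simp only [Polynomial.coeff_add, Polynomial.finsetSum_coeff, Polynomial.coeff_X_pow_self,
      Polynomial.coeff_zero] at this
    rw [Finset.sum_eq_zero] at this
    · simp at this
    · intro i hi
      rw [Polynomial.coeff_monomial, if_neg]
      have := Finset.mem_range.1 hi
      omega
  · rw [map_add, map_sum, map_pow, Polynomial.aeval_X]
    refine (mul_right_injective₀ huN) ?_
    simp only
    rw [mul_zero, ← hsum, Finset.sum_range_succ, mul_add, Finset.mul_sum]
    congr 1
    refine Finset.sum_congr rfl fun i hi => ?_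
    rw [Polynomial.aeval_monomial, hc i (Finset.mem_range.1 hi)]
    ring

end GermHom

end

section

open scoped ContDiff Topology
open Filter Set

section Step

/-- An analytic germ that vanishes along every line through the origin vanishes. -/
lemma exists_line_ne_zero {V : Type*} [NormedAddCommGroup V] [NormedSpace ℝ V] [Nontrivial V]
    {g : V → ℝ} (hg : AnalyticAt ℝ g 0) (hg0 : ¬ ∀ᶠ x in 𝓝 0, g x = 0) :
    ∃ v : V, v ≠ 0 ∧ ¬ ∀ᶠ t : ℝ in 𝓝 0, g (t • v) = 0 := by
  by_contra! hc
  refine hg0 ?_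
  obtain ⟨ε, hε, hball⟩ := Metric.eventually_nhds_iff_ball.1 hg.eventually_analyticAt
  filter_upwards [Metric.ball_mem_nhds 0 hε] with x hx
  by_cases hx0 : x = 0
  · obtain ⟨v, hv⟩ := exists_ne (0 : V)
    have := (hc v hv).self_of_nhds
    simpa [hx0] using this
  let l : ℝ →L[ℝ] V := ContinuousLinearMap.toSpanSingleton ℝ x
  have hl : ∀ t : ℝ, l t = t • x := fun t => by simp [l]
  have hconv : Convex ℝ (l ⁻¹' Metric.ball (0 : V) ε) :=
    (convex_ball (0 : V) ε).linear_preimage l.toLinearMap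
  have han : AnalyticOnNhd ℝ (fun t : ℝ => g (l t)) (l ⁻¹' Metric.ball (0 : V) ε) := fun t ht =>
    AnalyticAt.comp (g := g) (f := l) (hball _ ht) (l.analyticAt t)
  have h0 : (0 : ℝ) ∈ l ⁻¹' Metric.ball (0 : V) ε := by simp [hε]
  have := han.eqOn_zero_of_preconnected_of_eventuallyEq_zero hconv.isPreconnected h0
    ((hc x hx0).mono fun t ht => by simpa [hl] using ht)
  have h1 := this (show (1 : ℝ) ∈ l ⁻¹' Metric.ball (0 : V) ε by
    simpa [hl] using hx)
  simpa [hl] using h1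

section Pull

variable {V W : Type*} [NormedAddCommGroup V] [NormedSpace ℝ V] [NormedAddCommGroup W]
  [NormedSpace ℝ W]

/-- Pullback of analytic germs by a linear map. -/
def pullAlg (L : V →L[ℝ] W) : analyticAlg W →ₐ[ℝ] analyticAlg V where
  toFun f := ⟨fun x => (f : W → ℝ) (L x), by
    obtain ⟨f, hf⟩ := f
    exact AnalyticAt.comp_of_eq (g := f) (f := L) hf (L.analyticAt 0) (map_zero L)⟩
  map_one' := rfl
  map_mul' _ _ := rfl
  map_zero' := rfl
  map_add' _ _ := rfl
  commutes' _ := rfl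

lemma eventually_pull (L : V →L[ℝ] W) {p : W → Prop} (h : ∀ᶠ y in 𝓝 0, p y) :
    ∀ᶠ x in 𝓝 0, p (L x) :=
  (L.continuous.tendsto' 0 0 (map_zero L)).eventually h

variable {K : Type*} [Field K] [Algebra ℝ K]

/-- The germ homomorphism obtained by pulling back. -/
def GermHom.pull (φ : GermHom V K) (L : V →L[ℝ] W) : GermHom W K where
  ev := φ.ev.comp (pullAlg L)
  germ _ hf := φ.germ _ (eventually_pull L hf)

lemma GermHom.ev_dirDeriv_pull (φ : GermHom V K) (L : V →L[ℝ] W) (f : analyticAlg W) (v : V) :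
    φ.ev (dirDeriv v (pullAlg L f)) = φ.ev (pullAlg L (dirDeriv (L v) f)) := by
  refine φ.congr ?_
  filter_upwards [eventually_pull L (eventually_differentiableAt f)] with x hx
  have := hx.hasFDerivAt.comp x L.hasFDerivAt
  exact congrArg (fun l => l v) this.fderiv

lemma GermHom.ConstAlgebraic.of_pull {φ : GermHom V K} (σ : V ≃L[ℝ] W)
    (h : (φ.pull (σ : V →L[ℝ] W)).ConstAlgebraic) : φ.ConstAlgebraic := by
  intro z hz
  refine h z fun δ hδ => hz δ ?_
  obtain ⟨ι, _, c, v, hc⟩ := hδ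
  refine ⟨ι, inferInstance, c, fun i => σ.symm (v i), fun f => ?_⟩
  have e : f = pullAlg (σ : V →L[ℝ] W) (pullAlg (σ.symm : W →L[ℝ] V) f) := by
    apply Subtype.ext; funext x
    show (f : V → ℝ) x = (f : V → ℝ) (σ.symm (σ x))
    simp
  have h1 := hc (pullAlg (σ.symm : W →L[ℝ] V) f)
  calc δ (φ.ev f) = δ (φ.ev (pullAlg (σ : V →L[ℝ] W) (pullAlg (σ.symm : W →L[ℝ] V) f))) := by
        rw [← e]
    _ = _ := h1
    _ = _ := by
      refine Finset.sum_congr rfl fun i _ => ?_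
      congr 1
      have h2 := φ.ev_dirDeriv_pull (σ : V →L[ℝ] W) (pullAlg (σ.symm : W →L[ℝ] V) f) (σ.symm (v i))
      rw [← e] at h2
      rw [h2]
      simp [GermHom.pull]

lemma GermHom.range_pull_equiv (φ : GermHom V K) (σ : V ≃L[ℝ] W) :
    (φ.pull (σ : V →L[ℝ] W)).ev.range = φ.ev.range := by
  apply le_antisymm
  · rintro _ ⟨f, rfl⟩; exact ⟨pullAlg _ f, rfl⟩
  · rintro _ ⟨f, rfl⟩
    refine ⟨pullAlg (σ.symm : W →L[ℝ] V) f, ?_⟩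
    show φ.ev _ = φ.ev _
    congr 1
    apply Subtype.ext; funext x
    show (f : V → ℝ) (σ.symm (σ x)) = (f : V → ℝ) x
    simp

end Pull

/-- The projection forgetting the first coordinate. -/
def tailL (n : ℕ) : (Fin (n + 1) → ℝ) →L[ℝ] (Fin n → ℝ) :=
  ContinuousLinearMap.pi fun i => ContinuousLinearMap.proj i.succ

/-- The first coordinate as an analytic germ. -/
def coord0 (n : ℕ) : analyticAlg (Fin (n + 1) → ℝ) :=
  ⟨fun v => v 0, (ContinuousLinearMap.proj (R := ℝ) (φ := fun _ : Fin (n + 1) => ℝ) 0).analyticAt _⟩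

lemma dirDeriv_coord0 (n : ℕ) (v : Fin (n + 1) → ℝ) :
    dirDeriv v (coord0 n) = algebraMap ℝ _ (v 0) := by
  apply Subtype.ext; funext x
  have := (ContinuousLinearMap.proj (R := ℝ) (φ := fun _ : Fin (n + 1) => ℝ) 0).fderiv (x := x)
  exact congrArg (fun l => l v) this

namespace GermHom

variable {n : ℕ} {K : Type*} [Field K] [Algebra ℝ K]

lemma dirDeriv_pow (φ : GermHom (Fin (n + 1) → ℝ) K) (v) (f : analyticAlg (Fin (n + 1) → ℝ))
    (hf : φ.ev (dirDeriv v f) = 0) (i : ℕ) : φ.ev (dirDeriv v (f ^ i)) = 0 := by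
  induction i with
  | zero =>
    rw [pow_zero, ← map_one (algebraMap ℝ (analyticAlg (Fin (n + 1) → ℝ))), dirDeriv_algebraMap,
      map_zero]
  | succ i ih => rw [pow_succ, dirDeriv_mul, ih, hf, mul_zero, mul_zero, add_zero]

/-- Weierstrass division by an element of the kernel that is monic in the first coordinate. -/
lemma exists_monic_division (φ : GermHom (Fin (n + 1) → ℝ) K) {g : analyticAlg (Fin (n + 1) → ℝ)}
    (hg : φ.ev g = 0) (hreg : ¬ ∀ᶠ t : ℝ in 𝓝 0, (g : (Fin (n + 1) → ℝ) → ℝ) (Pi.single 0 t) = 0) :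
    ∃ (P : analyticAlg (Fin (n + 1) → ℝ)) (m : ℕ) (r : Fin m → analyticAlg (Fin n → ℝ)),
      φ.ev P = 0 ∧ P = coord0 n ^ m - ∑ i, pullAlg (tailL n) (r i) * coord0 n ^ (i : ℕ) ∧
      ∃ M : ℕ, ∀ f : analyticAlg (Fin (n + 1) → ℝ), ∃ (q : analyticAlg (Fin (n + 1) → ℝ))
        (s : Fin M → analyticAlg (Fin n → ℝ)),
        ∀ᶠ v in 𝓝 0, (f : (Fin (n + 1) → ℝ) → ℝ) v =
          (q * P + ∑ i, pullAlg (tailL n) (s i) * coord0 n ^ (i : ℕ) :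
            analyticAlg (Fin (n + 1) → ℝ)).1 v := by
  have hsumapply : ∀ {M : ℕ} (s : Fin M → analyticAlg (Fin n → ℝ)) (v : Fin (n + 1) → ℝ),
      (∑ i, pullAlg (tailL n) (s i) * coord0 n ^ (i : ℕ) : analyticAlg (Fin (n + 1) → ℝ)).1 v =
        ∑ i, (s i).1 (Fin.tail v) * v 0 ^ (i : ℕ) := by
    intro M s v
    rw [AddSubmonoidClass.coe_finsetSum, Finset.sum_apply]
    rfl
  obtain ⟨m, hm⟩ := weierstrass_division g.2 hreg
  obtain ⟨q, r, hq, hr, hqr⟩ := hm (fun v => v 0 ^ m) (coord0 n ^ m).2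
  let r' : Fin m → analyticAlg (Fin n → ℝ) := fun i => ⟨r i, hr i⟩
  let P : analyticAlg (Fin (n + 1) → ℝ) :=
    coord0 n ^ m - ∑ i, pullAlg (tailL n) (r' i) * coord0 n ^ (i : ℕ)
  have hPv : ∀ v, P.1 v = v 0 ^ m - ∑ i, r i (Fin.tail v) * v 0 ^ (i : ℕ) := by
    intro v
    show (coord0 n ^ m).1 v - _ = _
    rw [hsumapply]; rfl
  have hP : φ.ev P = 0 := by
    have : φ.ev P = φ.ev (⟨q, hq⟩ * g) := by
      refine φ.congr ?_
      filter_upwards [hqr] with v hv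
      rw [hPv, hv]
      show _ = q v * g.1 v
      ring
    rw [this, map_mul, hg, mul_zero]
  have hPreg : ¬ ∀ᶠ t : ℝ in 𝓝 0, P.1 (Pi.single 0 t) = 0 := by
    intro h
    let p : Polynomial ℝ := Polynomial.X ^ m -
      ∑ i : Fin m, Polynomial.C (r i 0) * Polynomial.X ^ (i : ℕ)
    have hp : p = 0 := by
      refine Polynomial.eq_zero_of_infinite_isRoot p ?_
      refine Set.Infinite.mono (s := {t : ℝ | P.1 (Pi.single 0 t) = 0}) ?_ ?_
      · intro t ht
        have h1 : P.1 (Pi.single 0 t) = 0 := ht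
        have h2 : Fin.tail (Pi.single (0 : Fin (n + 1)) t : Fin (n + 1) → ℝ) = 0 := by
          funext i; simp [Fin.tail]
        rw [hPv, h2] at h1
        simp only [Pi.single_eq_same] at h1
        simp [p, Polynomial.IsRoot, Polynomial.eval_finsetSum, h1]
      · exact infinite_of_mem_nhds 0 h
    have h3 : p.coeff m = 1 := by
      simp only [p, Polynomial.coeff_sub, Polynomial.coeff_X_pow_self, Polynomial.finsetSum_coeff,
        Polynomial.coeff_C_mul, Polynomial.coeff_X_pow]
      rw [Finset.sum_eq_zero, sub_zero]
      intro i _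
      rw [if_neg i.2.ne', mul_zero]
    rw [hp] at h3
    simp at h3
  refine ⟨P, m, r', hP, rfl, ?_⟩
  obtain ⟨M, hM⟩ := weierstrass_division P.2 hPreg
  refine ⟨M, fun f => ?_⟩
  obtain ⟨q, s, hq, hs, h⟩ := hM f.1 f.2
  refine ⟨⟨q, hq⟩, fun i => ⟨s i, hs i⟩, ?_⟩
  filter_upwards [h] with v hv
  show f.1 v = q v * P.1 v + _
  rw [hsumapply, hv]

lemma constAlgebraic_of_tail (φ : GermHom (Fin (n + 1) → ℝ) K)
    (halg : Algebra.IsAlgebraic φ.ev.range K) {g : analyticAlg (Fin (n + 1) → ℝ)}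
    (hg : φ.ev g = 0) (hreg : ¬ ∀ᶠ t : ℝ in 𝓝 0, (g : (Fin (n + 1) → ℝ) → ℝ) (Pi.single 0 t) = 0)
    (ih : ∀ ψ : GermHom (Fin n → ℝ) K, Algebra.IsAlgebraic ψ.ev.range K → ψ.ConstAlgebraic) :
    φ.ConstAlgebraic := by
  obtain ⟨P, m, r, hP, hPeq, M, hM⟩ := φ.exists_monic_division hg hreg
  set ψ := φ.pull (tailL n) with hψ
  set X := φ.ev (coord0 n) with hX
  have hψev : ∀ f, φ.ev (pullAlg (tailL n) f) = ψ.ev f := fun f => rfl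
  have hinteg : IsIntegral ψ.ev.range X := by
    let p : Polynomial ψ.ev.range := Polynomial.X ^ m -
      ∑ i : Fin m, Polynomial.C (⟨ψ.ev (r i), r i, rfl⟩ : ψ.ev.range) * Polynomial.X ^ (i : ℕ)
    refine ⟨p, Polynomial.monic_X_pow_sub (Finset.sup_lt_iff (WithBot.bot_lt_coe m) |>.2 ?_ |>
      (Polynomial.degree_sum_le _ _).trans_lt), ?_⟩
    · intro i _
      exact (Polynomial.degree_C_mul_X_pow_le _ _).trans_lt (Nat.cast_lt.2 i.2)
    · have h1 : φ.ev P = 0 := hP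
      rw [hPeq, map_sub, map_pow, map_sum] at h1
      simp only [p, Polynomial.eval₂_sub, Polynomial.eval₂_X_pow, Polynomial.eval₂_finsetSum,
        Polynomial.eval₂_mul, Polynomial.eval₂_C]
      rw [← h1]
      congr 1
      refine Finset.sum_congr rfl fun i _ => ?_
      rw [map_mul, map_pow]
      rfl
  have hform : ∀ f : analyticAlg (Fin (n + 1) → ℝ), ∃ (q : analyticAlg (Fin (n + 1) → ℝ)) (s : Fin M → analyticAlg (Fin n → ℝ)),
      ∀ᶠ v in 𝓝 0, (f : (Fin (n + 1) → ℝ) → ℝ) v =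
          (q * P + ∑ i, pullAlg (tailL n) (s i) * coord0 n ^ (i : ℕ) :
            analyticAlg (Fin (n + 1) → ℝ)).1 v := hM
  have hψalg : Algebra.IsAlgebraic ψ.ev.range K := by
    have hle : ψ.ev.range ≤ φ.ev.range := by
      rintro _ ⟨f, rfl⟩; exact ⟨pullAlg _ f, rfl⟩
    let _ : Algebra ψ.ev.range φ.ev.range := (Subalgebra.inclusion hle).toRingHom.toAlgebra
    have : IsScalarTower ψ.ev.range φ.ev.range K := IsScalarTower.of_algebraMap_eq fun _ => rfl
    have : Algebra.IsAlgebraic ψ.ev.range φ.ev.range := by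
      refine ⟨fun a => ?_⟩
      obtain ⟨_, f, rfl⟩ := a
      rw [← isAlgebraic_algebraMap_iff (A := K) Subtype.val_injective]
      refine IsIntegral.isAlgebraic ?_
      obtain ⟨q, s, h⟩ := hform f
      have e : φ.ev f = ∑ i, ψ.ev (s i) * X ^ (i : ℕ) := by
        rw [φ.congr h, map_add, map_mul, hP, mul_zero, zero_add, map_sum]
        exact Finset.sum_congr rfl fun i _ => by rw [map_mul, map_pow]; rfl
      show IsIntegral ψ.ev.range (φ.ev f)
      rw [e]
      refine IsIntegral.sum _ fun i _ => IsIntegral.mul ?_ (hinteg.pow _)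
      exact isIntegral_algebraMap (R := ψ.ev.range) (A := K) (x := ⟨ψ.ev (s i), s i, rfl⟩)
    exact Algebra.IsAlgebraic.trans ψ.ev.range φ.ev.range K
  intro z hz
  refine ih ψ hψalg z fun δ hδ => hz δ ?_
  obtain ⟨ι, _, c, v, hc⟩ := hδ
  refine ⟨Option ι, inferInstance, fun o => o.elim (δ X) c,
    fun o => o.elim (Pi.single 0 1) (fun i => Fin.cons 0 (v i)), fun h => ?_⟩
  let c' : Option ι → K := fun o => o.elim (δ X) c
  let v' : Option ι → (Fin (n + 1) → ℝ) :=
    fun o => o.elim (Pi.single 0 1) (fun i => Fin.cons 0 (v i))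
  let D : analyticAlg (Fin (n + 1) → ℝ) → K := fun f =>
    δ (φ.ev f) - ∑ o, c' o * φ.ev (dirDeriv (v' o) f)
  have Dadd : ∀ f g, D (f + g) = D f + D g := by
    intro f g
    simp only [D, map_add, dirDeriv_add, mul_add, Finset.sum_add_distrib]
    ring
  have Dmul : ∀ f g, D (f * g) = φ.ev f * D g + φ.ev g * D f := by
    intro f g
    simp only [D, map_mul, dirDeriv_mul, mul_add, Finset.sum_add_distrib, Derivation.leibniz,
      smul_eq_mul, mul_sub, Finset.mul_sum]
    have e1 : ∀ a b : analyticAlg (Fin (n + 1) → ℝ),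
        ∑ o, c' o * (φ.ev a * φ.ev (dirDeriv (v' o) b)) =
        ∑ o, φ.ev a * (c' o * φ.ev (dirDeriv (v' o) b)) := fun a b =>
      Finset.sum_congr rfl fun _ _ => by ring
    rw [e1, e1]
    ring
  have Dcongr : ∀ f g : analyticAlg (Fin (n + 1) → ℝ), (∀ᶠ x in 𝓝 0, f.1 x = g.1 x) →
      D f = D g := by
    intro f g h
    simp only [D]
    rw [φ.congr h]
    congr 1
    exact Finset.sum_congr rfl fun o _ => by rw [φ.dirDeriv_congr h]
  have Dconst : ∀ a : ℝ, D (algebraMap ℝ _ a) = 0 := by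
    intro a
    simp [D, dirDeriv_algebraMap]
  have Dneg : ∀ f, D (-f) = - D f := by
    intro f
    have h1 : D (f + -f) = D f + D (-f) := Dadd f (-f)
    have h2 : D 0 = 0 := by simpa using Dconst 0
    rw [add_neg_cancel, h2] at h1
    exact (neg_eq_of_add_eq_zero_right h1.symm).symm
  have Dtail : ∀ f, D (pullAlg (tailL n) f) = 0 := by
    intro f
    simp only [D, hψev, hc, Fintype.sum_option, ev_dirDeriv_pull]
    have t1 : tailL n (v' none) = 0 := by
      funext i; simp [tailL, v']
    have t2 : ∀ i, tailL n (v' (some i)) = v i := by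
      intro i; funext j; simp [tailL, v']
    have t3 : dirDeriv (0 : Fin n → ℝ) f = 0 := by
      apply Subtype.ext; funext x
      show fderiv ℝ f.1 x 0 = 0
      simp
    rw [t1, t3]
    simp [t2, c']
  have DX : D (coord0 n) = 0 := by
    simp only [D, dirDeriv_coord0, Fintype.sum_option]
    simp [v', c', ← hX]
  have Dpow : ∀ i : ℕ, D (coord0 n ^ i) = 0 := by
    intro i
    induction i with
    | zero => simpa using Dconst 1
    | succ i ih => rw [pow_succ, Dmul, ih, DX]; simp
  have Dsum : ∀ {M : ℕ} (s : Fin M → analyticAlg (Fin n → ℝ)),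
      D (∑ i, pullAlg (tailL n) (s i) * coord0 n ^ (i : ℕ)) = 0 := by
    intro M s
    refine Finset.sum_induction _ (fun f => D f = 0) (fun f g hf hg => ?_) ?_ fun i _ => ?_
    · rw [Dadd, hf, hg, add_zero]
    · simpa using Dconst 0
    · rw [Dmul, Dpow, Dtail]; simp
  have DP : D P = 0 := by
    rw [hPeq, sub_eq_add_neg, Dadd, Dneg, Dpow, Dsum]; simp
  obtain ⟨q, s, hqs⟩ := hform h
  have h0 : D h = 0 := by
    rw [Dcongr _ _ hqs, Dadd, Dmul, DP, hP, Dsum]; simp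
  exact sub_eq_zero.1 h0

/-- Constants of an algebraic extension of the image of the ring of analytic germs are algebraic
over `ℝ`. -/
theorem constAlgebraic : ∀ (n : ℕ) (φ : GermHom (Fin n → ℝ) K),
    Algebra.IsAlgebraic φ.ev.range K → φ.ConstAlgebraic := by
  intro n
  induction n with
  | zero =>
    intro φ halg
    refine φ.constAlgebraic_of_injective (fun f hf => ?_) halg
    have h1 : f = algebraMap ℝ _ (f.1 0) := by
      apply Subtype.ext; funext x
      show f.1 x = f.1 0
      rw [Subsingleton.elim x 0]
    rw [h1, AlgHom.commutes] at hf
    have h2 : f.1 0 = 0 := (algebraMap ℝ K).injective (by rw [hf, map_zero])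
    exact Eventually.of_forall fun x => by rw [Subsingleton.elim x 0]; exact h2
  | succ n ih =>
    intro φ halg
    by_cases hinj : φ.GermInjective
    · exact φ.constAlgebraic_of_injective hinj halg
    simp only [GermInjective, not_forall] at hinj
    obtain ⟨g, hg, hg0⟩ := hinj
    obtain ⟨v, hv, hline⟩ := exists_line_ne_zero g.2 hg0
    obtain ⟨σ, hσ⟩ := SeparatingDual.exists_continuousLinearEquiv_apply_eq (R := ℝ)
      (x := (Pi.single 0 1 : Fin (n + 1) → ℝ)) (y := v) (by
        intro h
        have := congrFun h 0
        simp at this) hv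
    refine GermHom.ConstAlgebraic.of_pull σ.symm ?_
    refine constAlgebraic_of_tail _ ?_ (g := pullAlg (σ : _ →L[ℝ] _) g) ?_ ?_ ih
    · rw [GermHom.range_pull_equiv]; exact halg
    · show φ.ev _ = 0
      rw [← hg]
      congr 1
      apply Subtype.ext; funext x
      show g.1 (σ (σ.symm x)) = g.1 x
      simp
    · intro h
      refine hline (h.mono fun t ht => ?_)
      have : g.1 (σ (Pi.single 0 t)) = 0 := ht
      have e : (Pi.single 0 t : Fin (n + 1) → ℝ) = t • Pi.single 0 1 := by
        rw [← Pi.single_smul]; simp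
      rwa [e, map_smul, hσ] at this

end GermHom

end Step

end

section

open scoped ContDiff Topology
open Filter Set

section Sard

lemma GermHom.ev_ne_zero {V : Type*} [NormedAddCommGroup V] [NormedSpace ℝ V] {K : Type*} [Field K]
    [Algebra ℝ K] (φ : GermHom V K) {f : analyticAlg V} (h : f.1 0 ≠ 0) : φ.ev f ≠ 0 := by
  intro h0
  have ha : AnalyticAt ℝ f.1 0 := f.2
  have h1 : φ.ev (f * ⟨fun x => (f.1 x)⁻¹, ha.inv h⟩) = φ.ev 1 := by
    refine φ.congr ?_
    filter_upwards [ha.continuousAt.eventually_ne h] with x hx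
    show f.1 x * (f.1 x)⁻¹ = 1
    exact mul_inv_cancel₀ hx
  rw [map_mul, h0, zero_mul, map_one] at h1
  exact zero_ne_one h1

lemma exists_algHom_field_ker {A : Type} [CommRing A] [Algebra ℝ A] (P : Ideal A) [P.IsPrime] :
    ∃ (K : Type) (_ : Field K) (_ : Algebra ℝ K) (ev : A →ₐ[ℝ] K),
      (∀ g, ev g = 0 ↔ g ∈ P) ∧ Algebra.IsAlgebraic ev.range K := by
  let ev : A →ₐ[ℝ] FractionRing (A ⧸ P) :=
    (IsScalarTower.toAlgHom ℝ (A ⧸ P) (FractionRing (A ⧸ P))).comp (Ideal.Quotient.mkₐ ℝ P)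
  have hev : ∀ g, ev g = algebraMap (A ⧸ P) (FractionRing (A ⧸ P)) (Ideal.Quotient.mk P g) :=
    fun g => rfl
  refine ⟨FractionRing (A ⧸ P), inferInstance, inferInstance, ev, fun g => ?_, ⟨fun z => ?_⟩⟩
  · rw [hev, map_eq_zero_iff _ (IsFractionRing.injective _ _), Ideal.Quotient.eq_zero_iff_mem]
  · obtain ⟨a, b, hb, rfl⟩ := IsFractionRing.div_surjective (A := A ⧸ P) z
    obtain ⟨a, rfl⟩ := Ideal.Quotient.mk_surjective a
    obtain ⟨b, rfl⟩ := Ideal.Quotient.mk_surjective b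
    rw [← hev, ← hev, div_eq_mul_inv]
    have h1 : ∀ g, IsAlgebraic ev.range (ev g) := fun g =>
      isAlgebraic_algebraMap (R := ev.range) (A := FractionRing (A ⧸ P)) ⟨ev g, g, rfl⟩
    exact (h1 a).mul (h1 b).inv

/-- A real-analytic function on `ℝⁿ` is locally constant on its critical set. -/
theorem analyticAt_eq_of_fderiv_eq_zero {n : ℕ} {f : (Fin n → ℝ) → ℝ} (hf : AnalyticAt ℝ f 0) :
    ∀ᶠ x in 𝓝 0, fderiv ℝ f x = 0 → f x = f 0 := by
  let F : analyticAlg (Fin n → ℝ) := ⟨fun x => f x - f 0, AnalyticAt.sub hf analyticAt_const⟩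
  have hF : ∀ x v, (dirDeriv v F).1 x = fderiv ℝ f x v := fun x v => by
    show fderiv ℝ (fun x => f x - f 0) x v = _
    rw [fderiv_sub_const]
  let J : Ideal (analyticAlg (Fin n → ℝ)) :=
    Ideal.span ({g | ∀ᶠ x in 𝓝 0, g.1 x = 0} ∪ Set.range fun v => dirDeriv v F)
  by_cases hJ : F ∈ J.radical
  · obtain ⟨k, hk⟩ := hJ
    have hgen : ∀ g ∈ J, ∀ᶠ x in 𝓝 0, fderiv ℝ f x = 0 → g.1 x = 0 := by
      intro g hg
      refine Submodule.span_induction ?_ ?_ ?_ ?_ hg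
      · rintro g (h | ⟨v, rfl⟩)
        · exact h.mono fun x hx _ => hx
        · exact Eventually.of_forall fun x hx => by
            show (dirDeriv v F).1 x = 0
            rw [hF, hx]; rfl
      · exact Eventually.of_forall fun x _ => rfl
      · intro a b _ _ ha hb
        filter_upwards [ha, hb] with x h1 h2 hx
        show a.1 x + b.1 x = 0
        rw [h1 hx, h2 hx, add_zero]
      · intro a b _ hb
        filter_upwards [hb] with x h1 hx
        show a.1 x * b.1 x = 0
        rw [h1 hx, mul_zero]
    filter_upwards [hgen _ hk] with x hx h0
    have h1 : (f x - f 0) ^ k = 0 := hx h0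
    exact sub_eq_zero.1 ((pow_eq_zero_iff fun h => by simp [h] at h1).1 h1)
  exfalso
  rw [Ideal.radical_eq_sInf, Submodule.mem_sInf] at hJ
  push Not at hJ
  obtain ⟨P, ⟨hJP, hP⟩, hFP⟩ := hJ
  obtain ⟨K, _, _, ev, hev0, halg⟩ := exists_algHom_field_ker P
  let φ : GermHom (Fin n → ℝ) K :=
    ⟨ev, fun g hg => (hev0 g).2 (hJP (Ideal.subset_span (Or.inl hg)))⟩
  have hFalg : IsAlgebraic ℝ (φ.ev F) := by
    refine GermHom.constAlgebraic n φ halg _ fun δ ⟨ι, _, c, v, hc⟩ => ?_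
    rw [hc]
    refine Finset.sum_eq_zero fun i _ => ?_
    have : φ.ev (dirDeriv (v i) F) = 0 :=
      (hev0 _).2 (hJP (Ideal.subset_span (Or.inr ⟨v i, rfl⟩)))
    rw [this, mul_zero]
  obtain ⟨p, hp, hpF⟩ := hFalg
  obtain ⟨q, hq, hdvd⟩ := Polynomial.exists_eq_pow_rootMultiplicity_mul_and_not_dvd p hp 0
  have hF0 : φ.ev F ≠ 0 := fun h => hFP ((hev0 F).1 h)
  rw [hq, map_mul, map_pow, map_sub, Polynomial.aeval_X, Polynomial.aeval_C, map_zero, sub_zero]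
    at hpF
  have hqF : φ.ev (Polynomial.aeval F q) = 0 := by
    rw [← Polynomial.aeval_algHom_apply]
    exact (mul_eq_zero.1 hpF).resolve_left (pow_ne_zero _ hF0)
  refine φ.ev_ne_zero ?_ hqF
  have h2 : (Polynomial.aeval F q).1 0 = q.eval 0 := by
    have h3 : (Polynomial.aeval F q).1 0 =
        ((Pi.evalAlgHom ℝ (fun _ : Fin n → ℝ => ℝ) 0).comp (analyticAlg (Fin n → ℝ)).val)
          (Polynomial.aeval F q) := rfl
    rw [h3, ← Polynomial.aeval_algHom_apply, Polynomial.aeval_def]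
    have h4 : ((Pi.evalAlgHom ℝ (fun _ : Fin n → ℝ => ℝ) 0).comp (analyticAlg (Fin n → ℝ)).val) F
        = 0 := by
      show f 0 - f 0 = 0
      ring
    rw [h4]; rfl
  rw [h2]
  intro h
  exact hdvd (Polynomial.dvd_iff_isRoot.2 h)

/-- A real-analytic function on a finite-dimensional space is locally constant on its critical
set. -/
theorem analyticAt_eq_of_fderiv_eq_zero' {N : Type*} [NormedAddCommGroup N] [NormedSpace ℝ N]
    [FiniteDimensional ℝ N] {f : N → ℝ} {a : N} (hf : AnalyticAt ℝ f a) :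
    ∀ᶠ x in 𝓝 a, fderiv ℝ f x = 0 → f x = f a := by
  let b := Module.finBasis ℝ N
  let σ : N ≃L[ℝ] (Fin (Module.finrank ℝ N) → ℝ) := b.equivFun.toContinuousLinearEquiv
  let g : (Fin (Module.finrank ℝ N) → ℝ) → ℝ := fun y => f (σ.symm y + a)
  have hg : AnalyticAt ℝ g 0 := by
    refine AnalyticAt.comp_of_eq (g := f) (f := fun y => σ.symm y + a) hf ?_ (by simp)
    exact ((σ.symm : (Fin (Module.finrank ℝ N) → ℝ) →L[ℝ] N).analyticAt 0).add analyticAt_const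
  have h1 := analyticAt_eq_of_fderiv_eq_zero hg
  have h2 : Tendsto (fun x => σ (x - a)) (𝓝 a) (𝓝 0) := by
    have : Continuous fun x => σ (x - a) := by fun_prop
    simpa using this.tendsto a
  filter_upwards [h2.eventually h1, hf.eventually_analyticAt] with x hx hxa h0
  have h3 : g (σ (x - a)) = f x := by simp [g]
  have h4 : g 0 = f a := by simp [g]
  rw [← h3, ← h4]
  refine hx ?_
  have h5 : HasFDerivAt (fun y => σ.symm y + a) (σ.symm : _ →L[ℝ] N) (σ (x - a)) :=
    (σ.symm : (Fin (Module.finrank ℝ N) → ℝ) →L[ℝ] N).hasFDerivAt.add_const a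
  have h6 : HasFDerivAt f (0 : N →L[ℝ] ℝ) (σ.symm (σ (x - a)) + a) := by
    rw [← h0]
    have : σ.symm (σ (x - a)) + a = x := by simp
    rw [this]
    exact hxa.differentiableAt.hasFDerivAt
  have h7 : HasFDerivAt g ((0 : N →L[ℝ] ℝ).comp
      (σ.symm : (Fin (Module.finrank ℝ N) → ℝ) →L[ℝ] N)) (σ (x - a)) :=
    HasFDerivAt.comp (g := f) (f := fun y => σ.symm y + a) (σ (x - a)) h6 h5
  exact h7.fderiv.trans (ContinuousLinearMap.zero_comp _)

end Sard

end

section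

open scoped ContDiff Topology
open Filter Set

section LyapunovSchmidt

variable {H : Type*} [NormedAddCommGroup H] [InnerProductSpace ℝ H] [CompleteSpace H]

local notation "⟪" x ", " y "⟫" => inner ℝ x y

/-- An operator that is positive on a closed subspace of finite codimension becomes coercive after
the other block is replaced by a large multiple of the identity. -/
lemma coercive_block (A : H →L[ℝ] H) (M : Submodule ℝ H) [M.HasOrthogonalProjection]
    (hA : ∀ h ∈ M, 1 / 2 * ‖h‖ ^ 2 ≤ ⟪A h, h⟫) :
    ∃ T : H ≃L[ℝ] H, ∀ u, T u = M.starProjection (A u) +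
      (‖A‖ ^ 2 + 1) • (u - M.starProjection u) := by
  let T : H →L[ℝ] H := M.starProjection ∘L A +
    (‖A‖ ^ 2 + 1) • (ContinuousLinearMap.id ℝ H - M.starProjection)
  have hT : ∀ u, T u = M.starProjection (A u) + (‖A‖ ^ 2 + 1) • (u - M.starProjection u) :=
    fun u => rfl
  let B : H →L[ℝ] H →L[ℝ] ℝ := innerSL ℝ ∘L T
  have hB : ∀ u v, B u v = ⟪T u, v⟫ := fun u v => rfl
  have hco : IsCoercive B := by
    refine ⟨1 / 4, by norm_num, fun u => ?_⟩
    set p := M.starProjection u with hp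
    set q := u - p with hq
    have hpM : p ∈ M := M.starProjection_apply_mem u
    have hqM : q ∈ Mᗮ := M.sub_starProjection_mem_orthogonal u
    have hpq : ⟪p, q⟫ = 0 := Submodule.inner_right_of_mem_orthogonal hpM hqM
    have hu : u = p + q := by simp [hq]
    have hn : ‖u‖ ^ 2 = ‖p‖ ^ 2 + ‖q‖ ^ 2 := by
      rw [hu, norm_add_sq_real, hpq]; ring
    have h1 : ⟪M.starProjection (A u), u⟫ = ⟪A p, p⟫ + ⟪A q, p⟫ := by
      rw [Submodule.inner_starProjection_left_eq_right, ← hp, hu, map_add, inner_add_left]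
    have h2 : ⟪q, u⟫ = ‖q‖ ^ 2 := by
      rw [hu, inner_add_right, real_inner_comm, hpq, real_inner_self_eq_norm_sq, zero_add]
    have h3 : B u u = ⟪A p, p⟫ + ⟪A q, p⟫ + (‖A‖ ^ 2 + 1) * ‖q‖ ^ 2 := by
      rw [hB, hT, inner_add_left, h1, real_inner_smul_left, h2]
    have h4 : -(‖A‖ * ‖q‖ * ‖p‖) ≤ ⟪A q, p⟫ := by
      have h5 := abs_le.1 (abs_real_inner_le_norm (A q) p)
      have h6 : ‖A q‖ * ‖p‖ ≤ ‖A‖ * ‖q‖ * ‖p‖ := by gcongr; exact A.le_opNorm q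
      linarith [h5.1]
    rw [h3]
    have := hA p hpM
    nlinarith [sq_nonneg (‖p‖ / 2 - ‖A‖ * ‖q‖), sq_nonneg ‖q‖, hn]
  refine ⟨hco.continuousLinearEquivOfBilin, fun u => ?_⟩
  rw [← hT]
  refine (hco.unique_continuousLinearEquivOfBilin fun w => ?_).symm
  rw [hB]

/-- Lyapunov–Schmidt reduction: an analytic function with Fredholm Hessian is locally constant on
its critical set. -/
theorem eventually_eq_of_gradient_eq_zero {E : H → ℝ} {G : H → H} {a : H} (hE : AnalyticAt ℝ E a)
    (hG : AnalyticAt ℝ G a) (hEG : ∀ u, HasFDerivAt E (innerSL ℝ (G u)) u) (hGa : G a = 0)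
    (M : Submodule ℝ H) [M.HasOrthogonalProjection] [FiniteDimensional ℝ Mᗮ]
    (hA : ∀ h ∈ M, 1 / 2 * ‖h‖ ^ 2 ≤ ⟪fderiv ℝ G a h, h⟫) :
    ∀ᶠ u in 𝓝 a, G u = 0 → E u = E a := by
  set A := fderiv ℝ G a
  obtain ⟨T, hT⟩ := coercive_block A M hA
  set c := ‖A‖ ^ 2 + 1
  let Φ : H → H := fun u => M.starProjection (G u) + c • ((u - a) - M.starProjection (u - a))
  have hΦa : Φ a = 0 := by simp [Φ, hGa]
  have hΦan : AnalyticAt ℝ Φ a := by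
    have h1 : AnalyticAt ℝ (fun u => M.starProjection (G u)) a :=
      (M.starProjection.analyticAt _).comp hG
    have h2 : AnalyticAt ℝ (fun u : H => u - a) a := analyticAt_id.sub analyticAt_const
    have h3 : AnalyticAt ℝ (fun u : H => M.starProjection (u - a)) a :=
      (M.starProjection.analyticAt _).comp h2
    exact h1.add (analyticAt_const.smul (h2.sub h3))
  have hΦ' : HasFDerivAt Φ (T : H →L[ℝ] H) a := by
    have h1 := M.starProjection.hasFDerivAt.comp a hG.differentiableAt.hasFDerivAt
    have h2 : HasFDerivAt (fun u : H => u - a) (ContinuousLinearMap.id ℝ H) a :=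
      (hasFDerivAt_id a).sub_const a
    have h3 := M.starProjection.hasFDerivAt.comp a h2
    refine (h1.add ((h2.sub h3).const_smul c)).congr_fderiv ?_
    ext u
    exact (hT u).symm
  have hcd : ContDiffAt ℝ ω Φ a := hΦan.contDiffAt
  set Ψ := hcd.localInverse hΦ' (by simp) with hΨ
  have hΨan : AnalyticAt ℝ Ψ 0 := by
    have := (hcd.to_localInverse hΦ' (by simp)).analyticAt
    rwa [hΦa] at this
  have hΨ0 : Ψ 0 = a := by
    have := hcd.localInverse_apply_image hΦ' (by simp)
    rwa [hΦa] at this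
  have hleft : ∀ᶠ u in 𝓝 a, Ψ (Φ u) = u :=
    (hcd.hasStrictFDerivAt' hΦ' (by simp)).eventually_left_inverse
  let ι : Mᗮ →L[ℝ] H := Mᗮ.subtypeL
  let g : Mᗮ → ℝ := fun ξ => E (Ψ (ι ξ))
  have hΨι : AnalyticAt ℝ (fun ξ : Mᗮ => Ψ (ι ξ)) 0 :=
    AnalyticAt.comp_of_eq (g := Ψ) (f := ι) hΨan (ι.analyticAt 0) (map_zero ι)
  have hg : AnalyticAt ℝ g 0 :=
    AnalyticAt.comp_of_eq (g := E) (f := fun ξ : Mᗮ => Ψ (ι ξ)) hE hΨι (by simp [hΨ0])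
  have hsard := analyticAt_eq_of_fderiv_eq_zero' hg
  let ξ : H → Mᗮ := fun u => ⟨c • ((u - a) - M.starProjection (u - a)),
    Submodule.smul_mem _ _ (M.sub_starProjection_mem_orthogonal _)⟩
  have hξc : Continuous ξ := by
    refine Continuous.subtype_mk ?_ _
    fun_prop
  have hξa : ξ a = 0 := by
    apply Subtype.ext
    simp [ξ]
  have hξt : Tendsto ξ (𝓝 a) (𝓝 0) := by
    have := hξc.tendsto a
    rwa [hξa] at this
  filter_upwards [hleft, hξt.eventually hsard, hξt.eventually hΨι.eventually_analyticAt]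
    with u h1 h2 h3 h0
  have h4 : Φ u = ι (ξ u) := by simp [Φ, ξ, ι, h0]
  rw [h4] at h1
  have h5 : g (ξ u) = E u := by simp only [g, h1]
  have h6 : g 0 = E a := by simp [g, hΨ0]
  rw [← h5, ← h6]
  refine h2 ?_
  have h7 : HasFDerivAt E (0 : H →L[ℝ] ℝ) (Ψ (ι (ξ u))) := by
    have := hEG u
    rw [h0, map_zero] at this
    rwa [h1]
  have h8 := HasFDerivAt.comp (g := E) (f := fun ξ : Mᗮ => Ψ (ι ξ)) (ξ u) h7
    h3.differentiableAt.hasFDerivAt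
  exact h8.fderiv.trans (ContinuousLinearMap.zero_comp _)

end LyapunovSchmidt

end

section

open scoped ContDiff Topology
open Filter Set

section PalaisSmale

variable {H : Type*} [NormedAddCommGroup H] [InnerProductSpace ℝ H]
variable {Z : Type*} [NormedAddCommGroup Z] [NormedSpace ℝ Z]

local notation "⟪" x ", " y "⟫" => inner ℝ x y

/-- A vector field is a compact perturbation of the identity, controlled on balls by `J`. -/
def CompactPerturbation (G : H → H) (J : H →L[ℝ] Z) : Prop :=
  ∀ R : ℝ, ∃ C : ℝ, 0 ≤ C ∧ ∀ u u' v : H, ‖u‖ ≤ R → ‖u'‖ ≤ R →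
    |⟪G u - G u', v⟫ - ⟪u - u', v⟫| ≤ C * (‖u - u'‖ * ‖J v‖ + ‖J (u - u')‖ * ‖v‖)

/-- `J` is approximable by finite rank operators in the sense of Ehrling. -/
def EhrlingCompact (J : H →L[ℝ] Z) : Prop :=
  ∀ ε : ℝ, 0 < ε → ∃ (m : ℕ) (l : H →L[ℝ] EuclideanSpace ℝ (Fin m)),
    ∀ u, ‖J u‖ ≤ ε * ‖u‖ + ‖l u‖

variable {G : H → H} {J : H →L[ℝ] Z} {E : H → ℝ}

lemma EhrlingCompact.exists_norm_sub_le (hJ : EhrlingCompact J) (hG : CompactPerturbation G J)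
    (R : ℝ) : ∃ (m : ℕ) (l : H →L[ℝ] EuclideanSpace ℝ (Fin m)), ∀ u u', ‖u‖ ≤ R → ‖u'‖ ≤ R →
      ‖u - u'‖ ≤ 2 * ‖G u - G u'‖ + ‖l u - l u'‖ := by
  obtain ⟨C, hC, h⟩ := hG R
  obtain ⟨m, l, hl⟩ := hJ (1 / (4 * C + 4)) (by positivity)
  refine ⟨m, (4 * C) • l, fun u u' hu hu' => ?_⟩
  set w := u - u' with hw
  have h1 := h u u' w hu hu'
  rw [← hw, real_inner_self_eq_norm_sq] at h1
  have h2 := real_inner_le_norm (G u - G u') w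
  have h3 := hl w
  have h4 : C * (1 / (4 * C + 4)) ≤ 1 / 4 := by
    rw [mul_one_div, div_le_div_iff₀ (by positivity) (by norm_num)]; linarith
  have h5 : ‖((4 * C) • l) u - ((4 * C) • l) u'‖ = 4 * C * ‖l w‖ := by
    rw [← map_sub, ← hw, _root_.smul_apply, norm_smul, Real.norm_of_nonneg (by positivity)]
  rw [h5]
  by_cases hw0 : ‖w‖ = 0
  · rw [hw0]; positivity
  have hwp : 0 < ‖w‖ := lt_of_le_of_ne (norm_nonneg _) (Ne.symm hw0)
  have h6 : C * ‖J w‖ ≤ 1 / 4 * ‖w‖ + C * ‖l w‖ := by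
    calc C * ‖J w‖ ≤ C * (1 / (4 * C + 4) * ‖w‖ + ‖l w‖) := by gcongr
      _ = C * (1 / (4 * C + 4)) * ‖w‖ + C * ‖l w‖ := by ring
      _ ≤ _ := by gcongr
  have h7 : ‖w‖ * ‖w‖ ≤ ‖w‖ * (‖G u - G u'‖ + 2 * (C * ‖J w‖)) := by
    have := (abs_le.1 h1).1
    nlinarith
  have h8 := le_of_mul_le_mul_left h7 hwp
  linarith

lemma EhrlingCompact.ultrafilter_converges [CompleteSpace H] (hJ : EhrlingCompact J) (hG : CompactPerturbation G J)
    {R : ℝ} (F : Ultrafilter H) (hR : ∀ᶠ u in (F : Filter H), ‖u‖ ≤ R)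
    (hF : Tendsto G F (𝓝 0)) : ∃ u, (F : Filter H) ≤ 𝓝 u := by
  obtain ⟨m, l, hl⟩ := hJ.exists_norm_sub_le hG R
  have hb : ∀ᶠ u in (F : Filter H), l u ∈ Metric.closedBall (0 : EuclideanSpace ℝ (Fin m))
      (‖l‖ * R) := by
    filter_upwards [hR] with u hu
    rw [mem_closedBall_zero_iff]
    exact (l.le_opNorm u).trans (by gcongr)
  obtain ⟨p, -, hp⟩ := (isCompact_closedBall (0 : EuclideanSpace ℝ (Fin m))
    (‖l‖ * R)).ultrafilter_le_nhds' (F.map l) hb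
  have hlp : Tendsto l F (𝓝 p) := hp
  have hc : Cauchy (F : Filter H) := by
    rw [Metric.cauchy_iff]
    refine ⟨F.neBot, fun ε hε => ?_⟩
    have h1 : ∀ᶠ u in (F : Filter H), ‖u‖ ≤ R ∧ ‖G u‖ < ε / 8 ∧ ‖l u - p‖ < ε / 8 := by
      refine hR.and (Eventually.and ?_ ?_)
      · have := Metric.tendsto_nhds.1 hF (ε / 8) (by positivity)
        simpa using this
      · have := Metric.tendsto_nhds.1 hlp (ε / 8) (by positivity)
        simpa [dist_eq_norm] using this
    refine ⟨_, h1, fun u hu u' hu' => ?_⟩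
    rw [dist_eq_norm]
    have h2 := hl u u' hu.1 hu'.1
    have h3 := norm_sub_le (G u) (G u')
    have h4 : ‖l u - l u'‖ ≤ ‖l u - p‖ + ‖l u' - p‖ := by
      have := norm_sub_le (l u - p) (l u' - p)
      simpa using this
    linarith [hu.2.1, hu.2.2, hu'.2.1, hu'.2.2]
  exact CompleteSpace.complete hc

lemma EhrlingCompact.half_le_hessian (hJ : EhrlingCompact J) (hG : CompactPerturbation G J) {a : H}
    (hGa : DifferentiableAt ℝ G a) : ∃ (m : ℕ) (l : H →L[ℝ] EuclideanSpace ℝ (Fin m)),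
      ∀ h, l h = 0 → 1 / 2 * ‖h‖ ^ 2 ≤ ⟪fderiv ℝ G a h, h⟫ := by
  obtain ⟨C, hC, hk⟩ := hG (‖a‖ + 1)
  obtain ⟨m, l, hl⟩ := hJ (1 / (4 * C + 4)) (by positivity)
  refine ⟨m, l, fun h hh => ?_⟩
  have h4 : C * (1 / (4 * C + 4)) ≤ 1 / 4 := by
    rw [mul_one_div, div_le_div_iff₀ (by positivity) (by norm_num)]; linarith
  have h3 := hl h
  rw [hh, norm_zero, add_zero] at h3
  have hd : HasDerivAt (fun t : ℝ => ⟪G (a + t • h), h⟫) ⟪fderiv ℝ G a h, h⟫ 0 := by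
    have h1 : HasDerivAt (fun t : ℝ => a + t • h) h 0 := by
      simpa using ((hasDerivAt_id (0 : ℝ)).smul_const h).const_add a
    have h2 : HasFDerivAt G (fderiv ℝ G a) (a + (0 : ℝ) • h) := by
      simpa using hGa.hasFDerivAt
    have h5 := h2.comp_hasDerivAt (0 : ℝ) h1
    simpa using h5.inner ℝ (hasDerivAt_const (0 : ℝ) h)
  rw [hasDerivAt_iff_tendsto_slope_zero] at hd
  have hd' := hd.mono_left (nhdsWithin_mono (0 : ℝ) (fun t (ht : t ∈ Set.Ioi (0 : ℝ)) => ne_of_gt ht))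
  refine ge_of_tendsto hd' ?_
  have hsmall : ∀ᶠ t in 𝓝[>] (0 : ℝ), t * ‖h‖ < 1 := by
    have : Tendsto (fun t : ℝ => t * ‖h‖) (𝓝[>] 0) (𝓝 (0 * ‖h‖)) :=
      (tendsto_id.mono_left nhdsWithin_le_nhds).mul_const _
    rw [zero_mul] at this
    exact this.eventually_lt_const one_pos
  filter_upwards [hsmall, self_mem_nhdsWithin] with t ht htp
  have htp : 0 < t := htp
  have hth : ‖t • h‖ = t * ‖h‖ := by rw [norm_smul, Real.norm_of_nonneg htp.le]
  have h5 := hk (a + t • h) a h ((norm_add_le _ _).trans (by rw [hth]; linarith)) (by linarith)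
  rw [add_sub_cancel_left, hth, map_smul, norm_smul, Real.norm_of_nonneg htp.le,
    real_inner_smul_left, real_inner_self_eq_norm_sq, inner_sub_left] at h5
  simp only [zero_add, zero_smul, add_zero, smul_eq_mul]
  have h6 := (abs_le.1 h5).1
  have h7 : C * ‖J h‖ ≤ 1 / 4 * ‖h‖ := by
    calc C * ‖J h‖ ≤ C * (1 / (4 * C + 4) * ‖h‖) := by gcongr
      _ = C * (1 / (4 * C + 4)) * ‖h‖ := by ring
      _ ≤ _ := by gcongr
  have h8 : C * ‖J h‖ * ‖h‖ ≤ 1 / 4 * ‖h‖ ^ 2 := by nlinarith [norm_nonneg h]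
  rw [le_inv_mul_iff₀ htp]
  nlinarith

/-- Finiteness of the set of levels approached by bounded Palais–Smale sequences of an analytic
function whose gradient is a compact perturbation of the identity. -/
theorem finite_palaisSmale_levels [CompleteSpace H] (hE : ∀ u, AnalyticAt ℝ E u) (hGan : ∀ u, AnalyticAt ℝ G u)
    (hEG : ∀ u, HasFDerivAt E (innerSL ℝ (G u)) u) (hG : CompactPerturbation G J)
    (hJ : EhrlingCompact J) (R : ℝ) :
    {t : ℝ | ∀ ε : ℝ, 0 < ε → ∃ u, ‖u‖ ≤ R ∧ |E u - t| ≤ ε ∧ ‖G u‖ ≤ ε}.Finite := by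
  set S : Set H := {u | ‖u‖ ≤ R ∧ G u = 0}
  have hEc : Continuous E := continuous_iff_continuousAt.2 fun u => (hE u).continuousAt
  have hGc : Continuous G := continuous_iff_continuousAt.2 fun u => (hGan u).continuousAt
  have hS : IsCompact S := by
    rw [isCompact_iff_ultrafilter_le_nhds']
    intro F hF
    have h1 : ∀ᶠ u in (F : Filter H), ‖u‖ ≤ R := Filter.mem_of_superset hF fun u hu => hu.1
    have h2 : Tendsto G F (𝓝 0) :=
      tendsto_const_nhds.congr' (Filter.mem_of_superset hF fun u hu => hu.2.symm)
    obtain ⟨u, hu⟩ := hJ.ultrafilter_converges hG F h1 h2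
    refine ⟨u, ?_, hu⟩
    have hcl : IsClosed S :=
      (isClosed_le continuous_norm continuous_const).inter (isClosed_eq hGc continuous_const)
    exact hcl.mem_of_tendsto (f := id) hu hF
  have hfin : (E '' S).Finite := by
    refine hS.induction_on (p := fun s => (E '' (s ∩ S)).Finite) (by simp) ?_ ?_ ?_ |>.subset
      (by rw [inter_self])
    · intro s t hst ht
      exact ht.subset (image_mono (inter_subset_inter_left _ hst))
    · intro s t hs ht
      rw [union_inter_distrib_right, image_union]
      exact hs.union ht
    · intro a ha
      obtain ⟨m, l, hl⟩ := hJ.half_le_hessian hG (hGan a).differentiableAt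
      let M : Submodule ℝ H := l.ker
      have hMc : IsClosed (M : Set H) := l.isClosed_ker
      have : CompleteSpace M := hMc.completeSpace_coe
      have hfd : FiniteDimensional ℝ Mᗮ := by
        refine FiniteDimensional.of_injective ((l : H →ₗ[ℝ] EuclideanSpace ℝ (Fin m)).comp Mᗮ.subtype) ?_
        rw [← LinearMap.ker_eq_bot, LinearMap.ker_eq_bot']
        intro x hx
        have h1 : (x : H) ∈ M := hx
        have h2 : ⟪(x : H), (x : H)⟫ = 0 := Submodule.inner_right_of_mem_orthogonal h1 x.2
        exact Subtype.ext (inner_self_eq_zero.1 h2)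
      have h1 := eventually_eq_of_gradient_eq_zero (hE a) (hGan a) hEG ha.2 M fun h hh => hl h hh
      refine ⟨{u | G u = 0 → E u = E a}, mem_nhdsWithin_of_mem_nhds h1, ?_⟩
      refine (finite_singleton (E a)).subset ?_
      rintro _ ⟨u, ⟨hu1, hu2⟩, rfl⟩
      exact hu1 hu2.2
  refine hfin.subset fun t ht => ?_
  choose u hu1 hu2 hu3 using fun n : ℕ => ht (1 / ((n : ℝ) + 1)) Nat.one_div_pos_of_nat
  let F : Ultrafilter H := (Ultrafilter.of (atTop : Filter ℕ)).map u
  have hle : (F : Filter H) ≤ map u atTop := Filter.map_mono (Ultrafilter.of_le _)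
  have hGF : Tendsto G F (𝓝 0) := by
    refine Tendsto.mono_left ?_ hle
    rw [tendsto_map'_iff]
    exact squeeze_zero_norm hu3 tendsto_one_div_add_atTop_nhds_zero_nat
  have hEF : Tendsto E F (𝓝 t) := by
    refine Tendsto.mono_left ?_ hle
    rw [tendsto_map'_iff, tendsto_iff_norm_sub_tendsto_zero]
    exact squeeze_zero (fun _ => norm_nonneg _) hu2 tendsto_one_div_add_atTop_nhds_zero_nat
  have hRF : ∀ᶠ u in (F : Filter H), ‖u‖ ≤ R := hle (show ∀ᶠ n in atTop, ‖u n‖ ≤ R from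
    Eventually.of_forall hu1)
  obtain ⟨v, hv⟩ := hJ.ultrafilter_converges hG F hRF hGF
  refine ⟨v, ⟨?_, ?_⟩, ?_⟩
  · exact le_of_tendsto ((continuous_norm.tendsto v).mono_left hv) hRF
  · exact tendsto_nhds_unique ((hGc.tendsto v).mono_left hv) hGF
  · exact tendsto_nhds_unique ((hEc.tendsto v).mono_left hv) hEF

end PalaisSmale

end

section

open scoped ContDiff Topology
open Filter Set

section QuarticEnergy

variable {H Y X Z : Type*} [NormedAddCommGroup H] [InnerProductSpace ℝ H]
  [NormedAddCommGroup Y] [InnerProductSpace ℝ Y] [NormedAddCommGroup X] [InnerProductSpace ℝ X]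
  [NormedAddCommGroup Z] [NormedSpace ℝ Z]

local notation "⟪" x ", " y "⟫" => inner ℝ x y

variable (α : ℝ) (L : H →L[ℝ] Y) (J₂ : H →L[ℝ] X) (J : H →L[ℝ] Z) (β : Z →L[ℝ] Z →L[ℝ] Y) (y₀ : Y)

/-- The affine-quadratic part of an abstract Ginzburg–Landau functional. -/
def quadMap (u : H) : Y := L u + y₀ + β (J u) (J u)

/-- An abstract Ginzburg–Landau functional. -/
def quarticEnergy (u : H) : ℝ := 1 / 2 * ‖quadMap L J β y₀ u‖ ^ 2 - α / 2 * ‖J₂ u‖ ^ 2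

/-- The first variation of `quarticEnergy`. -/
def quarticDeriv (u v : H) : ℝ :=
  ⟪quadMap L J β y₀ u, L v + (β (J u) (J v) + β (J v) (J u))⟫ - α * ⟪J₂ u, J₂ v⟫

variable (H) [CompleteSpace H] in
/-- The Riesz isomorphism as a linear map over the reals. -/
def rieszL : (H →L[ℝ] ℝ) →L[ℝ] H :=
  LinearMap.mkContinuous
    { toFun := fun l => (InnerProductSpace.toDual ℝ H).symm l
      map_add' := fun a b => map_add _ a b
      map_smul' := fun c a => by simp } 1 (fun l => by simp)

lemma inner_rieszL [CompleteSpace H] (l : H →L[ℝ] ℝ) (v : H) : ⟪rieszL H l, v⟫ = l v :=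
  InnerProductSpace.toDual_symm_apply

lemma analyticAt_inner_self {f : H → X} {u : H} (hf : AnalyticAt ℝ f u) :
    AnalyticAt ℝ (fun x => ⟪f x, f x⟫) u :=
  AnalyticAt.comp₂ (h := fun p : X × X => innerSL ℝ p.1 p.2) (f := f) (g := f)
    ((innerSL ℝ : X →L[ℝ] X →L[ℝ] ℝ).analyticAt_bilinear (f u, f u)) hf hf

lemma analyticAt_quarticEnergy (u : H) : AnalyticAt ℝ (quarticEnergy α L J₂ J β y₀) u := by
  have hJ : AnalyticAt ℝ J u := J.analyticAt u
  have h1 : AnalyticAt ℝ (quadMap L J β y₀) u := by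
    refine ((L.analyticAt u).add analyticAt_const).add ?_
    exact AnalyticAt.comp₂ (h := fun p : Z × Z => β p.1 p.2) (f := J) (g := J)
      (β.analyticAt_bilinear (J u, J u)) hJ hJ
  have h2 := analyticAt_inner_self h1
  have h3 := analyticAt_inner_self (J₂.analyticAt u)
  simp only [real_inner_self_eq_norm_sq] at h2 h3
  exact (analyticAt_const.mul h2).sub (analyticAt_const.mul h3)

lemma fderiv_quarticEnergy (u v : H) :
    fderiv ℝ (quarticEnergy α L J₂ J β y₀) u v = quarticDeriv α L J₂ J β y₀ u v := by
  have hl : HasDerivAt (fun t : ℝ => u + t • v) v 0 := by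
    simpa using ((hasDerivAt_id (0 : ℝ)).smul_const v).const_add u
  have h0 : HasFDerivAt (quarticEnergy α L J₂ J β y₀)
      (fderiv ℝ (quarticEnergy α L J₂ J β y₀) u) (u + (0 : ℝ) • v) := by
    simpa using (analyticAt_quarticEnergy α L J₂ J β y₀ u).differentiableAt.hasFDerivAt
  have h1 := h0.comp_hasDerivAt (0 : ℝ) hl
  have hJ : HasDerivAt (fun t : ℝ => J (u + t • v)) (J v) 0 :=
    J.hasFDerivAt.comp_hasDerivAt (0 : ℝ) hl
  have hL : HasDerivAt (fun t : ℝ => L (u + t • v)) (L v) 0 :=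
    L.hasFDerivAt.comp_hasDerivAt (0 : ℝ) hl
  have hJ₂ : HasDerivAt (fun t : ℝ => J₂ (u + t • v)) (J₂ v) 0 :=
    J₂.hasFDerivAt.comp_hasDerivAt (0 : ℝ) hl
  have hβ : HasDerivAt (fun t : ℝ => β (J (u + t • v)) (J (u + t • v)))
      (β (J u) (J v) + β (J v) (J u)) 0 := by
    have := (β.hasFDerivAt.comp_hasDerivAt (0 : ℝ) hJ).clm_apply hJ
    simpa [add_comm] using this
  have hN : HasDerivAt (fun t : ℝ => quadMap L J β y₀ (u + t • v))
      (L v + (β (J u) (J v) + β (J v) (J u))) 0 := (hL.add_const y₀).add hβ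
  have h2 := ((hN.inner ℝ hN).const_mul (1 / 2)).sub ((hJ₂.inner ℝ hJ₂).const_mul (α / 2))
  simp only [real_inner_self_eq_norm_sq] at h2
  refine (h1.unique h2).trans ?_
  simp only [zero_smul, add_zero, quarticDeriv]
  rw [real_inner_comm (quadMap L J β y₀ u), real_inner_comm (J₂ u)]
  ring

lemma quarticDeriv_sub_le (h1 : ∀ u, ‖u‖ ^ 2 = ‖L u‖ ^ 2 + ‖J₂ u‖ ^ 2) {C : ℝ} (hC : 0 ≤ C)
    (h2 : ∀ u, ‖J₂ u‖ ≤ C * ‖J u‖) (R : ℝ) :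
    ∃ C' : ℝ, 0 ≤ C' ∧ ∀ u u' v : H, ‖u‖ ≤ R → ‖u'‖ ≤ R →
      |quarticDeriv α L J₂ J β y₀ u v - quarticDeriv α L J₂ J β y₀ u' v - ⟪u - u', v⟫| ≤
        C' * (‖u - u'‖ * ‖J v‖ + ‖J (u - u')‖ * ‖v‖) := by
  have hL : ∀ u, ‖L u‖ ≤ ‖u‖ := fun u =>
    abs_le_of_sq_le_sq' (by nlinarith [h1 u, sq_nonneg ‖J₂ u‖]) (norm_nonneg _) |>.2
  have hJ₂ : ∀ u, ‖J₂ u‖ ≤ ‖u‖ := fun u =>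
    abs_le_of_sq_le_sq' (by nlinarith [h1 u, sq_nonneg ‖L u‖]) (norm_nonneg _) |>.2
  have hin : ∀ u v, ⟪u, v⟫ = ⟪L u, L v⟫ + ⟪J₂ u, J₂ v⟫ := by
    intro u v
    have e1 := h1 (u + v)
    rw [map_add, map_add, norm_add_sq_real, norm_add_sq_real, norm_add_sq_real, h1 u, h1 v] at e1
    linarith
  set S := max R 0
  have hS0 : 0 ≤ S := le_max_right _ _
  set b := ‖β‖
  set j := ‖J‖
  have hb0 : 0 ≤ b := norm_nonneg β
  have hj0 : 0 ≤ j := norm_nonneg J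
  have hβ : ∀ x y, ‖β x y‖ ≤ b * ‖x‖ * ‖y‖ := β.le_opNorm₂
  have hJb : ∀ u, ‖J u‖ ≤ j * ‖u‖ := J.le_opNorm
  set D := b * (j * S)
  have hD0 : 0 ≤ D := by positivity
  set N := S + ‖y₀‖ + D * (j * S)
  have hN0 : 0 ≤ N := by positivity
  refine ⟨2 * D + (1 + 2 * D * j) * (2 * D) + N * (2 * (b * j)) + (|α| + 1) * C,
    by positivity, fun u u' v hu hu' => ?_⟩
  replace hu : ‖u‖ ≤ S := hu.trans (le_max_left _ _)
  replace hu' : ‖u'‖ ≤ S := hu'.trans (le_max_left _ _)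
  set w := u - u' with hw
  set q := β (J u) (J w) + β (J w) (J u') with hq
  have hJu : ‖J u‖ ≤ j * S := (hJb u).trans (by gcongr)
  have hJu' : ‖J u'‖ ≤ j * S := (hJb u').trans (by gcongr)
  have hqn : ‖q‖ ≤ 2 * D * ‖J w‖ := by
    refine (norm_add_le _ _).trans ?_
    have a1 : ‖β (J u) (J w)‖ ≤ b * (j * S) * ‖J w‖ := (hβ _ _).trans (by gcongr)
    have a2 : ‖β (J w) (J u')‖ ≤ b * ‖J w‖ * (j * S) := (hβ _ _).trans (by gcongr)
    calc _ ≤ b * (j * S) * ‖J w‖ + b * ‖J w‖ * (j * S) := add_le_add a1 a2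
      _ = _ := by simp only [D]; ring
  have hNd : quadMap L J β y₀ u - quadMap L J β y₀ u' = L w + q := by
    simp only [quadMap, hq, hw, map_sub, _root_.sub_apply]
    abel
  have hNdn : ‖L w + q‖ ≤ (1 + 2 * D * j) * ‖w‖ := by
    refine (norm_add_le _ _).trans ?_
    have a1 : 2 * D * ‖J w‖ ≤ 2 * D * (j * ‖w‖) := by gcongr; exact hJb w
    linarith [hL w]
  have hbu : ‖β (J u) (J v) + β (J v) (J u)‖ ≤ 2 * D * ‖J v‖ := by
    refine (norm_add_le _ _).trans ?_
    have a1 : ‖β (J u) (J v)‖ ≤ b * (j * S) * ‖J v‖ := (hβ _ _).trans (by gcongr)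
    have a2 : ‖β (J v) (J u)‖ ≤ b * ‖J v‖ * (j * S) := (hβ _ _).trans (by gcongr)
    calc _ ≤ b * (j * S) * ‖J v‖ + b * ‖J v‖ * (j * S) := add_le_add a1 a2
      _ = _ := by simp only [D]; ring
  have hbw : ‖β (J w) (J v) + β (J v) (J w)‖ ≤ 2 * (b * j) * ‖w‖ * ‖J v‖ := by
    refine (norm_add_le _ _).trans ?_
    have a1 : ‖β (J w) (J v)‖ ≤ b * (j * ‖w‖) * ‖J v‖ :=
      (hβ _ _).trans (by gcongr; exact hJb w)
    have a2 : ‖β (J v) (J w)‖ ≤ b * ‖J v‖ * (j * ‖w‖) :=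
      (hβ _ _).trans (by gcongr; exact hJb w)
    linarith
  have hNu' : ‖quadMap L J β y₀ u'‖ ≤ N := by
    refine (norm_add_le _ _).trans (add_le_add ((norm_add_le _ _).trans ?_) ?_)
    · gcongr; exact (hL u').trans hu'
    · calc ‖β (J u') (J u')‖ ≤ b * ‖J u'‖ * ‖J u'‖ := hβ _ _
        _ ≤ b * (j * S) * (j * S) := by gcongr
  have hexp : quarticDeriv α L J₂ J β y₀ u v - quarticDeriv α L J₂ J β y₀ u' v - ⟪w, v⟫ =
      ⟪q, L v⟫ + ⟪L w + q, β (J u) (J v) + β (J v) (J u)⟫ +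
      ⟪quadMap L J β y₀ u', β (J w) (J v) + β (J v) (J w)⟫ - (α + 1) * ⟪J₂ w, J₂ v⟫ := by
    have e1 : quadMap L J β y₀ u = quadMap L J β y₀ u' + (L w + q) := by rw [← hNd]; abel
    have e2 : β (J u) (J v) + β (J v) (J u) =
        (β (J u') (J v) + β (J v) (J u')) + (β (J w) (J v) + β (J v) (J w)) := by
      simp only [hw, map_sub, _root_.sub_apply]; abel
    have e3 : ⟪J₂ u, J₂ v⟫ = ⟪J₂ u', J₂ v⟫ + ⟪J₂ w, J₂ v⟫ := by
      rw [← inner_add_left, hw, map_sub]; simp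
    rw [hin w v]
    simp only [quarticDeriv]
    rw [e3]
    rw [e1, inner_add_left (quadMap L J β y₀ u'), inner_add_right (quadMap L J β y₀ u') (L v),
      inner_add_right (quadMap L J β y₀ u') (L v), inner_add_right (L w + q) (L v),
      inner_add_left (L w) q (L v)]
    have e4 : ⟪quadMap L J β y₀ u', β (J u) (J v) + β (J v) (J u)⟫ =
        ⟪quadMap L J β y₀ u', β (J u') (J v) + β (J v) (J u')⟫ +
        ⟪quadMap L J β y₀ u', β (J w) (J v) + β (J v) (J w)⟫ := by
      rw [← inner_add_right, ← e2]
    rw [e4]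
    ring
  rw [hexp]
  have t1 : |⟪q, L v⟫| ≤ 2 * D * (‖J w‖ * ‖v‖) :=
    (abs_real_inner_le_norm _ _).trans (by
      calc ‖q‖ * ‖L v‖ ≤ 2 * D * ‖J w‖ * ‖v‖ := by gcongr; exact hL v
        _ = _ := by ring)
  have t2 : |⟪L w + q, β (J u) (J v) + β (J v) (J u)⟫| ≤
      (1 + 2 * D * j) * (2 * D) * (‖w‖ * ‖J v‖) :=
    (abs_real_inner_le_norm _ _).trans (by
      calc _ ≤ ((1 + 2 * D * j) * ‖w‖) * (2 * D * ‖J v‖) := by gcongr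
        _ = _ := by ring)
  have t3 : |⟪quadMap L J β y₀ u', β (J w) (J v) + β (J v) (J w)⟫| ≤
      N * (2 * (b * j)) * (‖w‖ * ‖J v‖) :=
    (abs_real_inner_le_norm _ _).trans (by
      calc _ ≤ N * (2 * (b * j) * ‖w‖ * ‖J v‖) := by gcongr
        _ = _ := by ring)
  have t4 : |(α + 1) * ⟪J₂ w, J₂ v⟫| ≤ (|α| + 1) * C * (‖J w‖ * ‖v‖) := by
    rw [abs_mul]
    have a1 : |α + 1| ≤ |α| + 1 := (abs_add_le _ _).trans (by simp)
    calc _ ≤ (|α| + 1) * (‖J₂ w‖ * ‖J₂ v‖) := by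
          gcongr; exact abs_real_inner_le_norm _ _
      _ ≤ (|α| + 1) * (C * ‖J w‖ * ‖v‖) := by gcongr; exacts [h2 w, hJ₂ v]
      _ = _ := by ring
  set p := ‖w‖ * ‖J v‖
  set r := ‖J w‖ * ‖v‖
  have hp0 : 0 ≤ p := by positivity
  have hr0 : 0 ≤ r := by positivity
  have tot : ∀ x y z s : ℝ, |x + y + z - s| ≤ |x| + |y| + |z| + |s| := fun x y z s =>
    (abs_sub _ _).trans (by gcongr; exact abs_add_three _ _ _)
  refine (tot _ _ _ _).trans ?_
  have k1 : 0 ≤ 2 * D := by positivity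
  have k2 : 0 ≤ (1 + 2 * D * j) * (2 * D) := by positivity
  have k3 : 0 ≤ N * (2 * (b * j)) := by positivity
  have k4 : 0 ≤ (|α| + 1) * C := by positivity
  generalize 2 * D = x1 at *
  generalize (1 + x1 * j) * x1 = x2 at *
  generalize N * (2 * (b * j)) = x3 at *
  generalize (|α| + 1) * C = x4 at *
  nlinarith [mul_nonneg k1 hp0, mul_nonneg k2 hr0, mul_nonneg k3 hr0, mul_nonneg k4 hp0]

/-- Finiteness of the levels approached by bounded Palais–Smale sequences of an abstract
Ginzburg–Landau functional. -/
theorem finite_quarticEnergy_levels [CompleteSpace H] (h1 : ∀ u, ‖u‖ ^ 2 = ‖L u‖ ^ 2 + ‖J₂ u‖ ^ 2) {C : ℝ}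
    (hC : 0 ≤ C) (h2 : ∀ u, ‖J₂ u‖ ≤ C * ‖J u‖) (h3 : EhrlingCompact J) {D : Set H} (hD : Dense D)
    (R : ℝ) :
    {t : ℝ | ∀ ε : ℝ, 0 < ε → ∃ u, ‖u‖ ≤ R ∧ |quarticEnergy α L J₂ J β y₀ u - t| ≤ ε ∧
      ∀ v ∈ D, |quarticDeriv α L J₂ J β y₀ u v| ≤ ε * ‖v‖}.Finite := by
  set E := quarticEnergy α L J₂ J β y₀ with hE
  let G : H → H := fun u => rieszL H (fderiv ℝ E u)
  have hGin : ∀ u v, ⟪G u, v⟫ = quarticDeriv α L J₂ J β y₀ u v := fun u v => by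
    rw [inner_rieszL, fderiv_quarticEnergy]
  have hEan : ∀ u, AnalyticAt ℝ E u := analyticAt_quarticEnergy α L J₂ J β y₀
  refine (finite_palaisSmale_levels (E := E) (G := G) (J := J) hEan ?_ ?_ ?_ h3 R).subset ?_
  · intro u
    exact ((rieszL H).analyticAt _).comp (hEan u).fderiv
  · intro u
    refine (hEan u).differentiableAt.hasFDerivAt.congr_fderiv ?_
    ext v
    exact (inner_rieszL _ v).symm
  · intro R
    obtain ⟨C', hC', h⟩ := quarticDeriv_sub_le α L J₂ J β y₀ h1 hC h2 R
    refine ⟨C', hC', fun u u' v hu hu' => ?_⟩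
    rw [inner_sub_left, hGin, hGin]
    exact h u u' v hu hu'
  · intro t ht ε hε
    obtain ⟨u, hu1, hu2, hu3⟩ := ht ε hε
    refine ⟨u, hu1, hu2, ?_⟩
    have h4 : ∀ v, |⟪G u, v⟫| ≤ ε * ‖v‖ := by
      have hcl : IsClosed {v | |⟪G u, v⟫| ≤ ε * ‖v‖} := by
        refine isClosed_le ?_ ?_ <;> fun_prop
      intro v
      have := hcl.closure_subset_iff.2 (fun v (hv : v ∈ D) => by
        show |⟪G u, v⟫| ≤ ε * ‖v‖
        rw [hGin]; exact hu3 v hv)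
      exact this (hD v)
    have h5 := h4 (G u)
    rw [real_inner_self_eq_norm_sq, abs_of_nonneg (by positivity), sq] at h5
    by_cases h0 : ‖G u‖ = 0
    · rw [h0]; exact hε.le
    · exact le_of_mul_le_mul_right h5 (lt_of_le_of_ne (norm_nonneg _) (Ne.symm h0))

end QuarticEnergy

end

section

open scoped ContDiff Topology
open Filter Set

section SquareIntegrals

variable {E : Type*} [NormedAddCommGroup E] [NormedSpace ℝ E]

theorem isCompact_unitSquare : IsCompact unitSquare := isCompact_Icc

theorem unitSquare_eq : unitSquare = Icc (0 : ℝ) 1 ×ˢ Icc (0 : ℝ) 1 := by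
  rw [unitSquare, Icc_prod_eq]

theorem Continuous.integrableOn_unitSquare {E : Type*} [NormedAddCommGroup E] {f : ℝ × ℝ → E} (hf : Continuous f) :
    IntegrableOn f unitSquare :=
  hf.continuousOn.integrableOn_compact isCompact_unitSquare

theorem setIntegral_rectangle {f : ℝ × ℝ → E} (hf : Continuous f) {a b c d : ℝ}
    (hab : a ≤ b) (hcd : c ≤ d) :
    ∫ x in Icc a b ×ˢ Icc c d, f x = ∫ s in a..b, ∫ t in c..d, f (s, t) := by
  rw [Measure.volume_eq_prod, setIntegral_prod]
  · rw [intervalIntegral.integral_of_le hab, integral_Icc_eq_integral_Ioc]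
    congr 1
    ext s
    rw [intervalIntegral.integral_of_le hcd, integral_Icc_eq_integral_Ioc]
  · rw [← Measure.volume_eq_prod]
    exact hf.continuousOn.integrableOn_compact (isCompact_Icc.prod isCompact_Icc)

theorem setIntegral_unitSquare {f : ℝ × ℝ → E} (hf : Continuous f) :
    ∫ x in unitSquare, f x = ∫ s in (0 : ℝ)..1, ∫ t in (0 : ℝ)..1, f (s, t) := by
  rw [unitSquare_eq, setIntegral_rectangle hf zero_le_one zero_le_one]

theorem integral_rectangle_swap {f : ℝ × ℝ → E} (hf : Continuous f) (a b c d : ℝ) :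
    ∫ s in a..b, ∫ t in c..d, f (s, t) = ∫ t in c..d, ∫ s in a..b, f (s, t) := by
  refine intervalIntegral_intervalIntegral_swap ?_
  exact (hf.continuousOn.integrableOn_compact
    ((isCompact_uIcc (a := a) (b := b)).prod (isCompact_uIcc (a := c) (b := d)))).mono_set
    (prod_mono uIoc_subset_uIcc uIoc_subset_uIcc)

theorem setIntegral_unitSquare_swap {f : ℝ × ℝ → E} (hf : Continuous f) :
    ∫ x in unitSquare, f x = ∫ t in (0 : ℝ)..1, ∫ s in (0 : ℝ)..1, f (s, t) := by
  rw [setIntegral_unitSquare hf, integral_rectangle_swap hf]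

theorem measurableSet_unitSquare : MeasurableSet unitSquare := isCompact_unitSquare.measurableSet

theorem volume_unitSquare : volume unitSquare = 1 := by
  rw [unitSquare_eq, Measure.volume_eq_prod, Measure.prod_prod]
  simp

theorem setIntegral_unitSquare_mono {f g : ℝ × ℝ → ℝ} (hf : Continuous f) (hg : Continuous g)
    (h : ∀ x ∈ unitSquare, f x ≤ g x) :
    ∫ x in unitSquare, f x ≤ ∫ x in unitSquare, g x :=
  setIntegral_mono_on hf.integrableOn_unitSquare hg.integrableOn_unitSquare
    measurableSet_unitSquare h

theorem setIntegral_unitSquare_const (c : E) [CompleteSpace E] :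
    ∫ _x in unitSquare, c = c := by
  rw [setIntegral_const, Measure.real, volume_unitSquare]
  simp

end SquareIntegrals

section PartialDerivatives

variable {E : Type*} [NormedAddCommGroup E] [NormedSpace ℝ E]

theorem hasDerivAt_pd1 {f : ℝ × ℝ → E} {s t : ℝ} (hf : DifferentiableAt ℝ f (s, t)) :
    HasDerivAt (fun s => f (s, t)) (pd1 f (s, t)) s := by
  have h : HasDerivAt (fun s : ℝ => (s, t)) ((1 : ℝ), (0 : ℝ)) s :=
    (hasDerivAt_id s).prodMk (hasDerivAt_const s t)
  exact (hf.hasFDerivAt.comp_hasDerivAt s h)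

theorem hasDerivAt_pd2 {f : ℝ × ℝ → E} {s t : ℝ} (hf : DifferentiableAt ℝ f (s, t)) :
    HasDerivAt (fun t => f (s, t)) (pd2 f (s, t)) t := by
  have h : HasDerivAt (fun t : ℝ => (s, t)) ((0 : ℝ), (1 : ℝ)) t :=
    (hasDerivAt_const t s).prodMk (hasDerivAt_id t)
  exact (hf.hasFDerivAt.comp_hasDerivAt t h)

theorem ContDiff.continuous_pd1 {f : ℝ × ℝ → E} (hf : ContDiff ℝ 1 f) : Continuous (pd1 f) :=
  (hf.continuous_fderiv one_ne_zero).clm_apply continuous_const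

theorem ContDiff.continuous_pd2 {f : ℝ × ℝ → E} (hf : ContDiff ℝ 1 f) : Continuous (pd2 f) :=
  (hf.continuous_fderiv one_ne_zero).clm_apply continuous_const

end PartialDerivatives

section OneDimensional

variable {E : Type*} [NormedAddCommGroup E] [NormedSpace ℝ E] [CompleteSpace E]

theorem norm_sub_le_integral_norm_deriv {g g' : ℝ → E} (hg : ∀ x, HasDerivAt g (g' x) x)
    (hg' : Continuous g') {a b x y : ℝ} (hx : x ∈ Icc a b) (hy : y ∈ Icc a b) :
    ‖g x - g y‖ ≤ ∫ s in a..b, ‖g' s‖ := by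
  have hab : a ≤ b := hx.1.trans hx.2
  rw [← intervalIntegral.integral_eq_sub_of_hasDerivAt (fun t _ => hg t)
    (hg'.intervalIntegrable y x)]
  refine (intervalIntegral.norm_integral_le_integral_norm_uIoc).trans ?_
  rw [intervalIntegral.integral_of_le hab]
  refine setIntegral_mono_set ?_ (Eventually.of_forall fun _ => norm_nonneg _) ?_
  · exact (hg'.norm.intervalIntegrable a b).1
  · refine LE.le.eventuallyLE (Ioc_subset_Ioc ?_ ?_)
    · exact le_min hy.1 hx.1
    · exact max_le hy.2 hx.2

theorem norm_le_integral_add_integral_deriv {g g' : ℝ → E} (hg : ∀ x, HasDerivAt g (g' x) x)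
    (hg' : Continuous g') {x : ℝ} (hx : x ∈ Icc (0 : ℝ) 1) :
    ‖g x‖ ≤ (∫ s in (0 : ℝ)..1, ‖g s‖) + ∫ s in (0 : ℝ)..1, ‖g' s‖ := by
  have hgc : Continuous g := continuous_iff_continuousAt.2 fun x => (hg x).continuousAt
  have h : ∫ _s in (0 : ℝ)..1, ‖g x‖ ≤
      ∫ s in (0 : ℝ)..1, (‖g s‖ + ∫ s in (0 : ℝ)..1, ‖g' s‖) := by
    refine intervalIntegral.integral_mono_on zero_le_one
      (continuous_const.intervalIntegrable _ _)
      (Continuous.intervalIntegrable (by fun_prop) _ _) fun s hs => ?_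
    have := norm_sub_le_integral_norm_deriv hg hg' hx hs
    have h2 := norm_le_insert' (g x) (g s)
    linarith
  rw [intervalIntegral.integral_add (hgc.norm.intervalIntegrable _ _)
    (continuous_const.intervalIntegrable _ _)] at h
  simpa using h

theorem sq_integral_le {g : ℝ → ℝ} (hg : Continuous g) {a b : ℝ} (hab : a ≤ b) :
    (∫ s in a..b, g s) ^ 2 ≤ (b - a) * ∫ s in a..b, g s ^ 2 := by
  rcases hab.eq_or_lt with rfl | hab'
  · simp
  set m := ∫ s in a..b, g s with hm
  have h : 0 ≤ ∫ s in a..b, ((b - a) * g s - m) ^ 2 :=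
    intervalIntegral.integral_nonneg hab fun _ _ => sq_nonneg _
  have h2 : ∫ s in a..b, ((b - a) * g s - m) ^ 2 =
      (b - a) ^ 2 * (∫ s in a..b, g s ^ 2) - 2 * (b - a) * m * (∫ s in a..b, g s)
        + (b - a) * m ^ 2 := by
    have : ∀ s, ((b - a) * g s - m) ^ 2 =
        (b - a) ^ 2 * g s ^ 2 - 2 * (b - a) * m * g s + m ^ 2 := fun s => by ring
    simp only [this]
    rw [intervalIntegral.integral_add, intervalIntegral.integral_sub,
      intervalIntegral.integral_const_mul, intervalIntegral.integral_const_mul,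
      intervalIntegral.integral_const]
    · simp
    all_goals exact Continuous.intervalIntegrable (by fun_prop) _ _
  rw [h2, ← hm] at h
  have h3 : 0 ≤ (b - a) * ((b - a) * (∫ s in a..b, g s ^ 2) - m ^ 2) := by nlinarith
  have := nonneg_of_mul_nonneg_right h3 (sub_pos.2 hab')
  linarith

end OneDimensional
end

section

open scoped ContDiff Topology
open Filter Set

section Rectangles

variable {E : Type*} [NormedAddCommGroup E] [NormedSpace ℝ E] [CompleteSpace E]

theorem continuous_integral_fst {E : Type*} [NormedAddCommGroup E] [NormedSpace ℝ E]
    {f : ℝ × ℝ → E} (hf : Continuous f) (a b : ℝ) :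
    Continuous fun t => ∫ s in a..b, f (s, t) :=
  intervalIntegral.continuous_parametric_intervalIntegral_of_continuous' (f := fun t s => f (s, t))
    (hf.comp continuous_swap) a b

theorem continuous_integral_snd {E : Type*} [NormedAddCommGroup E] [NormedSpace ℝ E]
    {f : ℝ × ℝ → E} (hf : Continuous f) (a b : ℝ) :
    Continuous fun s => ∫ t in a..b, f (s, t) :=
  intervalIntegral.continuous_parametric_intervalIntegral_of_continuous' (f := fun s t => f (s, t))
    hf a b

theorem norm_sub_le_integral_pd {f : ℝ × ℝ → E} (hf : ContDiff ℝ 1 f) {a b c d x y s t : ℝ}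
    (hx : x ∈ Icc a b) (hy : y ∈ Icc c d) (hs : s ∈ Icc a b) (ht : t ∈ Icc c d) :
    ‖f (x, y) - f (s, t)‖ ≤
      (∫ u in a..b, ‖pd1 f (u, y)‖) + ∫ v in c..d, ‖pd2 f (s, v)‖ := by
  have hd := hf.differentiable one_ne_zero
  have h1 := norm_sub_le_integral_norm_deriv (g := fun u => f (u, y))
    (fun u => hasDerivAt_pd1 (hd (u, y))) (hf.continuous_pd1.comp (by fun_prop)) hx hs
  have h2 := norm_sub_le_integral_norm_deriv (g := fun v => f (s, v))
    (fun v => hasDerivAt_pd2 (hd (s, v))) (hf.continuous_pd2.comp (by fun_prop)) hy ht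
  have : f (x, y) - f (s, t) = (f (x, y) - f (s, y)) + (f (s, y) - f (s, t)) := by abel
  rw [this]
  exact (norm_add_le _ _).trans (add_le_add h1 h2)

theorem norm_sub_mean_le {f : ℝ × ℝ → E} (hf : ContDiff ℝ 1 f) {a b c d x y : ℝ}
    (hx : x ∈ Icc a b) (hy : y ∈ Icc c d) :
    ‖((b - a) * (d - c)) • f (x, y) - ∫ s in a..b, ∫ t in c..d, f (s, t)‖ ≤
      (b - a) * (d - c) * (∫ u in a..b, ‖pd1 f (u, y)‖) +
        (d - c) * ∫ s in a..b, ∫ v in c..d, ‖pd2 f (s, v)‖ := by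
  have hab : a ≤ b := hx.1.trans hx.2
  have hcd : c ≤ d := hy.1.trans hy.2
  have hfc := hf.continuous
  have h2c := hf.continuous_pd2.norm
  have e : ((b - a) * (d - c)) • f (x, y) - ∫ s in a..b, ∫ t in c..d, f (s, t) =
      ∫ s in a..b, ∫ t in c..d, (f (x, y) - f (s, t)) := by
    have : ∀ s, ∫ t in c..d, (f (x, y) - f (s, t)) =
        (d - c) • f (x, y) - ∫ t in c..d, f (s, t) := fun s => by
      rw [intervalIntegral.integral_sub (continuous_const.intervalIntegrable _ _)
        (Continuous.intervalIntegrable (by fun_prop) _ _), intervalIntegral.integral_const]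
    simp only [this]
    rw [intervalIntegral.integral_sub (continuous_const.intervalIntegrable _ _)
        ((continuous_integral_snd hfc c d).intervalIntegrable _ _),
      intervalIntegral.integral_const, smul_smul]
  rw [e]
  set A := ∫ u in a..b, ‖pd1 f (u, y)‖ with hA
  have h1 : ∀ s ∈ Icc a b, ‖∫ t in c..d, (f (x, y) - f (s, t))‖ ≤
      (d - c) * (A + ∫ v in c..d, ‖pd2 f (s, v)‖) := fun s hs => by
    have := intervalIntegral.norm_integral_le_of_norm_le_const
      (a := c) (b := d) (f := fun t => f (x, y) - f (s, t))
      (C := A + ∫ v in c..d, ‖pd2 f (s, v)‖) fun t ht => by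
        rw [uIoc_of_le hcd] at ht
        exact norm_sub_le_integral_pd hf hx hy hs ⟨ht.1.le, ht.2⟩
    rwa [abs_of_nonneg (sub_nonneg.2 hcd), mul_comm] at this
  have hB := continuous_integral_snd h2c c d
  refine (intervalIntegral.norm_integral_le_of_norm_le hab
    (g := fun s => (d - c) * (A + ∫ v in c..d, ‖pd2 f (s, v)‖))
    (Eventually.of_forall fun s hs => h1 s ⟨hs.1.le, hs.2⟩)
    (Continuous.intervalIntegrable (by fun_prop) _ _)).trans ?_
  rw [intervalIntegral.integral_const_mul, intervalIntegral.integral_add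
    (continuous_const.intervalIntegrable _ _) (hB.intervalIntegrable _ _),
    intervalIntegral.integral_const, smul_eq_mul]
  apply le_of_eq
  ring

/-- The Poincaré inequality in `L¹` on the unit square. -/
theorem integral_norm_sub_mean_le {f : ℝ × ℝ → E} (hf : ContDiff ℝ 1 f) :
    ∫ x in unitSquare, ‖f x - ∫ y in unitSquare, f y‖ ≤
      (∫ x in unitSquare, ‖pd1 f x‖) + ∫ x in unitSquare, ‖pd2 f x‖ := by
  have h1c := hf.continuous_pd1.norm
  have h2c := hf.continuous_pd2.norm
  have hfc := hf.continuous
  set m := ∫ y in unitSquare, f y with hm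
  set B := ∫ x in unitSquare, ‖pd2 f x‖ with hB
  have key : ∀ x ∈ unitSquare, ‖f x - m‖ ≤ (∫ u in (0 : ℝ)..1, ‖pd1 f (u, x.2)‖) + B := by
    rintro ⟨x, y⟩ hxy
    rw [unitSquare_eq] at hxy
    have := norm_sub_mean_le hf hxy.1 hxy.2
    rw [← setIntegral_unitSquare hfc, ← setIntegral_unitSquare h2c] at this
    simpa using this
  have hA : Continuous fun x : ℝ × ℝ => ∫ u in (0 : ℝ)..1, ‖pd1 f (u, x.2)‖ :=
    (continuous_integral_fst h1c 0 1).comp continuous_snd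
  refine (setIntegral_unitSquare_mono
    (g := fun x => (∫ u in (0 : ℝ)..1, ‖pd1 f (u, x.2)‖) + B)
    (by fun_prop) (hA.add continuous_const) key).trans ?_
  rw [integral_add hA.integrableOn_unitSquare
    (Continuous.integrableOn_unitSquare (by fun_prop)), setIntegral_unitSquare_const]
  refine add_le_add ?_ le_rfl
  rw [setIntegral_unitSquare hA, setIntegral_unitSquare_swap h1c]
  simp

end Rectangles

section Sobolev

variable {E : Type*} [NormedAddCommGroup E] [NormedSpace ℝ E] [CompleteSpace E]

/-- The embedding of `W^{1,1}` into `L²` on the unit square. -/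
theorem integral_norm_sq_le {f : ℝ × ℝ → E} (hf : ContDiff ℝ 1 f) :
    ∫ x in unitSquare, ‖f x‖ ^ 2 ≤
      ((∫ x in unitSquare, ‖f x‖) + ∫ x in unitSquare, ‖pd1 f x‖) *
        ((∫ x in unitSquare, ‖f x‖) + ∫ x in unitSquare, ‖pd2 f x‖) := by
  have h1c := hf.continuous_pd1.norm
  have h2c := hf.continuous_pd2.norm
  have hfc := hf.continuous.norm
  have hd := hf.differentiable one_ne_zero
  set u : ℝ → ℝ := fun t => (∫ s in (0 : ℝ)..1, ‖f (s, t)‖) + ∫ s in (0 : ℝ)..1, ‖pd1 f (s, t)‖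
  set v : ℝ → ℝ := fun s => (∫ t in (0 : ℝ)..1, ‖f (s, t)‖) + ∫ t in (0 : ℝ)..1, ‖pd2 f (s, t)‖
  have hu : Continuous u :=
    (continuous_integral_fst hfc 0 1).add (continuous_integral_fst h1c 0 1)
  have hv : Continuous v :=
    (continuous_integral_snd hfc 0 1).add (continuous_integral_snd h2c 0 1)
  have key : ∀ x ∈ unitSquare, ‖f x‖ ^ 2 ≤ v x.1 * u x.2 := by
    rintro ⟨x, y⟩ hxy
    rw [unitSquare_eq] at hxy
    have h1 : ‖f (x, y)‖ ≤ u y := norm_le_integral_add_integral_deriv (g := fun s => f (s, y))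
      (fun s => hasDerivAt_pd1 (hd (s, y))) (hf.continuous_pd1.comp (by fun_prop)) hxy.1
    have h2 : ‖f (x, y)‖ ≤ v x := norm_le_integral_add_integral_deriv (g := fun t => f (x, t))
      (fun t => hasDerivAt_pd2 (hd (x, t))) (hf.continuous_pd2.comp (by fun_prop)) hxy.2
    rw [sq]
    exact mul_le_mul h2 h1 (norm_nonneg _) ((norm_nonneg _).trans h2)
  refine (setIntegral_unitSquare_mono (by fun_prop) (by fun_prop) key).trans (le_of_eq ?_)
  rw [setIntegral_unitSquare (by fun_prop)]
  simp only [intervalIntegral.integral_const_mul, intervalIntegral.integral_mul_const]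
  rw [mul_comm]
  congr 1
  · rw [intervalIntegral.integral_add
      ((continuous_integral_fst hfc 0 1).intervalIntegrable _ _)
      ((continuous_integral_fst h1c 0 1).intervalIntegrable _ _),
      setIntegral_unitSquare_swap hfc, setIntegral_unitSquare_swap h1c]
  · rw [intervalIntegral.integral_add
      ((continuous_integral_snd hfc 0 1).intervalIntegrable _ _)
      ((continuous_integral_snd h2c 0 1).intervalIntegrable _ _),
      setIntegral_unitSquare hfc, setIntegral_unitSquare h2c]

end Sobolev
end

section

open scoped ContDiff Topology
open Filter Set

section CauchySchwarz

theorem sq_setIntegral_mul_le {f g : ℝ × ℝ → ℝ} (hf : Continuous f) (hg : Continuous g) :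
    (∫ x in unitSquare, f x * g x) ^ 2 ≤
      (∫ x in unitSquare, f x ^ 2) * ∫ x in unitSquare, g x ^ 2 := by
  have h : ∀ t : ℝ, 0 ≤ (∫ x in unitSquare, f x ^ 2) * (t * t) +
      (2 * ∫ x in unitSquare, f x * g x) * t + ∫ x in unitSquare, g x ^ 2 := fun t => by
    have h0 : 0 ≤ ∫ x in unitSquare, (t * f x + g x) ^ 2 :=
      integral_nonneg fun _ => sq_nonneg _
    have e : ∀ x, (t * f x + g x) ^ 2 = t * t * f x ^ 2 + 2 * t * (f x * g x) + g x ^ 2 :=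
      fun x => by ring
    simp only [e] at h0
    rw [integral_add, integral_add, integral_const_mul, integral_const_mul] at h0
    · linarith
    all_goals exact Continuous.integrableOn_unitSquare (by fun_prop)
  have := discrim_le_zero h
  rw [discrim] at this
  linarith

end CauchySchwarz

section Ladyzhenskaya

variable {V : Type*} [NormedAddCommGroup V] [InnerProductSpace ℝ V]

theorem abs_fderiv_norm_sq_le {f : ℝ × ℝ → V} (hf : ContDiff ℝ 1 f) (x v : ℝ × ℝ) :
    |fderiv ℝ (fun y => ‖f y‖ ^ 2) x v| ≤ 2 * (‖f x‖ * ‖fderiv ℝ f x v‖) := by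
  have h := ((hf.differentiable one_ne_zero x).hasFDerivAt.norm_sq).fderiv
  rw [h]
  simp only [_root_.smul_apply, ContinuousLinearMap.comp_apply, innerSL_apply_apply,
    nsmul_eq_mul]
  rw [abs_mul]
  have := abs_real_inner_le_norm (f x) (fderiv ℝ f x v)
  simpa using this

/-- Ladyzhenskaya's inequality on the unit square. -/
theorem integral_norm_pow_four_le {f : ℝ × ℝ → V} (hf : ContDiff ℝ 1 f) :
    ∫ x in unitSquare, ‖f x‖ ^ 4 ≤
      4 * (∫ x in unitSquare, ‖f x‖ ^ 2) *
        ((∫ x in unitSquare, ‖f x‖ ^ 2) + (∫ x in unitSquare, ‖pd1 f x‖ ^ 2) +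
          ∫ x in unitSquare, ‖pd2 f x‖ ^ 2) := by
  have hfc := hf.continuous
  have h1c := hf.continuous_pd1
  have h2c := hf.continuous_pd2
  set h : ℝ × ℝ → ℝ := fun x => ‖f x‖ ^ 2 with hh
  have hh1 : ContDiff ℝ 1 h := hf.norm_sq ℝ
  have key := integral_norm_sq_le hh1
  have e4 : ∀ x, (‖f x‖ ^ 2) ^ 2 = ‖f x‖ ^ 4 := fun x => by ring
  have e2 : ∀ x, ‖h x‖ = ‖f x‖ ^ 2 := fun x => by
    rw [hh, Real.norm_of_nonneg (by positivity)]
  have b1 : ∫ x in unitSquare, ‖pd1 h x‖ ≤ 2 * ∫ x in unitSquare, ‖f x‖ * ‖pd1 f x‖ := by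
    rw [← integral_const_mul]
    exact setIntegral_unitSquare_mono hh1.continuous_pd1.norm (by fun_prop)
      fun x _ => abs_fderiv_norm_sq_le hf x _
  have b2 : ∫ x in unitSquare, ‖pd2 h x‖ ≤ 2 * ∫ x in unitSquare, ‖f x‖ * ‖pd2 f x‖ := by
    rw [← integral_const_mul]
    exact setIntegral_unitSquare_mono hh1.continuous_pd2.norm (by fun_prop)
      fun x _ => abs_fderiv_norm_sq_le hf x _
  have c1 := sq_setIntegral_mul_le hfc.norm h1c.norm
  have c2 := sq_setIntegral_mul_le hfc.norm h2c.norm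
  simp only [e2, e4] at key
  set M := ∫ x in unitSquare, ‖f x‖ ^ 2
  set P := ∫ x in unitSquare, ‖pd1 h x‖
  set Q := ∫ x in unitSquare, ‖pd2 h x‖
  have hM : 0 ≤ M := integral_nonneg fun _ => by positivity
  have hP : 0 ≤ P := integral_nonneg fun _ => by positivity
  have hQ : 0 ≤ Q := integral_nonneg fun _ => by positivity
  set p := ∫ x in unitSquare, ‖f x‖ * ‖pd1 f x‖
  set q := ∫ x in unitSquare, ‖f x‖ * ‖pd2 f x‖
  have d1 : P ^ 2 ≤ (2 * p) ^ 2 := pow_le_pow_left₀ hP b1 2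
  have d2 : Q ^ 2 ≤ (2 * q) ^ 2 := pow_le_pow_left₀ hQ b2 2
  nlinarith [sq_nonneg (P - Q), sq_nonneg (M - P), sq_nonneg (M - Q)]

end Ladyzhenskaya

section Poincare

variable {E : Type*} [NormedAddCommGroup E] [NormedSpace ℝ E] [CompleteSpace E]

theorem integral_rectangle_mono {f g : ℝ × ℝ → ℝ} (hf : Continuous f) (hg : Continuous g)
    {a b c d : ℝ} (hab : a ≤ b) (hcd : c ≤ d)
    (h : ∀ x ∈ Icc a b, ∀ y ∈ Icc c d, f (x, y) ≤ g (x, y)) :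
    ∫ s in a..b, ∫ t in c..d, f (s, t) ≤ ∫ s in a..b, ∫ t in c..d, g (s, t) :=
  intervalIntegral.integral_mono_on hab
    ((continuous_integral_snd hf c d).intervalIntegrable _ _)
    ((continuous_integral_snd hg c d).intervalIntegrable _ _) fun s hs =>
      intervalIntegral.integral_mono_on hcd (Continuous.intervalIntegrable (by fun_prop) _ _)
        (Continuous.intervalIntegrable (by fun_prop) _ _) fun t ht => h s hs t ht

/-- The Poincaré inequality on a square of side `δ`. -/
theorem poincare_square {f : ℝ × ℝ → E} (hf : ContDiff ℝ 1 f) (a c : ℝ) {δ : ℝ} (hδ : 0 < δ) :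
    ∫ s in a..a + δ, ∫ t in c..c + δ, ‖f (s, t)‖ ^ 2 ≤
      4 * δ ^ 2 * ((∫ s in a..a + δ, ∫ t in c..c + δ, ‖pd1 f (s, t)‖ ^ 2) +
        ∫ s in a..a + δ, ∫ t in c..c + δ, ‖pd2 f (s, t)‖ ^ 2) +
      2 / δ ^ 2 * ‖∫ s in a..a + δ, ∫ t in c..c + δ, f (s, t)‖ ^ 2 := by
  have ha : a ≤ a + δ := by linarith
  have hc : c ≤ c + δ := by linarith
  have hfc := hf.continuous
  have h1c := hf.continuous_pd1
  have h2c := hf.continuous_pd2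
  set M := ∫ s in a..a + δ, ∫ t in c..c + δ, f (s, t) with hM
  set B := ∫ s in a..a + δ, ∫ t in c..c + δ, ‖pd2 f (s, t)‖ with hB
  set G := ∫ s in a..a + δ, ∫ t in c..c + δ, ‖pd2 f (s, t)‖ ^ 2 with hG
  have hBG : B ^ 2 ≤ δ ^ 2 * G := by
    have hc2 := continuous_integral_snd h2c.norm c (c + δ)
    have h1 := sq_integral_le hc2 ha
    have h2 : ∫ s in a..a + δ, (∫ t in c..c + δ, ‖pd2 f (s, t)‖) ^ 2 ≤
        ∫ s in a..a + δ, δ * ∫ t in c..c + δ, ‖pd2 f (s, t)‖ ^ 2 := by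
      refine intervalIntegral.integral_mono_on ha ((hc2.pow 2).intervalIntegrable _ _)
        ((continuous_const.mul (continuous_integral_snd (f := fun x => ‖pd2 f x‖ ^ 2)
          (by fun_prop) c (c + δ))).intervalIntegrable _ _) fun s _ => ?_
      have := sq_integral_le (g := fun t => ‖pd2 f (s, t)‖) (by fun_prop) hc
      simpa using this
    rw [intervalIntegral.integral_const_mul, ← hG] at h2
    rw [← hB] at h1
    have e : a + δ - a = δ := by ring
    rw [e] at h1
    nlinarith
  have hA1 : Continuous fun x : ℝ × ℝ => ∫ u in a..a + δ, ‖pd1 f (u, x.2)‖ ^ 2 :=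
    (continuous_integral_fst (f := fun x => ‖pd1 f x‖ ^ 2) (by fun_prop) a (a + δ)).comp
      continuous_snd
  have key : ∀ x ∈ Icc a (a + δ), ∀ y ∈ Icc c (c + δ), δ ^ 4 * ‖f (x, y)‖ ^ 2 ≤
      4 * δ ^ 5 * (∫ u in a..a + δ, ‖pd1 f (u, y)‖ ^ 2) +
        (2 * ‖M‖ ^ 2 + 4 * δ ^ 4 * G) := fun x hx y hy => by
    have h1 := norm_sub_mean_le hf hx hy
    have e1 : a + δ - a = δ := by ring
    have e2 : c + δ - c = δ := by ring
    rw [e1, e2, ← hM, ← hB] at h1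
    have h3 := sq_integral_le (g := fun u => ‖pd1 f (u, y)‖) (by fun_prop) ha
    rw [e1] at h3
    set A := ∫ u in a..a + δ, ‖pd1 f (u, y)‖
    have h4 : ‖(δ * δ) • f (x, y)‖ ≤ ‖M‖ + ‖(δ * δ) • f (x, y) - M‖ := norm_le_insert' _ _
    rw [norm_smul, Real.norm_of_nonneg (by positivity)] at h4
    have h5 : δ * δ * ‖f (x, y)‖ ≤ ‖M‖ + (δ * δ * A + δ * B) := h4.trans (by linarith)
    have h6 : (δ * δ * ‖f (x, y)‖) ^ 2 ≤ (‖M‖ + (δ * δ * A + δ * B)) ^ 2 :=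
      pow_le_pow_left₀ (by positivity) h5 2
    have h7 : δ ^ 4 * A ^ 2 ≤ δ ^ 4 * (δ * ∫ u in a..a + δ, ‖pd1 f (u, y)‖ ^ 2) :=
      mul_le_mul_of_nonneg_left h3 (by positivity)
    have h8 : δ ^ 2 * B ^ 2 ≤ δ ^ 2 * (δ ^ 2 * G) :=
      mul_le_mul_of_nonneg_left hBG (by positivity)
    nlinarith [sq_nonneg (‖M‖ - (δ * δ * A + δ * B)), sq_nonneg (δ * δ * A - δ * B)]
  have h := integral_rectangle_mono
    (f := fun x => δ ^ 4 * ‖f x‖ ^ 2)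
    (g := fun x => 4 * δ ^ 5 * (∫ u in a..a + δ, ‖pd1 f (u, x.2)‖ ^ 2) +
        (2 * ‖M‖ ^ 2 + 4 * δ ^ 4 * G)) (by fun_prop)
    ((continuous_const.mul hA1).add continuous_const) ha hc key
  have hA2 : Continuous fun t => ∫ u in a..a + δ, ‖pd1 f (u, t)‖ ^ 2 :=
    continuous_integral_fst (f := fun x => ‖pd1 f x‖ ^ 2) (by fun_prop) a (a + δ)
  simp only [intervalIntegral.integral_const_mul] at h
  rw [intervalIntegral.integral_congr fun s _ => intervalIntegral.integral_add
    (f := fun t => 4 * δ ^ 5 * ∫ u in a..a + δ, ‖pd1 f (u, t)‖ ^ 2)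
    (g := fun _ => 2 * ‖M‖ ^ 2 + 4 * δ ^ 4 * G)
    ((continuous_const.mul hA2).intervalIntegrable _ _)
    (continuous_const.intervalIntegrable _ _), intervalIntegral.integral_const_mul,
    ← integral_rectangle_swap (f := fun x => ‖pd1 f x‖ ^ 2) (by fun_prop)] at h
  simp only [intervalIntegral.integral_const, smul_eq_mul, add_sub_cancel_left] at h
  set I := ∫ s in a..a + δ, ∫ t in c..c + δ, ‖f (s, t)‖ ^ 2
  set H := ∫ s in a..a + δ, ∫ t in c..c + δ, ‖pd1 f (s, t)‖ ^ 2
  have h9 : δ ^ 4 * I ≤ δ ^ 4 * (4 * δ ^ 2 * (H + G) + 2 / δ ^ 2 * ‖M‖ ^ 2) := by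
    refine h.trans (le_of_eq ?_)
    field_simp
    ring
  exact le_of_mul_le_mul_left h9 (by positivity)

theorem integral_eq_sum_squares {E : Type*} [NormedAddCommGroup E] [NormedSpace ℝ E]
    {f : ℝ × ℝ → E} (hf : Continuous f) {N : ℕ} (hN : 0 < N) :
    ∫ x in unitSquare, f x = ∑ j ∈ Finset.range N, ∑ k ∈ Finset.range N,
      ∫ s in (j / N : ℝ)..j / N + 1 / N, ∫ t in (k / N : ℝ)..k / N + 1 / N, f (s, t) := by
  have hN' : (N : ℝ) ≠ 0 := by positivity
  have aux : ∀ {F : Type _} [NormedAddCommGroup F] [NormedSpace ℝ F] (g : ℝ → F),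
      Continuous g → ∫ s in (0 : ℝ)..1, g s =
        ∑ j ∈ Finset.range N, ∫ s in (j / N : ℝ)..j / N + 1 / N, g s := by
    intro F _ _ g hg
    have := intervalIntegral.sum_integral_adjacent_intervals (f := g) (μ := volume)
      (a := fun j : ℕ => (j / N : ℝ)) (n := N) fun k _ => hg.intervalIntegrable _ _
    simp only [Nat.cast_zero, zero_div, div_self hN'] at this
    rw [← this]
    refine Finset.sum_congr rfl fun j _ => ?_
    rw [Nat.cast_succ, add_div]
  rw [setIntegral_unitSquare hf, aux _ (continuous_integral_snd hf 0 1)]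
  refine Finset.sum_congr rfl fun j _ => ?_
  rw [← intervalIntegral.integral_finsetSum fun k _ =>
    (continuous_integral_snd hf _ _).intervalIntegrable _ _]
  refine intervalIntegral.integral_congr fun s _ => ?_
  exact aux (fun t => f (s, t)) (by fun_prop)

theorem poincare_sum_squares {f : ℝ × ℝ → E} (hf : ContDiff ℝ 1 f) {N : ℕ} (hN : 0 < N) :
    ∫ x in unitSquare, ‖f x‖ ^ 2 ≤
      4 / N ^ 2 * ((∫ x in unitSquare, ‖pd1 f x‖ ^ 2) + ∫ x in unitSquare, ‖pd2 f x‖ ^ 2) +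
      2 * N ^ 2 * ∑ j ∈ Finset.range N, ∑ k ∈ Finset.range N,
        ‖∫ s in (j / N : ℝ)..j / N + 1 / N, ∫ t in (k / N : ℝ)..k / N + 1 / N, f (s, t)‖ ^ 2 := by
  have hfc := hf.continuous
  have h1c := hf.continuous_pd1
  have h2c := hf.continuous_pd2
  have hN' : (0 : ℝ) < 1 / N := by positivity
  rw [integral_eq_sum_squares (f := fun x => ‖f x‖ ^ 2) (by fun_prop) hN,
    integral_eq_sum_squares (f := fun x => ‖pd1 f x‖ ^ 2) (by fun_prop) hN,
    integral_eq_sum_squares (f := fun x => ‖pd2 f x‖ ^ 2) (by fun_prop) hN]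
  rw [← Finset.sum_add_distrib, Finset.mul_sum, Finset.mul_sum, ← Finset.sum_add_distrib]
  refine Finset.sum_le_sum fun j _ => ?_
  rw [← Finset.sum_add_distrib, Finset.mul_sum, Finset.mul_sum, ← Finset.sum_add_distrib]
  refine Finset.sum_le_sum fun k _ => ?_
  refine (poincare_square hf _ _ hN').trans (le_of_eq ?_)
  have : (N : ℝ) ≠ 0 := by positivity
  field_simp

end Poincare
end

section

open scoped ContDiff Topology
open Filter Set

section PartialCalculus

variable {E : Type*} [NormedAddCommGroup E] [NormedSpace ℝ E]

theorem pd1_eq_of_hasDerivAt {f : ℝ × ℝ → E} {x : ℝ × ℝ} {f' : E}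
    (hf : DifferentiableAt ℝ f x) (h : HasDerivAt (fun s => f (s, x.2)) f' x.1) :
    pd1 f x = f' :=
  (hasDerivAt_pd1 (f := f) (s := x.1) (t := x.2) hf).unique h

theorem pd2_eq_of_hasDerivAt {f : ℝ × ℝ → E} {x : ℝ × ℝ} {f' : E}
    (hf : DifferentiableAt ℝ f x) (h : HasDerivAt (fun t => f (x.1, t)) f' x.2) :
    pd2 f x = f' :=
  (hasDerivAt_pd2 (f := f) (s := x.1) (t := x.2) hf).unique h

theorem ContDiff.pd1 {f : ℝ × ℝ → E} (hf : ContDiff ℝ ∞ f) : ContDiff ℝ ∞ (pd1 f) :=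
  (hf.fderiv_right (m := ∞) le_rfl).clm_apply contDiff_const

theorem ContDiff.pd2 {f : ℝ × ℝ → E} (hf : ContDiff ℝ ∞ f) : ContDiff ℝ ∞ (pd2 f) :=
  (hf.fderiv_right (m := ∞) le_rfl).clm_apply contDiff_const

theorem pd1_add {f g : ℝ × ℝ → E} {x : ℝ × ℝ} (hf : DifferentiableAt ℝ f x)
    (hg : DifferentiableAt ℝ g x) : pd1 (fun y => f y + g y) x = pd1 f x + pd1 g x := by
  simp only [_root_.pd1]
  rw [fderiv_fun_add hf hg]
  rfl

theorem pd2_add {f g : ℝ × ℝ → E} {x : ℝ × ℝ} (hf : DifferentiableAt ℝ f x)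
    (hg : DifferentiableAt ℝ g x) : pd2 (fun y => f y + g y) x = pd2 f x + pd2 g x := by
  simp only [_root_.pd2]
  rw [fderiv_fun_add hf hg]
  rfl

theorem pd1_sub {f g : ℝ × ℝ → E} {x : ℝ × ℝ} (hf : DifferentiableAt ℝ f x)
    (hg : DifferentiableAt ℝ g x) : pd1 (fun y => f y - g y) x = pd1 f x - pd1 g x := by
  simp only [_root_.pd1]
  rw [fderiv_fun_sub hf hg]
  rfl

theorem pd2_sub {f g : ℝ × ℝ → E} {x : ℝ × ℝ} (hf : DifferentiableAt ℝ f x)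
    (hg : DifferentiableAt ℝ g x) : pd2 (fun y => f y - g y) x = pd2 f x - pd2 g x := by
  simp only [_root_.pd2]
  rw [fderiv_fun_sub hf hg]
  rfl

theorem pd1_const_smul {f : ℝ × ℝ → E} {x : ℝ × ℝ} (c : ℝ) (hf : DifferentiableAt ℝ f x) :
    pd1 (fun y => c • f y) x = c • pd1 f x := by
  simp only [_root_.pd1]
  rw [fderiv_fun_const_smul hf]
  rfl

theorem pd2_const_smul {f : ℝ × ℝ → E} {x : ℝ × ℝ} (c : ℝ) (hf : DifferentiableAt ℝ f x) :
    pd2 (fun y => c • f y) x = c • pd2 f x := by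
  simp only [_root_.pd2]
  rw [fderiv_fun_const_smul hf]
  rfl

theorem pd1_mul {f g : ℝ × ℝ → ℝ} {x : ℝ × ℝ} (hf : DifferentiableAt ℝ f x)
    (hg : DifferentiableAt ℝ g x) :
    pd1 (fun y => f y * g y) x = f x * pd1 g x + pd1 f x * g x := by
  simp only [_root_.pd1]
  rw [fderiv_fun_mul hf hg]
  simp [mul_comm]

theorem pd2_mul {f g : ℝ × ℝ → ℝ} {x : ℝ × ℝ} (hf : DifferentiableAt ℝ f x)
    (hg : DifferentiableAt ℝ g x) :
    pd2 (fun y => f y * g y) x = f x * pd2 g x + pd2 f x * g x := by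
  simp only [_root_.pd2]
  rw [fderiv_fun_mul hf hg]
  simp [mul_comm]

theorem pd1_inner {f g : ℝ × ℝ → ℂ} {x : ℝ × ℝ} (a : ℝ × ℝ → ℝ) (hf : DifferentiableAt ℝ f x)
    (hg : DifferentiableAt ℝ g x) :
    pd1 (fun y => inner ℝ (f y) (g y)) x = inner ℝ (f x) (D1 a g x) + inner ℝ (D1 a f x) (g x) := by
  simp only [_root_.pd1, D1]
  rw [fderiv_inner_apply ℝ hf hg]
  simp [Complex.inner]
  ring

theorem pd2_inner {f g : ℝ × ℝ → ℂ} {x : ℝ × ℝ} (a : ℝ × ℝ → ℝ) (hf : DifferentiableAt ℝ f x)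
    (hg : DifferentiableAt ℝ g x) :
    pd2 (fun y => inner ℝ (f y) (g y)) x = inner ℝ (f x) (D2 a g x) + inner ℝ (D2 a f x) (g x) := by
  simp only [_root_.pd2, D2]
  rw [fderiv_inner_apply ℝ hf hg]
  simp [Complex.inner]
  ring

theorem pd1_pd2_comm {f : ℝ × ℝ → E} (hf : ContDiff ℝ ∞ f) (x : ℝ × ℝ) :
    pd1 (pd2 f) x = pd2 (pd1 f) x := by
  have hsymm : IsSymmSndFDerivAt ℝ f x :=
    (contDiff_infty.1 hf 2).contDiffAt.isSymmSndFDerivAt (by simp)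
  have hd : DifferentiableAt ℝ (fderiv ℝ f) x :=
    (hf.fderiv_right (m := ∞) le_rfl).differentiable (by simp) x
  have h1 : pd1 (pd2 f) x = fderiv ℝ (fderiv ℝ f) x (1, 0) (0, 1) := by
    change fderiv ℝ (fun y => fderiv ℝ f y (0, 1)) x (1, 0) = _
    rw [fderiv_clm_apply hd (differentiableAt_const _)]
    simp
  have h2 : pd2 (pd1 f) x = fderiv ℝ (fderiv ℝ f) x (0, 1) (1, 0) := by
    change fderiv ℝ (fun y => fderiv ℝ f y (1, 0)) x (0, 1) = _
    rw [fderiv_clm_apply hd (differentiableAt_const _)]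
    simp
  rw [h1, h2]
  exact hsymm (1, 0) (0, 1)

end PartialCalculus

section Periodic

variable {E : Type*} [NormedAddCommGroup E] [NormedSpace ℝ E]

/-- `1`-periodicity in the first coordinate. -/
def Periodic1 {F : Type*} (f : ℝ × ℝ → F) : Prop := ∀ x : ℝ × ℝ, f (x.1 + 1, x.2) = f x

/-- `1`-periodicity in the second coordinate. -/
def Periodic2 {F : Type*} (f : ℝ × ℝ → F) : Prop := ∀ x : ℝ × ℝ, f (x.1, x.2 + 1) = f x

theorem fderiv_shift (f : ℝ × ℝ → E) (x v : ℝ × ℝ) :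
    fderiv ℝ (fun y => f (y + v)) x = fderiv ℝ f (x + v) := by
  rw [fderiv_comp_add_right]

theorem Periodic1.eq_add {F : Type*} {f : ℝ × ℝ → F} (h : Periodic1 f) :
    (fun y => f (y + (1, 0))) = f := by
  ext y
  rw [← h y]
  congr 1
  ext <;> simp

theorem Periodic2.eq_add {F : Type*} {f : ℝ × ℝ → F} (h : Periodic2 f) :
    (fun y => f (y + (0, 1))) = f := by
  ext y
  rw [← h y]
  congr 1
  ext <;> simp

theorem Periodic1.fderiv {f : ℝ × ℝ → E} (h : Periodic1 f) : Periodic1 (fderiv ℝ f) := fun x => by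
  have := fderiv_shift f x (1, 0)
  rw [h.eq_add] at this
  rw [this]
  congr 1
  ext <;> simp

theorem Periodic2.fderiv {f : ℝ × ℝ → E} (h : Periodic2 f) : Periodic2 (fderiv ℝ f) := fun x => by
  have := fderiv_shift f x (0, 1)
  rw [h.eq_add] at this
  rw [this]
  congr 1
  ext <;> simp

theorem Periodic1.pd1 {f : ℝ × ℝ → E} (h : Periodic1 f) : Periodic1 (pd1 f) :=
  fun x => by simp only [_root_.pd1, h.fderiv x]

theorem Periodic1.pd2 {f : ℝ × ℝ → E} (h : Periodic1 f) : Periodic1 (pd2 f) :=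
  fun x => by simp only [_root_.pd2, h.fderiv x]

theorem Periodic2.pd1 {f : ℝ × ℝ → E} (h : Periodic2 f) : Periodic2 (pd1 f) :=
  fun x => by simp only [_root_.pd1, h.fderiv x]

theorem Periodic2.pd2 {f : ℝ × ℝ → E} (h : Periodic2 f) : Periodic2 (pd2 f) :=
  fun x => by simp only [_root_.pd2, h.fderiv x]

variable [CompleteSpace E]

theorem integral_pd1_eq_zero {f : ℝ × ℝ → E} (hf : ContDiff ℝ 1 f) (h : Periodic1 f) :
    ∫ x in unitSquare, pd1 f x = 0 := by
  have hd := hf.differentiable one_ne_zero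
  rw [setIntegral_unitSquare_swap hf.continuous_pd1]
  have : ∀ t, ∫ s in (0 : ℝ)..1, _root_.pd1 f (s, t) = 0 := fun t => by
    rw [intervalIntegral.integral_eq_sub_of_hasDerivAt
      (fun s _ => hasDerivAt_pd1 (hd (s, t)))
      ((hf.continuous_pd1.comp (by fun_prop : Continuous fun s => (s, t))).intervalIntegrable _ _)]
    have := h (0, t)
    simp only [zero_add] at this
    rw [this, sub_self]
  simp [this]

theorem integral_pd2_eq_zero {f : ℝ × ℝ → E} (hf : ContDiff ℝ 1 f) (h : Periodic2 f) :
    ∫ x in unitSquare, pd2 f x = 0 := by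
  have hd := hf.differentiable one_ne_zero
  rw [setIntegral_unitSquare hf.continuous_pd2]
  have : ∀ s, ∫ t in (0 : ℝ)..1, _root_.pd2 f (s, t) = 0 := fun s => by
    rw [intervalIntegral.integral_eq_sub_of_hasDerivAt
      (fun t _ => hasDerivAt_pd2 (hd (s, t)))
      ((hf.continuous_pd2.comp (by fun_prop : Continuous fun t => (s, t))).intervalIntegrable _ _)]
    have := h (s, 0)
    simp only [zero_add] at this
    rw [this, sub_self]
  simp [this]

theorem integral_pd_add_pd_eq_zero {f g : ℝ × ℝ → E} (hf : ContDiff ℝ 1 f) (hf' : Periodic1 f)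
    (hg : ContDiff ℝ 1 g) (hg' : Periodic2 g) :
    ∫ x in unitSquare, (pd1 f x + pd2 g x) = 0 := by
  rw [integral_add hf.continuous_pd1.integrableOn_unitSquare
    hg.continuous_pd2.integrableOn_unitSquare, integral_pd1_eq_zero hf hf',
    integral_pd2_eq_zero hg hg', add_zero]

/-- The `L²` norm of the gradient of a periodic vector field is controlled by its curl and
divergence. -/
theorem integral_gradient_eq_curl_div {b c : ℝ × ℝ → ℝ} (hb : ContDiff ℝ ∞ b)
    (hc : ContDiff ℝ ∞ c) (hb1 : Periodic1 b) (hb2 : Periodic2 b) (hc1 : Periodic1 c)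
    (hc2 : Periodic2 c) :
    ∫ x in unitSquare, (pd1 b x ^ 2 + pd2 b x ^ 2 + pd1 c x ^ 2 + pd2 c x ^ 2) =
      ∫ x in unitSquare, (curv b c x ^ 2 + (pd1 b x + pd2 c x) ^ 2) := by
  have h1 : ContDiff ℝ 1 fun x => b x * pd2 c x := (hb.mul hc.pd2).of_le (by exact_mod_cast le_top)
  have h2 : ContDiff ℝ 1 fun x => -(b x * pd1 c x) :=
    (hb.mul hc.pd1).neg.of_le (by exact_mod_cast le_top)
  have h := integral_pd_add_pd_eq_zero h1 (fun x => by rw [hb1 x, hc1.pd2 x]) h2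
    (fun x => by rw [hb2 x, hc2.pd1 x])
  have bc := hb.pd1.continuous
  have bc' := hb.pd2.continuous
  have cc := hc.pd1.continuous
  have cc' := hc.pd2.continuous
  have e : ∀ x, curv b c x ^ 2 + (pd1 b x + pd2 c x) ^ 2 =
      (pd1 b x ^ 2 + pd2 b x ^ 2 + pd1 c x ^ 2 + pd2 c x ^ 2) +
        2 * (pd1 (fun x => b x * pd2 c x) x + pd2 (fun x => -(b x * pd1 c x)) x) := fun x => by
    have db := hb.differentiable (by simp) x
    have e2 : _root_.pd2 (fun x => -(b x * _root_.pd1 c x)) x =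
        -(_root_.pd2 (fun x => b x * _root_.pd1 c x) x) := by
      simp [_root_.pd2, fderiv_fun_neg]
    rw [e2, pd1_mul db (hc.pd2.differentiable (by simp) x),
      pd2_mul db (hc.pd1.differentiable (by simp) x), pd1_pd2_comm hc x, curv]
    ring
  have hq : Continuous fun x => 2 * (_root_.pd1 (fun x => b x * _root_.pd2 c x) x +
      _root_.pd2 (fun x => -(b x * _root_.pd1 c x)) x) :=
    continuous_const.mul (h1.continuous_pd1.add h2.continuous_pd2)
  simp only [e]
  rw [integral_add (Continuous.integrableOn_unitSquare (by fun_prop)) hq.integrableOn_unitSquare,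
    integral_const_mul, h, mul_zero, add_zero]

end Periodic
end

section

open scoped ContDiff Topology
open Filter Set

section QuasiPeriodic

/-- The quasi-periodicity in the second coordinate of sections of the line bundle of degree `d`. -/
def QuasiPeriodic (d : ℤ) (φ : ℝ × ℝ → ℂ) : Prop :=
  ∀ x : ℝ × ℝ, φ (x.1, x.2 + 1) =
    Complex.exp (2 * Real.pi * Complex.I * (d : ℂ) * (x.1 : ℂ)) * φ x

theorem norm_exp_factor (d : ℤ) (s : ℝ) :
    ‖Complex.exp (2 * Real.pi * Complex.I * (d : ℂ) * (s : ℂ))‖ = 1 := by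
  have : (2 * Real.pi * Complex.I * (d : ℂ) * (s : ℂ)) =
      ((2 * Real.pi * d * s : ℝ) : ℂ) * Complex.I := by
    push_cast
    ring
  rw [this, Complex.norm_exp_ofReal_mul_I]

theorem inner_mul_mul_of_norm_eq_one {e : ℂ} (he : ‖e‖ = 1) (u v : ℂ) :
    inner ℝ (e * u) (e * v) = inner ℝ u v := by
  rw [Complex.inner, Complex.inner, map_mul]
  have h : (starRingEnd ℂ) e * e = 1 := by
    rw [Complex.conj_mul', he]
    simp
  congr 1
  linear_combination ((starRingEnd ℂ) u * v) * h

theorem QuasiPeriodic.inner {d : ℤ} {φ ψ : ℝ × ℝ → ℂ} (hφ : QuasiPeriodic d φ)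
    (hψ : QuasiPeriodic d ψ) : Periodic2 fun x => inner ℝ (φ x) (ψ x) := fun x => by
  simp only [hφ x, hψ x, inner_mul_mul_of_norm_eq_one (norm_exp_factor d x.1)]

theorem QuasiPeriodic.eq_add {d : ℤ} {φ : ℝ × ℝ → ℂ} (h : QuasiPeriodic d φ) :
    (fun y => φ (y + (0, 1))) =
      fun y => Complex.exp (2 * Real.pi * Complex.I * (d : ℂ) * (y.1 : ℂ)) * φ y := by
  ext y
  rw [← h y]
  congr 1
  ext <;> simp

theorem QuasiPeriodic.D1 {d : ℤ} {φ : ℝ × ℝ → ℂ} (h : QuasiPeriodic d φ)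
    (hφ : Differentiable ℝ φ) {a : ℝ × ℝ → ℝ}
    (ha : ∀ x : ℝ × ℝ, a (x.1, x.2 + 1) = a x - 2 * Real.pi * d) : QuasiPeriodic d (D1 a φ) := by
  intro x
  have h1 : _root_.pd1 φ (x.1, x.2 + 1) = Complex.exp (2 * Real.pi * Complex.I * d * x.1) *
      (_root_.pd1 φ x + 2 * Real.pi * Complex.I * d * φ x) := by
    have e : pd1 φ (x.1, x.2 + 1) = pd1 (fun y => φ (y + (0, 1))) x := by
      simp only [pd1, fderiv_shift]
      congr 2
      ext <;> simp
    rw [e, h.eq_add]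
    refine pd1_eq_of_hasDerivAt (f := fun y : ℝ × ℝ =>
      Complex.exp (2 * Real.pi * Complex.I * d * y.1) * φ y) ?_ ?_
    · have : DifferentiableAt ℝ (fun y : ℝ × ℝ => ((y.1 : ℝ) : ℂ)) x :=
        (Complex.ofRealCLM.differentiableAt (x := x.1)).comp x differentiableAt_fst
      exact ((this.const_mul _).cexp).mul (hφ x)
    · have d1 : HasDerivAt (fun s : ℝ => ((s : ℝ) : ℂ)) 1 x.1 := Complex.ofRealCLM.hasDerivAt
      have d2 := (d1.const_mul (2 * Real.pi * Complex.I * d : ℂ)).cexp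
      have d3 := d2.mul (hasDerivAt_pd1 (f := φ) (s := x.1) (t := x.2) (hφ x))
      refine d3.congr_deriv ?_
      ring
  simp only [_root_.D1, h1, h x, ha x]
  push_cast
  ring

theorem QuasiPeriodic.D2 {d : ℤ} {φ : ℝ × ℝ → ℂ} (h : QuasiPeriodic d φ)
    (hφ : Differentiable ℝ φ) {a : ℝ × ℝ → ℝ} (ha : Periodic2 a) : QuasiPeriodic d (D2 a φ) := by
  intro x
  have h1 : _root_.pd2 φ (x.1, x.2 + 1) = Complex.exp (2 * Real.pi * Complex.I * d * x.1) *
      _root_.pd2 φ x := by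
    have e : pd2 φ (x.1, x.2 + 1) = pd2 (fun y => φ (y + (0, 1))) x := by
      simp only [pd2, fderiv_shift]
      congr 2
      ext <;> simp
    rw [e, h.eq_add]
    refine pd2_eq_of_hasDerivAt (f := fun y : ℝ × ℝ =>
      Complex.exp (2 * Real.pi * Complex.I * d * y.1) * φ y) ?_ ?_
    · have : DifferentiableAt ℝ (fun y : ℝ × ℝ => ((y.1 : ℝ) : ℂ)) x :=
        (Complex.ofRealCLM.differentiableAt (x := x.1)).comp x differentiableAt_fst
      exact ((this.const_mul _).cexp).mul (hφ x)
    · exact (hasDerivAt_pd2 (f := φ) (s := x.1) (t := x.2) (hφ x)).const_mul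
        (Complex.exp (2 * Real.pi * Complex.I * d * x.1))
  simp only [_root_.D2, h1, h x, ha x]
  ring

theorem Periodic1.D1 {φ : ℝ × ℝ → ℂ} (h : Periodic1 φ) {a : ℝ × ℝ → ℝ} (ha : Periodic1 a) :
    Periodic1 (D1 a φ) := fun x => by
  simp only [_root_.D1, h.pd1 x, h x, ha x]

theorem Periodic1.D2 {φ : ℝ × ℝ → ℂ} (h : Periodic1 φ) {a : ℝ × ℝ → ℝ} (ha : Periodic1 a) :
    Periodic1 (D2 a φ) := fun x => by
  simp only [_root_.D2, h.pd2 x, h x, ha x]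

theorem ContDiff.D1 {φ : ℝ × ℝ → ℂ} (h : ContDiff ℝ ∞ φ) {a : ℝ × ℝ → ℝ} (ha : ContDiff ℝ ∞ a) :
    ContDiff ℝ ∞ (D1 a φ) :=
  h.pd1.add ((contDiff_const.mul (Complex.ofRealCLM.contDiff.comp ha)).mul h)

theorem ContDiff.D2 {φ : ℝ × ℝ → ℂ} (h : ContDiff ℝ ∞ φ) {a : ℝ × ℝ → ℝ} (ha : ContDiff ℝ ∞ a) :
    ContDiff ℝ ∞ (D2 a φ) :=
  h.pd2.add ((contDiff_const.mul (Complex.ofRealCLM.contDiff.comp ha)).mul h)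

theorem ContDiff.curv {a b : ℝ × ℝ → ℝ} (ha : ContDiff ℝ ∞ a) (hb : ContDiff ℝ ∞ b) :
    ContDiff ℝ ∞ (curv a b) := hb.pd1.sub ha.pd2

end QuasiPeriodic

section WeakForm

/-- The space of smooth variations of field pairs of degree `d`. -/
def smoothFields (d : ℤ) : Submodule ℝ ((ℝ × ℝ → ℝ) × (ℝ × ℝ → ℝ) × (ℝ × ℝ → ℂ)) where
  carrier := {s | (ContDiff ℝ ∞ s.1 ∧ Periodic1 s.1 ∧ Periodic2 s.1) ∧
    (ContDiff ℝ ∞ s.2.1 ∧ Periodic1 s.2.1 ∧ Periodic2 s.2.1) ∧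
    (ContDiff ℝ ∞ s.2.2 ∧ Periodic1 s.2.2 ∧ QuasiPeriodic d s.2.2)}
  add_mem' := by
    rintro s t ⟨⟨a1, a2, a3⟩, ⟨b1, b2, b3⟩, c1, c2, c3⟩ ⟨⟨a1', a2', a3'⟩, ⟨b1', b2', b3'⟩, c1', c2', c3'⟩
    refine ⟨⟨a1.add a1', fun x => ?_, fun x => ?_⟩, ⟨b1.add b1', fun x => ?_, fun x => ?_⟩,
      c1.add c1', fun x => ?_, fun x => ?_⟩
    · simp [a2 x, a2' x]
    · simp [a3 x, a3' x]
    · simp [b2 x, b2' x]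
    · simp [b3 x, b3' x]
    · simp [c2 x, c2' x]
    · simp [c3 x, c3' x, mul_add]
  zero_mem' := ⟨⟨contDiff_const, fun _ => rfl, fun _ => rfl⟩,
    ⟨contDiff_const, fun _ => rfl, fun _ => rfl⟩, contDiff_const, fun _ => rfl,
    fun x => by simp⟩
  smul_mem' := by
    rintro r s ⟨⟨a1, a2, a3⟩, ⟨b1, b2, b3⟩, c1, c2, c3⟩
    refine ⟨⟨a1.const_smul r, fun x => ?_, fun x => ?_⟩,
      ⟨b1.const_smul r, fun x => ?_, fun x => ?_⟩, c1.const_smul r, fun x => ?_, fun x => ?_⟩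
    · simp [a2 x]
    · simp [a3 x]
    · simp [b2 x]
    · simp [b3 x]
    · simp [c2 x]
    · simp only [Prod.smul_snd, Pi.smul_apply, c3 x, Complex.real_smul]
      ring

theorem weak_form {α β : ℝ} {d : ℤ} {F₀ : ℝ × ℝ → ℝ} (hF₀ : ExternalField d F₀) {P : FieldPair d}
    (hP : IsGLSolution α β F₀ P) {c₁ c₂ : ℝ × ℝ → ℝ} {ψ : ℝ × ℝ → ℂ}
    (ht : (c₁, c₂, ψ) ∈ smoothFields d) :
    ∫ x in unitSquare, ((curv P.a1 P.a2 x - F₀ x) * curv c₁ c₂ x +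
      inner ℝ (D1 P.a1 P.φ x) (D1 P.a1 ψ x + Complex.I * c₁ x * P.φ x) +
      inner ℝ (D2 P.a2 P.φ x) (D2 P.a2 ψ x + Complex.I * c₂ x * P.φ x) +
      (β * ‖P.φ x‖ ^ 2 - α) * inner ℝ (P.φ x) (ψ x)) = 0 := by
  obtain ⟨⟨k1, k2, k3⟩, ⟨l1, l2, l3⟩, m1, m2, m3⟩ := ht
  simp only at k1 k2 k3 l1 l2 l3 m1 m2 m3
  have sa1 := P.smooth_a1
  have sa2 := P.smooth_a2
  have sφ := P.smooth_φ
  have hh : ContDiff ℝ ∞ fun x => curv P.a1 P.a2 x - F₀ x := (sa1.curv sa2).sub hF₀.1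
  have h1 : Periodic1 fun x => curv P.a1 P.a2 x - F₀ x := fun x => by
    have p1 : Periodic1 P.a1 := P.per1_a1
    have p2 : Periodic1 P.a2 := P.per1_a2
    simp only [curv, p1.pd2 x, p2.pd1 x, hF₀.2.1 x]
  have h2 : Periodic2 fun x => curv P.a1 P.a2 x - F₀ x := fun x => by
    have p2 : Periodic2 P.a2 := P.per2_a2
    have p1 : pd2 P.a1 (x.1, x.2 + 1) = pd2 P.a1 x := by
      have e : pd2 P.a1 (x.1, x.2 + 1) = pd2 (fun y => P.a1 (y + (0, 1))) x := by
        simp only [pd2, fderiv_shift]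
        congr 2
        ext <;> simp
      have e2 : (fun y => P.a1 (y + (0, 1))) = fun y => P.a1 y - 2 * Real.pi * d := by
        ext y
        rw [← P.per2_a1 y]
        congr 1
        ext <;> simp
      rw [e, e2]
      simp only [pd2]
      rw [fderiv_sub_const]
    simp only [curv, p1, p2.pd1 x, hF₀.2.2.1 x]
  set h : ℝ × ℝ → ℝ := fun x => curv P.a1 P.a2 x - F₀ x with hdef
  have sD1 : ContDiff ℝ ∞ (D1 P.a1 P.φ) := sφ.D1 sa1
  have sD2 : ContDiff ℝ ∞ (D2 P.a2 P.φ) := sφ.D2 sa2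
  have qφ : QuasiPeriodic d P.φ := P.per2_φ
  have q1 : QuasiPeriodic d (D1 P.a1 P.φ) := qφ.D1 (sφ.differentiable (by simp)) P.per2_a1
  have q2 : QuasiPeriodic d (D2 P.a2 P.φ) := qφ.D2 (sφ.differentiable (by simp)) P.per2_a2
  have r1 : Periodic1 (D1 P.a1 P.φ) := Periodic1.D1 P.per1_φ P.per1_a1
  have r2 : Periodic1 (D2 P.a2 P.φ) := Periodic1.D2 P.per1_φ P.per1_a2
  have sf : ContDiff ℝ ∞ fun x => h x * c₂ x + inner ℝ (D1 P.a1 P.φ x) (ψ x) :=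
    (hh.mul l1).add (sD1.inner ℝ m1)
  have sg : ContDiff ℝ ∞ fun x => inner ℝ (D2 P.a2 P.φ x) (ψ x) - h x * c₁ x :=
    (sD2.inner ℝ m1).sub (hh.mul k1)
  rw [← integral_pd_add_pd_eq_zero (sf.of_le (by exact_mod_cast le_top))
    (fun x => by simp only [h1 x, l2 x, r1 x, m2 x]) (sg.of_le (by exact_mod_cast le_top))
    (fun x => by
      have := q2.inner m3 x
      simp only at this
      simp only [h2 x, k3 x, this])]
  congr 1
  ext x
  have df : ∀ {F : Type} [NormedAddCommGroup F] [NormedSpace ℝ F] {f : ℝ × ℝ → F},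
      ContDiff ℝ ∞ f → DifferentiableAt ℝ f x := fun hf => hf.differentiable (by simp) x
  rw [pd1_add (df (hh.mul l1)) (df (sD1.inner ℝ m1)), pd1_mul (df hh) (df l1),
    pd1_inner P.a1 (df sD1) (df m1), pd2_sub (df (sD2.inner ℝ m1)) (df (hh.mul k1)),
    pd2_mul (df hh) (df k1), pd2_inner P.a2 (df sD2) (df m1)]
  have E1 := hP.1 x
  have E2 := hP.2.1 x
  have E3 := hP.2.2 x
  have E3' : inner ℝ (D1 P.a1 (D1 P.a1 P.φ) x) (ψ x) + inner ℝ (D2 P.a2 (D2 P.a2 P.φ) x) (ψ x) =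
      (β * ‖P.φ x‖ ^ 2 - α) * inner ℝ (P.φ x) (ψ x) := by
    rw [← inner_add_left, ← real_inner_smul_left]
    congr 1
    rw [Complex.real_smul]
    push_cast
    linear_combination -E3
  have I1 : inner ℝ (D1 P.a1 P.φ x) (Complex.I * c₁ x * P.φ x) =
      c₁ x * ((starRingEnd ℂ) (P.φ x) * D1 P.a1 P.φ x).im := by
    simp [Complex.inner]
    ring
  have I2 : inner ℝ (D2 P.a2 P.φ x) (Complex.I * c₂ x * P.φ x) =
      c₂ x * ((starRingEnd ℂ) (P.φ x) * D2 P.a2 P.φ x).im := by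
    simp [Complex.inner]
    ring
  rw [inner_add_right, inner_add_right, I1, I2]
  have hx : curv P.a1 P.a2 x - F₀ x = h x := rfl
  rw [hx, curv]
  rw [← hdef] at E1 E2
  linear_combination c₁ x * E1 + c₂ x * E2 - E3'

end WeakForm
end

section

open scoped ContDiff Topology
open Filter Set

section Apriori

theorem FieldPair.integral_curv {d : ℤ} (P : FieldPair d) :
    ∫ x in unitSquare, curv P.a1 P.a2 x = 2 * Real.pi * d := by
  have sa1 := P.smooth_a1
  have sa2 := P.smooth_a2
  have s0 : ContDiff ℝ ∞ fun x : ℝ × ℝ => 2 * Real.pi * d * x.2 := contDiff_const.mul contDiff_snd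
  have s1 : ContDiff ℝ 1 fun x : ℝ × ℝ => -(P.a1 x + 2 * Real.pi * d * x.2) :=
    (sa1.add s0).neg.of_le (by exact_mod_cast le_top)
  have h := integral_pd_add_pd_eq_zero (sa2.of_le (by exact_mod_cast le_top)) P.per1_a2 s1
    (fun x => by simp only [P.per2_a1 x]; ring)
  have e : ∀ x, curv P.a1 P.a2 x = (pd1 P.a2 x + pd2 (fun x => -(P.a1 x + 2 * Real.pi * d * x.2)) x)
      + 2 * Real.pi * d := fun x => by
    have h2 : pd2 (fun x => -(P.a1 x + 2 * Real.pi * d * x.2)) x =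
        -(pd2 P.a1 x + 2 * Real.pi * d) := by
      refine pd2_eq_of_hasDerivAt (s1.differentiable one_ne_zero x) ?_
      have := hasDerivAt_pd2 (f := P.a1) (s := x.1) (t := x.2) (sa1.differentiable (by simp) x)
      have h3 := ((hasDerivAt_id x.2).const_mul (2 * Real.pi * d))
      exact (this.add (h3.congr_deriv (mul_one _))).neg
    rw [h2, curv]
    ring
  simp only [e]
  have c1 : Continuous fun x => pd1 P.a2 x + pd2 (fun x => -(P.a1 x + 2 * Real.pi * d * x.2)) x :=
    sa2.pd1.continuous.add s1.continuous_pd2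
  rw [integral_add c1.integrableOn_unitSquare continuous_const.integrableOn_unitSquare, h,
    setIntegral_unitSquare_const, zero_add]

theorem sq_setIntegral_le {f : ℝ × ℝ → ℝ} (hf : Continuous f) :
    (∫ x in unitSquare, f x) ^ 2 ≤ ∫ x in unitSquare, f x ^ 2 := by
  have := sq_setIntegral_mul_le hf (continuous_const (y := (1 : ℝ)))
  simpa [Measure.real, volume_unitSquare] using this

variable {α β : ℝ} {d : ℤ} {F₀ : ℝ × ℝ → ℝ} {P : FieldPair d}

theorem IsGLSolution.integral_eq_zero (hF₀ : ExternalField d F₀) (hP : IsGLSolution α β F₀ P) :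
    (∫ x in unitSquare, ‖D1 P.a1 P.φ x‖ ^ 2) + (∫ x in unitSquare, ‖D2 P.a2 P.φ x‖ ^ 2) +
      β * (∫ x in unitSquare, ‖P.φ x‖ ^ 4) - α * ∫ x in unitSquare, ‖P.φ x‖ ^ 2 = 0 := by
  have ht : ((fun _ => 0, fun _ => 0, P.φ) : (ℝ × ℝ → ℝ) × (ℝ × ℝ → ℝ) × (ℝ × ℝ → ℂ)) ∈
      smoothFields d := ⟨⟨contDiff_const, fun _ => rfl, fun _ => rfl⟩,
    ⟨contDiff_const, fun _ => rfl, fun _ => rfl⟩, P.smooth_φ, P.per1_φ, P.per2_φ⟩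
  have h := weak_form hF₀ hP ht
  have sφ := P.smooth_φ
  have c0 := sφ.continuous
  have c1 := (ContDiff.D1 sφ P.smooth_a1).continuous
  have c2 := (ContDiff.D2 sφ P.smooth_a2).continuous
  rw [← h, ← integral_const_mul, ← integral_const_mul, ← integral_add, ← integral_add,
    ← integral_sub]
  · congr 1
    ext x
    simp only [curv, pd1, pd2, fderiv_fun_const]
    simp only [Complex.ofReal_zero, mul_zero, zero_mul, add_zero, real_inner_self_eq_norm_sq]
    simp
    ring
  all_goals exact Continuous.integrableOn_unitSquare (by fun_prop)

theorem IsGLSolution.bounds (hα : 0 < α) (hβ : 0 < β) (hF₀ : ExternalField d F₀)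
    (hP : IsGLSolution α β F₀ P) :
    (∫ x in unitSquare, ‖P.φ x‖ ^ 2) ≤ α / β ∧ (∫ x in unitSquare, ‖P.φ x‖ ^ 4) ≤ (α / β) ^ 2 ∧
      (∫ x in unitSquare, ‖D1 P.a1 P.φ x‖ ^ 2) + (∫ x in unitSquare, ‖D2 P.a2 P.φ x‖ ^ 2) ≤
        α ^ 2 / β := by
  have h := hP.integral_eq_zero hF₀
  have c0 := P.smooth_φ.continuous
  have hs := sq_setIntegral_le (f := fun x => ‖P.φ x‖ ^ 2) (by fun_prop)
  have e : ∀ x, (‖P.φ x‖ ^ 2) ^ 2 = ‖P.φ x‖ ^ 4 := fun x => by ring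
  simp only [e] at hs
  have n1 : 0 ≤ ∫ x in unitSquare, ‖D1 P.a1 P.φ x‖ ^ 2 := integral_nonneg fun _ => by positivity
  have n2 : 0 ≤ ∫ x in unitSquare, ‖D2 P.a2 P.φ x‖ ^ 2 := integral_nonneg fun _ => by positivity
  have n3 : 0 ≤ ∫ x in unitSquare, ‖P.φ x‖ ^ 2 := integral_nonneg fun _ => by positivity
  have n4 : 0 ≤ ∫ x in unitSquare, ‖P.φ x‖ ^ 4 := integral_nonneg fun _ => by positivity
  set M := ∫ x in unitSquare, ‖P.φ x‖ ^ 2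
  set N := ∫ x in unitSquare, ‖P.φ x‖ ^ 4
  have hM : M ≤ α / β := by
    rw [le_div_iff₀ hβ]
    by_contra! hc
    have : 0 < M := by
      rcases n3.eq_or_lt with h0 | h0
      · rw [← h0] at hc; linarith
      · exact h0
    nlinarith [mul_lt_mul_of_pos_right hc this]
  have hM' : α * M ≤ α ^ 2 / β := by
    calc α * M ≤ α * (α / β) := by gcongr
      _ = α ^ 2 / β := by ring
  refine ⟨hM, ?_, by nlinarith⟩
  have : β * N ≤ α ^ 2 / β := by linarith
  calc N = β * N / β := by field_simp
    _ ≤ (α ^ 2 / β) / β := by gcongr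
    _ = (α / β) ^ 2 := by field_simp

theorem IsGLSolution.integral_curv_sub_sq_le (hα : 0 < α) (hβ : 0 < β) (hF₀ : ExternalField d F₀)
    (hP : IsGLSolution α β F₀ P) :
    (∫ x in unitSquare, (curv P.a1 P.a2 x - F₀ x) ^ 2) ≤ 8 * (α / β) * (α ^ 2 / β) := by
  obtain ⟨b1, -, b3⟩ := hP.bounds hα hβ hF₀
  have sh : ContDiff ℝ ∞ fun x => curv P.a1 P.a2 x - F₀ x :=
    (ContDiff.curv P.smooth_a1 P.smooth_a2).sub hF₀.1
  have sh1 := sh.of_le (m := 1) (by exact_mod_cast le_top)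
  have hc := (ContDiff.curv P.smooth_a1 P.smooth_a2).continuous
  have hc0 := hF₀.1.continuous
  have c0 := P.smooth_φ.continuous
  have c1 := (ContDiff.D1 P.smooth_φ P.smooth_a1).continuous
  have c2 := (ContDiff.D2 P.smooth_φ P.smooth_a2).continuous
  have hmean : ∫ x in unitSquare, (curv P.a1 P.a2 x - F₀ x) = 0 := by
    rw [integral_sub hc.integrableOn_unitSquare hc0.integrableOn_unitSquare, P.integral_curv,
      hF₀.2.2.2, sub_self]
  have hp := integral_norm_sub_mean_le sh1
  have hs := integral_norm_sq_le sh1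
  rw [hmean] at hp
  simp only [sub_zero] at hp
  have g1 : ∫ x in unitSquare, ‖pd1 (fun x => curv P.a1 P.a2 x - F₀ x) x‖ ≤
      ∫ x in unitSquare, ‖P.φ x‖ * ‖D2 P.a2 P.φ x‖ := by
    refine setIntegral_unitSquare_mono sh1.continuous_pd1.norm (by fun_prop) fun x _ => ?_
    have := hP.2.1 x
    have e : pd1 (fun x => curv P.a1 P.a2 x - F₀ x) x =
      ((starRingEnd ℂ) (P.φ x) * D2 P.a2 P.φ x).im := by linarith
    rw [e, Real.norm_eq_abs]
    refine (Complex.abs_im_le_norm _).trans (le_of_eq ?_)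
    rw [norm_mul, RCLike.norm_conj]
  have g2 : ∫ x in unitSquare, ‖pd2 (fun x => curv P.a1 P.a2 x - F₀ x) x‖ ≤
      ∫ x in unitSquare, ‖P.φ x‖ * ‖D1 P.a1 P.φ x‖ := by
    refine setIntegral_unitSquare_mono sh1.continuous_pd2.norm (by fun_prop) fun x _ => ?_
    have := hP.1 x
    have e : pd2 (fun x => curv P.a1 P.a2 x - F₀ x) x =
      -((starRingEnd ℂ) (P.φ x) * D1 P.a1 P.φ x).im := by linarith
    rw [e, norm_neg, Real.norm_eq_abs]
    refine (Complex.abs_im_le_norm _).trans (le_of_eq ?_)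
    rw [norm_mul, RCLike.norm_conj]
  have q1 := sq_setIntegral_mul_le c0.norm c1.norm
  have q2 := sq_setIntegral_mul_le c0.norm c2.norm
  simp only [Real.norm_eq_abs, sq_abs] at hs
  simp only [Real.norm_eq_abs] at hp g1 g2
  set A := ∫ x in unitSquare, |curv P.a1 P.a2 x - F₀ x|
  set S1 := ∫ x in unitSquare, |pd1 (fun x => curv P.a1 P.a2 x - F₀ x) x|
  set S2 := ∫ x in unitSquare, |pd2 (fun x => curv P.a1 P.a2 x - F₀ x) x|
  have m0 : 0 ≤ A := integral_nonneg fun _ => abs_nonneg _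
  have m1 : 0 ≤ S1 := integral_nonneg fun _ => abs_nonneg _
  have m2 : 0 ≤ S2 := integral_nonneg fun _ => abs_nonneg _
  have n1 : 0 ≤ ∫ x in unitSquare, ‖D1 P.a1 P.φ x‖ ^ 2 := integral_nonneg fun _ => by positivity
  have n2 : 0 ≤ ∫ x in unitSquare, ‖D2 P.a2 P.φ x‖ ^ 2 := integral_nonneg fun _ => by positivity
  set X1 := ∫ x in unitSquare, ‖D1 P.a1 P.φ x‖ ^ 2
  set X2 := ∫ x in unitSquare, ‖D2 P.a2 P.φ x‖ ^ 2
  have r1 : S1 ^ 2 ≤ α / β * X2 := (pow_le_pow_left₀ m1 g1 2).trans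
    (q2.trans (mul_le_mul_of_nonneg_right b1 n2))
  have r2 : S2 ^ 2 ≤ α / β * X1 := (pow_le_pow_left₀ m2 g2 2).trans
    (q1.trans (mul_le_mul_of_nonneg_right b1 n1))
  have r3 : (A + S1) * (A + S2) ≤ 8 * (S1 ^ 2 + S2 ^ 2) := by
    have : (A + S1) * (A + S2) ≤ (2 * (S1 + S2)) * (2 * (S1 + S2)) := by
      apply mul_le_mul <;> linarith
    nlinarith [sq_nonneg (S1 - S2)]
  have hpos : 0 < α / β := div_pos hα hβ
  calc _ ≤ (A + S1) * (A + S2) := hs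
    _ ≤ 8 * (S1 ^ 2 + S2 ^ 2) := r3
    _ ≤ 8 * (α / β * (X1 + X2)) := by linarith
    _ ≤ 8 * (α / β * (α ^ 2 / β)) := by gcongr
    _ = _ := by ring

end Apriori
end

section

open scoped ContDiff Topology
open Filter Set

section Torus

/-- The projection of the plane onto the two-dimensional torus. -/
def torusProj (x : ℝ × ℝ) : UnitAddTorus (Fin 2) := ![(x.1 : UnitAddCircle), (x.2 : UnitAddCircle)]

theorem isOpenQuotientMap_torusProj : IsOpenQuotientMap torusProj := by
  have h1 : IsOpenQuotientMap (Pi.map (fun (_ : Fin 2) (s : ℝ) => (s : UnitAddCircle))) :=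
    IsOpenQuotientMap.piMap fun _ => QuotientAddGroup.isOpenQuotientMap_mk
  have h2 : IsOpenQuotientMap (Homeomorph.finTwoArrow (X := ℝ)).symm :=
    (Homeomorph.finTwoArrow (X := ℝ)).symm.isOpenQuotientMap
  have h3 := h1.comp h2
  convert h3 using 1
  funext x
  ext i
  fin_cases i <;> rfl

theorem Periodic1.int_add {F : Type*} {f : ℝ × ℝ → F} (h : Periodic1 f) (n : ℤ) (s t : ℝ) :
    f (s + n, t) = f (s, t) := by
  have h1 : Function.Periodic (fun s => f (s, t)) 1 := fun s => h (s, t)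
  simpa using h1.int_mul n s

theorem Periodic2.int_add {F : Type*} {f : ℝ × ℝ → F} (h : Periodic2 f) (n : ℤ) (s t : ℝ) :
    f (s, t + n) = f (s, t) := by
  have h1 : Function.Periodic (fun t => f (s, t)) 1 := fun t => h (s, t)
  simpa using h1.int_mul n t

theorem exists_int_add_of_coe_eq {s t : ℝ} (h : (s : UnitAddCircle) = (t : UnitAddCircle)) :
    ∃ n : ℤ, t = s + n := by
  have h1 : ((t - s : ℝ) : UnitAddCircle) = 0 := by
    rw [AddCircle.coe_sub, h, sub_self]
  obtain ⟨n, hn⟩ := (AddCircle.coe_eq_zero_iff (1 : ℝ)).1 h1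
  refine ⟨n, ?_⟩
  simp at hn
  linarith

/-- A continuous doubly periodic function descends to the torus. -/
theorem exists_torus_lift {g : ℝ × ℝ → ℂ} (hg : Continuous g) (h1 : Periodic1 g)
    (h2 : Periodic2 g) : ∃ G : C(UnitAddTorus (Fin 2), ℂ), ∀ x, G (torusProj x) = g x := by
  have hf : Function.FactorsThrough g torusProj := by
    rintro ⟨s, t⟩ ⟨s', t'⟩ h
    have ha := congrFun h 0
    have hb := congrFun h 1
    simp only [torusProj, Matrix.cons_val_zero, Matrix.cons_val_one] at ha hb
    obtain ⟨m, rfl⟩ := exists_int_add_of_coe_eq ha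
    obtain ⟨n, rfl⟩ := exists_int_add_of_coe_eq hb
    rw [h1.int_add, h2.int_add]
  have hq : Topology.IsQuotientMap
      (⟨torusProj, isOpenQuotientMap_torusProj.continuous⟩ : C(ℝ × ℝ, UnitAddTorus (Fin 2))) :=
    isOpenQuotientMap_torusProj.isQuotientMap
  exact ⟨hq.lift ⟨g, hg⟩ hf, fun x => DFunLike.congr_fun (hq.lift_comp ⟨g, hg⟩ hf) x⟩

end Torus

section Laplace

/-- The plane wave with integer frequencies `m`, `n`. -/
def planeWave (m n : ℤ) (x : ℝ × ℝ) : ℂ :=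
  Complex.exp (2 * Real.pi * I * m * x.1 + 2 * Real.pi * I * n * x.2)

theorem contDiff_planeWave (m n : ℤ) : ContDiff ℝ ∞ (planeWave m n) := by
  unfold planeWave
  have h1 : ContDiff ℝ ∞ fun x : ℝ × ℝ => (x.1 : ℂ) := Complex.ofRealCLM.contDiff.comp contDiff_fst
  have h2 : ContDiff ℝ ∞ fun x : ℝ × ℝ => (x.2 : ℂ) := Complex.ofRealCLM.contDiff.comp contDiff_snd
  exact ((contDiff_const.mul h1).add (contDiff_const.mul h2)).cexp

theorem pd1_planeWave (m n : ℤ) (x : ℝ × ℝ) :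
    pd1 (planeWave m n) x = 2 * Real.pi * I * m * planeWave m n x := by
  refine pd1_eq_of_hasDerivAt ((contDiff_planeWave m n).differentiable (by simp) x) ?_
  have h := ((((hasDerivAt_id x.1).ofReal_comp).const_mul (2 * Real.pi * I * m)).add_const
    (2 * Real.pi * I * n * x.2)).cexp
  refine h.congr_deriv ?_
  simp only [id, Complex.ofReal_one, planeWave]
  ring

theorem pd2_planeWave (m n : ℤ) (x : ℝ × ℝ) :
    pd2 (planeWave m n) x = 2 * Real.pi * I * n * planeWave m n x := by
  refine pd2_eq_of_hasDerivAt ((contDiff_planeWave m n).differentiable (by simp) x) ?_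
  have h := ((((hasDerivAt_id x.2).ofReal_comp).const_mul (2 * Real.pi * I * n)).const_add
    (2 * Real.pi * I * m * x.1)).cexp
  refine h.congr_deriv ?_
  simp only [id, Complex.ofReal_one, planeWave]
  ring

theorem periodic1_planeWave (m n : ℤ) : Periodic1 (planeWave m n) := fun x => by
  unfold planeWave
  have : 2 * Real.pi * I * m * ((x.1 + 1 : ℝ) : ℂ) + 2 * Real.pi * I * n * x.2
      = 2 * Real.pi * I * m * x.1 + 2 * Real.pi * I * n * x.2 + m * (2 * Real.pi * I) := by
    push_cast; ring
  rw [this, Complex.exp_add, Complex.exp_int_mul_two_pi_mul_I, mul_one]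

theorem periodic2_planeWave (m n : ℤ) : Periodic2 (planeWave m n) := fun x => by
  unfold planeWave
  have : 2 * Real.pi * I * m * x.1 + 2 * Real.pi * I * n * ((x.2 + 1 : ℝ) : ℂ)
      = 2 * Real.pi * I * m * x.1 + 2 * Real.pi * I * n * x.2 + n * (2 * Real.pi * I) := by
    push_cast; ring
  rw [this, Complex.exp_add, Complex.exp_int_mul_two_pi_mul_I, mul_one]

theorem mFourier_torusProj (n : Fin 2 → ℤ) (x : ℝ × ℝ) :
    UnitAddTorus.mFourier n (torusProj x) = planeWave (n 0) (n 1) x := by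
  simp only [UnitAddTorus.mFourier, ContinuousMap.coe_mk, Fin.prod_univ_two, torusProj,
    Matrix.cons_val_zero, Matrix.cons_val_one, planeWave, Complex.exp_add]
  rw [fourier_coe_apply, fourier_coe_apply]
  simp

/-- The Laplace operator on smooth functions of two variables. -/
def laplace2 {E : Type*} [NormedAddCommGroup E] [NormedSpace ℝ E] (f : ℝ × ℝ → E) (x : ℝ × ℝ) :
    E := pd1 (pd1 f) x + pd2 (pd2 f) x

theorem pd1_clm_comp {E F : Type*} [NormedAddCommGroup E] [NormedSpace ℝ E]
    [NormedAddCommGroup F] [NormedSpace ℝ F] (L : E →L[ℝ] F) {f : ℝ × ℝ → E}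
    (hf : ContDiff ℝ ∞ f) : pd1 (fun x => L (f x)) = fun x => L (pd1 f x) := by
  funext x
  have h := (L.hasFDerivAt.comp x (hf.differentiable (by simp) x).hasFDerivAt).fderiv
  unfold pd1
  rw [show (fun x => L (f x)) = L ∘ f from rfl, h]
  rfl

theorem pd2_clm_comp {E F : Type*} [NormedAddCommGroup E] [NormedSpace ℝ E]
    [NormedAddCommGroup F] [NormedSpace ℝ F] (L : E →L[ℝ] F) {f : ℝ × ℝ → E}
    (hf : ContDiff ℝ ∞ f) : pd2 (fun x => L (f x)) = fun x => L (pd2 f x) := by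
  funext x
  have h := (L.hasFDerivAt.comp x (hf.differentiable (by simp) x).hasFDerivAt).fderiv
  unfold pd2
  rw [show (fun x => L (f x)) = L ∘ f from rfl, h]
  rfl

theorem laplace2_clm_comp {E F : Type*} [NormedAddCommGroup E] [NormedSpace ℝ E]
    [NormedAddCommGroup F] [NormedSpace ℝ F] (L : E →L[ℝ] F) {f : ℝ × ℝ → E}
    (hf : ContDiff ℝ ∞ f) (x : ℝ × ℝ) : laplace2 (fun x => L (f x)) x = L (laplace2 f x) := by
  unfold laplace2
  rw [pd1_clm_comp L hf, pd1_clm_comp L hf.pd1, pd2_clm_comp L hf, pd2_clm_comp L hf.pd2, map_add]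

theorem laplace2_add {E : Type*} [NormedAddCommGroup E] [NormedSpace ℝ E] {f g : ℝ × ℝ → E}
    (hf : ContDiff ℝ ∞ f) (hg : ContDiff ℝ ∞ g) (x : ℝ × ℝ) :
    laplace2 (fun y => f y + g y) x = laplace2 f x + laplace2 g x := by
  have d : ∀ {k : ℝ × ℝ → E}, ContDiff ℝ ∞ k → Differentiable ℝ k :=
    fun h => h.differentiable (by simp)
  have h1 : pd1 (fun y => f y + g y) = fun y => pd1 f y + pd1 g y :=
    funext fun y => pd1_add (d hf y) (d hg y)
  have h2 : pd2 (fun y => f y + g y) = fun y => pd2 f y + pd2 g y :=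
    funext fun y => pd2_add (d hf y) (d hg y)
  unfold laplace2
  rw [h1, h2, pd1_add (d hf.pd1 x) (d hg.pd1 x), pd2_add (d hf.pd2 x) (d hg.pd2 x)]
  abel

theorem laplace2_planeWave (m n : ℤ) (x : ℝ × ℝ) :
    laplace2 (planeWave m n) x
      = -(4 * Real.pi ^ 2 * ((m : ℂ) ^ 2 + (n : ℂ) ^ 2)) * planeWave m n x := by
  have h1 : pd1 (planeWave m n)
      = fun x => (2 * Real.pi * I * m) * planeWave m n x := funext fun y => pd1_planeWave m n y
  have h2 : pd2 (planeWave m n)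
      = fun x => (2 * Real.pi * I * n) * planeWave m n x := funext fun y => pd2_planeWave m n y
  have e1 := congrFun (pd1_clm_comp (ContinuousLinearMap.mul ℝ ℂ (2 * Real.pi * I * m))
    (contDiff_planeWave m n)) x
  have e2 := congrFun (pd2_clm_comp (ContinuousLinearMap.mul ℝ ℂ (2 * Real.pi * I * n))
    (contDiff_planeWave m n)) x
  simp only [ContinuousLinearMap.mul_apply'] at e1 e2
  unfold laplace2
  rw [h1, h2, e1, e2, pd1_planeWave, pd2_planeWave]
  linear_combination (4 * Real.pi ^ 2 * ((m : ℂ) ^ 2 + (n : ℂ) ^ 2)) * planeWave m n x * I_sq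

theorem exists_laplace2_eq_of_mem_span {G : C(UnitAddTorus (Fin 2), ℂ)}
    (hG : G ∈ Submodule.span ℂ (range (UnitAddTorus.mFourier (d := Fin 2)))) :
    ∃ χ : ℝ × ℝ → ℂ, ContDiff ℝ ∞ χ ∧ Periodic1 χ ∧ Periodic2 χ ∧
      ∃ c : ℂ, ∀ x, laplace2 χ x = G (torusProj x) - c := by
  have hzero : ∀ x, laplace2 (fun _ : ℝ × ℝ => (0 : ℂ)) x = 0 := fun x => by
    simpa using laplace2_clm_comp (0 : ℂ →L[ℝ] ℂ)
      (contDiff_const : ContDiff ℝ ∞ fun _ : ℝ × ℝ => (0 : ℂ)) x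
  induction hG using Submodule.span_induction with
  | mem G hG =>
    obtain ⟨n, rfl⟩ := hG
    by_cases hn : ((n 0 : ℂ) ^ 2 + (n 1 : ℂ) ^ 2) = 0
    · have h0 : n 0 ^ 2 + n 1 ^ 2 = 0 := by exact_mod_cast hn
      have ha : n 0 = 0 := by nlinarith [sq_nonneg (n 0), sq_nonneg (n 1)]
      have hb : n 1 = 0 := by nlinarith [sq_nonneg (n 0), sq_nonneg (n 1)]
      refine ⟨fun _ => 0, contDiff_const, fun _ => rfl, fun _ => rfl, 1, fun x => ?_⟩
      rw [hzero, mFourier_torusProj, ha, hb]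
      simp [planeWave]
    · set k : ℂ := -(4 * Real.pi ^ 2 * ((n 0 : ℂ) ^ 2 + (n 1 : ℂ) ^ 2)) with hk
      have hk0 : k ≠ 0 := by
        rw [hk]
        simp [hn]
      refine ⟨fun x => k⁻¹ * planeWave (n 0) (n 1) x, contDiff_const.mul (contDiff_planeWave _ _),
        fun x => by simp only [periodic1_planeWave _ _ x],
        fun x => by simp only [periodic2_planeWave _ _ x], 0, fun x => ?_⟩
      have e := laplace2_clm_comp (ContinuousLinearMap.mul ℝ ℂ k⁻¹)
        (contDiff_planeWave (n 0) (n 1)) x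
      simp only [ContinuousLinearMap.mul_apply'] at e
      rw [e, laplace2_planeWave, mFourier_torusProj, ← hk]
      field_simp
      ring
  | zero => exact ⟨fun _ => 0, contDiff_const, fun _ => rfl, fun _ => rfl, 0, fun x => by simp [hzero]⟩
  | add G G' _ _ h h' =>
    obtain ⟨χ, a1, a2, a3, c, hc⟩ := h
    obtain ⟨χ', b1, b2, b3, c', hc'⟩ := h'
    refine ⟨fun x => χ x + χ' x, a1.add b1, fun x => by simp only [a2 x, b2 x],
      fun x => by simp only [a3 x, b3 x], c + c', fun x => ?_⟩
    rw [laplace2_add a1 b1, hc, hc', ContinuousMap.add_apply]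
    ring
  | smul k G _ h =>
    obtain ⟨χ, a1, a2, a3, c, hc⟩ := h
    refine ⟨fun x => k * χ x, contDiff_const.mul a1, fun x => by simp only [a2 x],
      fun x => by simp only [a3 x], k * c, fun x => ?_⟩
    have e := laplace2_clm_comp (ContinuousLinearMap.mul ℝ ℂ k) a1 x
    simp only [ContinuousLinearMap.mul_apply'] at e
    rw [e, hc, ContinuousMap.smul_apply, smul_eq_mul]
    ring

theorem integral_laplace2_eq_zero {χ : ℝ × ℝ → ℝ} (h : ContDiff ℝ ∞ χ) (h1 : Periodic1 χ)
    (h2 : Periodic2 χ) : ∫ x in unitSquare, laplace2 χ x = 0 :=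
  integral_pd_add_pd_eq_zero (h.pd1.of_le (by exact_mod_cast le_top)) h1.pd1
    (h.pd2.of_le (by exact_mod_cast le_top)) h2.pd2

/-- Approximate solvability of the Poisson equation on the torus. -/
theorem exists_laplace2_near {g : ℝ × ℝ → ℝ} (hg : Continuous g) (h1 : Periodic1 g)
    (h2 : Periodic2 g) (h0 : ∫ x in unitSquare, g x = 0) {ε : ℝ} (hε : 0 < ε) :
    ∃ χ : ℝ × ℝ → ℝ, ContDiff ℝ ∞ χ ∧ Periodic1 χ ∧ Periodic2 χ ∧
      ∀ x, |laplace2 χ x - g x| ≤ ε := by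
  obtain ⟨G, hG⟩ := exists_torus_lift (g := fun x => (g x : ℂ)) (by fun_prop)
    (fun x => by simp only [h1 x]) (fun x => by simp only [h2 x])
  have hmem : G ∈ (Submodule.span ℂ (range (UnitAddTorus.mFourier (d := Fin 2)))).topologicalClosure
      := by rw [UnitAddTorus.span_mFourier_closure_eq_top]; trivial
  obtain ⟨G', hG', hd⟩ := Metric.mem_closure_iff.1 hmem (ε / 2) (half_pos hε)
  obtain ⟨χ, a1, a2, a3, c, hc⟩ := exists_laplace2_eq_of_mem_span hG'
  have hclose : ∀ x, |(G' (torusProj x)).re - g x| ≤ ε / 2 := fun x => by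
    have h3 := ContinuousMap.dist_apply_le_dist (f := G') (g := G) (torusProj x)
    rw [hG x, dist_comm G' G, Complex.dist_eq] at h3
    have h4 := Complex.abs_re_le_norm (G' (torusProj x) - (g x : ℂ))
    simp only [Complex.sub_re, Complex.ofReal_re] at h4
    linarith
  have hre : ∀ x, laplace2 (fun x => (χ x).re) x = (G' (torusProj x)).re - c.re := fun x => by
    have e := laplace2_clm_comp Complex.reCLM a1 x
    simp only [Complex.reCLM_apply] at e
    rw [e, hc, Complex.sub_re]
  have hsm : ContDiff ℝ ∞ fun x => (χ x).re := Complex.reCLM.contDiff.comp a1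
  have p1 : Periodic1 fun x => (χ x).re := fun x => by simp only [a2 x]
  have p2 : Periodic2 fun x => (χ x).re := fun x => by simp only [a3 x]
  refine ⟨_, hsm, p1, p2, fun x => ?_⟩
  have hcont : Continuous fun x => (G' (torusProj x)).re :=
    Complex.continuous_re.comp (G'.continuous.comp isOpenQuotientMap_torusProj.continuous)
  have hcr : |c.re| ≤ ε / 2 := by
    have hI := integral_laplace2_eq_zero hsm p1 p2
    have hsplit : ∀ x, laplace2 (fun x => (χ x).re) x
        = ((G' (torusProj x)).re - g x) + (g x - c.re) := fun x => by rw [hre]; ring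
    simp_rw [hsplit] at hI
    have q1 : Continuous fun x => (G' (torusProj x)).re - g x := hcont.sub hg
    have q2 : Continuous fun x => g x - c.re := hg.sub continuous_const
    rw [integral_add q1.integrableOn_unitSquare q2.integrableOn_unitSquare,
      integral_sub hg.integrableOn_unitSquare continuous_const.integrableOn_unitSquare, h0,
      setIntegral_unitSquare_const] at hI
    have hn : ‖∫ x in unitSquare, ((G' (torusProj x)).re - g x)‖ ≤ ε / 2 * volume.real unitSquare :=
      norm_setIntegral_le_of_norm_le_const (by rw [volume_unitSquare]; simp) fun x _ => hclose x
    rw [measureReal_def, volume_unitSquare] at hn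
    simp at hn hI
    have : c.re = ∫ x in unitSquare, ((G' (torusProj x)).re - g x) := by linarith
    rw [this]; exact hn
  rw [hre, show (G' (torusProj x)).re - c.re - g x = ((G' (torusProj x)).re - g x) - c.re by ring]
  calc _ ≤ |(G' (torusProj x)).re - g x| + |c.re| := abs_sub _ _
    _ ≤ ε := by linarith [hclose x]

end Laplace

end

section

open scoped ContDiff Topology
open Filter Set

section Gauge

/-- The gauge transformation `exp (i (χ + 2π (k x₁ + l x₂)))`. -/
def gaugeFactor (χ : ℝ × ℝ → ℝ) (k l : ℤ) (x : ℝ × ℝ) : ℂ :=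
  Complex.exp (((χ x + 2 * Real.pi * (k * x.1 + l * x.2) : ℝ) : ℂ) * I)

variable {χ : ℝ × ℝ → ℝ} (k l : ℤ)

theorem norm_gaugeFactor (x : ℝ × ℝ) : ‖gaugeFactor χ k l x‖ = 1 := Complex.norm_exp_ofReal_mul_I _

theorem contDiff_gaugeFactor (hχ : ContDiff ℝ ∞ χ) : ContDiff ℝ ∞ (gaugeFactor χ k l) := by
  unfold gaugeFactor
  have h : ContDiff ℝ ∞ fun x : ℝ × ℝ => χ x + 2 * Real.pi * (k * x.1 + l * x.2) := by fun_prop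
  exact ((Complex.ofRealCLM.contDiff.comp h).mul contDiff_const).cexp

theorem pd1_gaugeFactor (hχ : ContDiff ℝ ∞ χ) (x : ℝ × ℝ) :
    pd1 (gaugeFactor χ k l) x
      = I * ((pd1 χ x + 2 * Real.pi * k : ℝ) : ℂ) * gaugeFactor χ k l x := by
  refine pd1_eq_of_hasDerivAt ((contDiff_gaugeFactor k l hχ).differentiable (by simp) x) ?_
  have h1 := hasDerivAt_pd1 (f := χ) (s := x.1) (t := x.2) (hχ.differentiable (by simp) x)
  have h2 := (((hasDerivAt_id x.1).const_mul (k : ℝ)).add_const (l * x.2)).const_mul (2 * Real.pi)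
  have h3 := ((h1.add h2).ofReal_comp.mul_const I).cexp
  refine h3.congr_deriv ?_
  simp only [gaugeFactor, id, Pi.add_apply]
  push_cast
  ring

theorem pd2_gaugeFactor (hχ : ContDiff ℝ ∞ χ) (x : ℝ × ℝ) :
    pd2 (gaugeFactor χ k l) x
      = I * ((pd2 χ x + 2 * Real.pi * l : ℝ) : ℂ) * gaugeFactor χ k l x := by
  refine pd2_eq_of_hasDerivAt ((contDiff_gaugeFactor k l hχ).differentiable (by simp) x) ?_
  have h1 := hasDerivAt_pd2 (f := χ) (s := x.1) (t := x.2) (hχ.differentiable (by simp) x)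
  have h2 := (((hasDerivAt_id x.2).const_mul (l : ℝ)).const_add (k * x.1)).const_mul (2 * Real.pi)
  have h3 := ((h1.add h2).ofReal_comp.mul_const I).cexp
  refine h3.congr_deriv ?_
  simp only [gaugeFactor, id, Pi.add_apply]
  push_cast
  ring

theorem D1_gaugeFactor_mul (hχ : ContDiff ℝ ∞ χ) (a : ℝ × ℝ → ℝ) {ψ : ℝ × ℝ → ℂ}
    (hψ : ContDiff ℝ ∞ ψ) :
    D1 (fun x => a x - pd1 χ x - 2 * Real.pi * k) (fun x => gaugeFactor χ k l x * ψ x)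
      = fun x => gaugeFactor χ k l x * D1 a ψ x := by
  funext x
  have h : pd1 (fun x => gaugeFactor χ k l x * ψ x) x
      = gaugeFactor χ k l x * pd1 ψ x + pd1 (gaugeFactor χ k l) x * ψ x := by
    simp only [pd1]
    rw [fderiv_fun_mul ((contDiff_gaugeFactor k l hχ).differentiable (by simp) x)
      (hψ.differentiable (by simp) x)]
    simp [mul_comm]
  rw [D1, D1, h, pd1_gaugeFactor k l hχ]
  push_cast
  ring

theorem D2_gaugeFactor_mul (hχ : ContDiff ℝ ∞ χ) (a : ℝ × ℝ → ℝ) {ψ : ℝ × ℝ → ℂ}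
    (hψ : ContDiff ℝ ∞ ψ) :
    D2 (fun x => a x - pd2 χ x - 2 * Real.pi * l) (fun x => gaugeFactor χ k l x * ψ x)
      = fun x => gaugeFactor χ k l x * D2 a ψ x := by
  funext x
  have h : pd2 (fun x => gaugeFactor χ k l x * ψ x) x
      = gaugeFactor χ k l x * pd2 ψ x + pd2 (gaugeFactor χ k l) x * ψ x := by
    simp only [pd2]
    rw [fderiv_fun_mul ((contDiff_gaugeFactor k l hχ).differentiable (by simp) x)
      (hψ.differentiable (by simp) x)]
    simp [mul_comm]
  rw [D2, D2, h, pd2_gaugeFactor k l hχ]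
  push_cast
  ring

theorem periodic1_gaugeFactor (h : Periodic1 χ) : Periodic1 (gaugeFactor χ k l) := fun x => by
  unfold gaugeFactor
  have : ((χ (x.1 + 1, x.2) + 2 * Real.pi * (k * (x.1 + 1) + l * x.2) : ℝ) : ℂ) * I
      = ((χ x + 2 * Real.pi * (k * x.1 + l * x.2) : ℝ) : ℂ) * I + k * (2 * Real.pi * I) := by
    rw [h x]
    push_cast
    ring
  rw [this, Complex.exp_add, Complex.exp_int_mul_two_pi_mul_I, mul_one]

theorem periodic2_gaugeFactor (h : Periodic2 χ) : Periodic2 (gaugeFactor χ k l) := fun x => by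
  unfold gaugeFactor
  have : ((χ (x.1, x.2 + 1) + 2 * Real.pi * (k * x.1 + l * (x.2 + 1)) : ℝ) : ℂ) * I
      = ((χ x + 2 * Real.pi * (k * x.1 + l * x.2) : ℝ) : ℂ) * I + l * (2 * Real.pi * I) := by
    rw [h x]
    push_cast
    ring
  rw [this, Complex.exp_add, Complex.exp_int_mul_two_pi_mul_I, mul_one]

variable {d : ℤ}

/-- The gauge transform of a field pair. -/
def FieldPair.gauge (P : FieldPair d) (hχ : ContDiff ℝ ∞ χ) (h1 : Periodic1 χ) (h2 : Periodic2 χ)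
    (k l : ℤ) : FieldPair d where
  a1 := fun x => P.a1 x - pd1 χ x - 2 * Real.pi * k
  a2 := fun x => P.a2 x - pd2 χ x - 2 * Real.pi * l
  φ := fun x => gaugeFactor χ k l x * P.φ x
  smooth_a1 := (P.smooth_a1.sub hχ.pd1).sub contDiff_const
  smooth_a2 := (P.smooth_a2.sub hχ.pd2).sub contDiff_const
  smooth_φ := (contDiff_gaugeFactor k l hχ).mul P.smooth_φ
  per1_a1 := fun x => by rw [P.per1_a1, h1.pd1]
  per1_a2 := fun x => by rw [P.per1_a2, h1.pd2]
  per1_φ := fun x => by rw [P.per1_φ, periodic1_gaugeFactor k l h1]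
  per2_a2 := fun x => by rw [P.per2_a2, h2.pd2]
  per2_a1 := fun x => by rw [P.per2_a1, h2.pd1]; ring
  per2_φ := fun x => by rw [P.per2_φ, periodic2_gaugeFactor k l h2]; ring

variable (P : FieldPair d) (hχ : ContDiff ℝ ∞ χ) (h1 : Periodic1 χ) (h2 : Periodic2 χ)

theorem FieldPair.D1_gauge : D1 (P.gauge hχ h1 h2 k l).a1 (P.gauge hχ h1 h2 k l).φ
    = fun x => gaugeFactor χ k l x * D1 P.a1 P.φ x :=
  D1_gaugeFactor_mul k l hχ P.a1 P.smooth_φ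

theorem FieldPair.D2_gauge : D2 (P.gauge hχ h1 h2 k l).a2 (P.gauge hχ h1 h2 k l).φ
    = fun x => gaugeFactor χ k l x * D2 P.a2 P.φ x :=
  D2_gaugeFactor_mul k l hχ P.a2 P.smooth_φ

theorem pd1_sub_sub_const {a b : ℝ × ℝ → ℝ} (ha : ContDiff ℝ ∞ a) (hb : ContDiff ℝ ∞ b) (c : ℝ)
    (x : ℝ × ℝ) : pd1 (fun x => a x - b x - c) x = pd1 a x - pd1 b x := by
  simp only [pd1]
  rw [fderiv_sub_const, fderiv_fun_sub (ha.differentiable (by simp) x)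
    (hb.differentiable (by simp) x)]
  rfl

theorem pd2_sub_sub_const {a b : ℝ × ℝ → ℝ} (ha : ContDiff ℝ ∞ a) (hb : ContDiff ℝ ∞ b) (c : ℝ)
    (x : ℝ × ℝ) : pd2 (fun x => a x - b x - c) x = pd2 a x - pd2 b x := by
  simp only [pd2]
  rw [fderiv_sub_const, fderiv_fun_sub (ha.differentiable (by simp) x)
    (hb.differentiable (by simp) x)]
  rfl

theorem FieldPair.curv_gauge :
    curv (P.gauge hχ h1 h2 k l).a1 (P.gauge hχ h1 h2 k l).a2 = curv P.a1 P.a2 := by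
  funext x
  simp only [curv, FieldPair.gauge]
  rw [pd1_sub_sub_const P.smooth_a2 hχ.pd2, pd2_sub_sub_const P.smooth_a1 hχ.pd1,
    pd1_pd2_comm hχ x]
  ring

theorem FieldPair.energy_gauge (α β : ℝ) (F₀ : ℝ × ℝ → ℝ) :
    energy α β F₀ (P.gauge hχ h1 h2 k l) = energy α β F₀ P := by
  unfold energy
  rw [P.D1_gauge, P.D2_gauge, P.curv_gauge]
  simp only [FieldPair.gauge, norm_mul, norm_gaugeFactor, one_mul]

theorem IsGLSolution.gauge {α β : ℝ} {F₀ : ℝ × ℝ → ℝ} {P : FieldPair d}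
    (hP : IsGLSolution α β F₀ P) : IsGLSolution α β F₀ (P.gauge hχ h1 h2 k l) := by
  have hu : ∀ x, (starRingEnd ℂ) (gaugeFactor χ k l x) * gaugeFactor χ k l x = 1 := fun x => by
    rw [Complex.conj_mul', norm_gaugeFactor]
    simp
  have hc : ∀ x z, (starRingEnd ℂ) ((P.gauge hχ h1 h2 k l).φ x) * (gaugeFactor χ k l x * z)
      = (starRingEnd ℂ) (P.φ x) * z := fun x z => by
    simp only [FieldPair.gauge, map_mul]
    linear_combination (starRingEnd ℂ) (P.φ x) * z * hu x
  obtain ⟨e1, e2, e3⟩ := hP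
  refine ⟨fun x => ?_, fun x => ?_, fun x => ?_⟩
  · rw [P.D1_gauge, P.curv_gauge, hc]
    exact e1 x
  · rw [P.D2_gauge, P.curv_gauge, hc]
    exact e2 x
  · rw [P.D1_gauge, P.D2_gauge]
    have f1 : D1 (P.gauge hχ h1 h2 k l).a1 (fun x => gaugeFactor χ k l x * D1 P.a1 P.φ x)
        = fun x => gaugeFactor χ k l x * D1 P.a1 (D1 P.a1 P.φ) x :=
      D1_gaugeFactor_mul k l hχ P.a1 (P.smooth_φ.D1 P.smooth_a1)
    have f2 : D2 (P.gauge hχ h1 h2 k l).a2 (fun x => gaugeFactor χ k l x * D2 P.a2 P.φ x)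
        = fun x => gaugeFactor χ k l x * D2 P.a2 (D2 P.a2 P.φ) x :=
      D2_gaugeFactor_mul k l hχ P.a2 (P.smooth_φ.D2 P.smooth_a2)
    rw [f1, f2]
    simp only [FieldPair.gauge, norm_mul, norm_gaugeFactor, one_mul]
    linear_combination gaugeFactor χ k l x * e3 x

/-- The periodic part of the first connection coefficient. -/
def FieldPair.b1 (P : FieldPair d) (x : ℝ × ℝ) : ℝ := P.a1 x + 2 * Real.pi * d * x.2

theorem FieldPair.contDiff_b1 : ContDiff ℝ ∞ P.b1 :=
  P.smooth_a1.add (contDiff_const.mul contDiff_snd)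

theorem FieldPair.periodic1_b1 : Periodic1 P.b1 := fun x => by
  simp only [FieldPair.b1, P.per1_a1]

theorem FieldPair.periodic2_b1 : Periodic2 P.b1 := fun x => by
  simp only [FieldPair.b1, P.per2_a1]
  ring

theorem FieldPair.pd1_b1 (x : ℝ × ℝ) : pd1 P.b1 x = pd1 P.a1 x := by
  refine pd1_eq_of_hasDerivAt (P.contDiff_b1.differentiable (by simp) x) ?_
  exact (hasDerivAt_pd1 (f := P.a1) (s := x.1) (t := x.2)
    (P.smooth_a1.differentiable (by simp) x)).add_const (2 * Real.pi * d * x.2)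

theorem FieldPair.pd2_b1 (x : ℝ × ℝ) : pd2 P.b1 x = pd2 P.a1 x + 2 * Real.pi * d := by
  refine pd2_eq_of_hasDerivAt (P.contDiff_b1.differentiable (by simp) x) ?_
  have h := ((hasDerivAt_id x.2).const_mul (2 * Real.pi * d))
  exact (hasDerivAt_pd2 (f := P.a1) (s := x.1) (t := x.2)
    (P.smooth_a1.differentiable (by simp) x)).add (h.congr_deriv (mul_one _))

theorem abs_sub_two_pi_mul_floor_le (m : ℝ) :
    |m - 2 * Real.pi * ⌊m / (2 * Real.pi)⌋| ≤ 2 * Real.pi := by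
  have hp : 0 < 2 * Real.pi := by positivity
  have h1 := Int.floor_le (m / (2 * Real.pi))
  have h2 := Int.lt_floor_add_one (m / (2 * Real.pi))
  rw [le_div_iff₀ hp] at h1
  rw [div_lt_iff₀ hp] at h2
  rw [abs_le]
  constructor <;> nlinarith

/-- Every solution is gauge equivalent to one in approximate Coulomb gauge with bounded means. -/
theorem IsGLSolution.exists_gauge {α β : ℝ} {F₀ : ℝ × ℝ → ℝ} {P : FieldPair d}
    (hP : IsGLSolution α β F₀ P) {ε : ℝ} (hε : 0 < ε) :
    ∃ Q : FieldPair d, IsGLSolution α β F₀ Q ∧ energy α β F₀ Q = energy α β F₀ P ∧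
      (∀ x, |pd1 Q.b1 x + pd2 Q.a2 x| ≤ ε) ∧ |∫ x in unitSquare, Q.b1 x| ≤ 2 * Real.pi ∧
      |∫ x in unitSquare, Q.a2 x| ≤ 2 * Real.pi := by
  have l1 : ∀ {f : ℝ × ℝ → ℝ}, ContDiff ℝ ∞ f → ContDiff ℝ 1 f :=
    fun h => h.of_le (by exact_mod_cast le_top)
  obtain ⟨χ, hχ, p1, p2, h⟩ := exists_laplace2_near (g := fun x => pd1 P.b1 x + pd2 P.a2 x)
    (P.contDiff_b1.pd1.continuous.add P.smooth_a2.pd2.continuous)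
    (fun x => by
      have q1 := P.periodic1_b1.pd1 x
      have q2 := Periodic1.pd2 P.per1_a2 x
      simp only [q1, q2])
    (fun x => by
      have q1 := P.periodic2_b1.pd1 x
      have q2 := Periodic2.pd2 P.per2_a2 x
      simp only [q1, q2])
    (integral_pd_add_pd_eq_zero (l1 P.contDiff_b1) P.periodic1_b1 (l1 P.smooth_a2) P.per2_a2) hε
  refine ⟨P.gauge hχ p1 p2 ⌊(∫ x in unitSquare, P.b1 x) / (2 * Real.pi)⌋
    ⌊(∫ x in unitSquare, P.a2 x) / (2 * Real.pi)⌋, hP.gauge _ _ hχ p1 p2,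
    P.energy_gauge _ _ hχ p1 p2 α β F₀, fun x => ?_, ?_, ?_⟩
  · rw [FieldPair.pd1_b1]
    simp only [FieldPair.gauge]
    rw [pd1_sub_sub_const P.smooth_a1 hχ.pd1, pd2_sub_sub_const P.smooth_a2 hχ.pd2]
    have := h x
    rw [P.pd1_b1, laplace2, abs_sub_comm] at this
    convert this using 2
    ring
  · convert abs_sub_two_pi_mul_floor_le (∫ x in unitSquare, P.b1 x) using 2
    have e : ∀ x, (P.gauge hχ p1 p2 ⌊(∫ x in unitSquare, P.b1 x) / (2 * Real.pi)⌋
        ⌊(∫ x in unitSquare, P.a2 x) / (2 * Real.pi)⌋).b1 x = P.b1 x - pd1 χ x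
          - 2 * Real.pi * ⌊(∫ x in unitSquare, P.b1 x) / (2 * Real.pi)⌋ := fun x => by
      simp only [FieldPair.gauge, FieldPair.b1]
      ring
    simp_rw [e]
    have c1 := P.contDiff_b1.continuous
    have c2 := hχ.pd1.continuous
    have c3 : Continuous fun x => P.b1 x - pd1 χ x := c1.sub c2
    rw [integral_sub c3.integrableOn_unitSquare continuous_const.integrableOn_unitSquare,
      integral_sub c1.integrableOn_unitSquare c2.integrableOn_unitSquare,
      integral_pd1_eq_zero (l1 hχ) p1, setIntegral_unitSquare_const, sub_zero]
  · convert abs_sub_two_pi_mul_floor_le (∫ x in unitSquare, P.a2 x) using 2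
    simp only [FieldPair.gauge]
    have c1 := P.smooth_a2.continuous
    have c2 := hχ.pd2.continuous
    have c3 : Continuous fun x => P.a2 x - pd2 χ x := c1.sub c2
    rw [integral_sub c3.integrableOn_unitSquare continuous_const.integrableOn_unitSquare,
      integral_sub c1.integrableOn_unitSquare c2.integrableOn_unitSquare,
      integral_pd2_eq_zero (l1 hχ) p2, setIntegral_unitSquare_const, sub_zero]

end Gauge

end

section

open scoped ContDiff Topology
open Filter Set

section SquareLp

open scoped ENNReal

/-- Lebesgue measure on the fundamental domain. -/
def squareMeasure : Measure (ℝ × ℝ) := volume.restrict unitSquare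

instance : IsProbabilityMeasure squareMeasure :=
  ⟨by rw [squareMeasure, Measure.restrict_apply_univ, volume_unitSquare]⟩

instance : ENNReal.HolderTriple 4 4 2 := ⟨by
  rw [← ENNReal.toReal_eq_toReal_iff' (by simp) (by simp), ENNReal.toReal_add (by simp) (by simp)]
  simp only [ENNReal.toReal_inv, ENNReal.toReal_ofNat]
  norm_num⟩

instance : Fact ((1 : ℝ≥0∞) ≤ 4) := ⟨by norm_num⟩

theorem memLp_squareMeasure {E : Type*} [NormedAddCommGroup E] {f : ℝ × ℝ → E} (hf : Continuous f) (p : ℝ≥0∞) :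
    MemLp f p squareMeasure := by
  obtain ⟨C, hC⟩ := isCompact_unitSquare.exists_bound_of_continuousOn hf.continuousOn
  exact MemLp.of_bound hf.aestronglyMeasurable C
    (by
      unfold squareMeasure
      filter_upwards [ae_restrict_mem measurableSet_unitSquare] with x hx using hC x hx)

variable {E F G : Type*} [NormedAddCommGroup E] [NormedSpace ℝ E] [NormedAddCommGroup F]
  [NormedSpace ℝ F] [NormedAddCommGroup G] [NormedSpace ℝ G]

/-- The class of a continuous function in the Lebesgue space of the fundamental domain. -/
def squareLp (E : Type*) [NormedAddCommGroup E] [NormedSpace ℝ E] (p : ℝ≥0∞) :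
    C(ℝ × ℝ, E) →ₗ[ℝ] Lp E p squareMeasure where
  toFun f := (memLp_squareMeasure f.continuous p).toLp f
  map_add' f g := MemLp.toLp_add (memLp_squareMeasure f.continuous p)
    (memLp_squareMeasure g.continuous p)
  map_smul' c f := MemLp.toLp_const_smul c (memLp_squareMeasure f.continuous p)

theorem squareLp_apply (p : ℝ≥0∞) (f : C(ℝ × ℝ, E)) :
    squareLp E p f = (memLp_squareMeasure f.continuous p).toLp f := rfl

theorem coeFn_squareLp (p : ℝ≥0∞) (f : C(ℝ × ℝ, E)) : squareLp E p f =ᵐ[squareMeasure] f :=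
  (memLp_squareMeasure f.continuous p).coeFn_toLp

theorem inner_squareLp {E : Type*} [NormedAddCommGroup E] [InnerProductSpace ℝ E]
    (f g : C(ℝ × ℝ, E)) :
    inner ℝ (squareLp E 2 f) (squareLp E 2 g) = ∫ x in unitSquare, inner ℝ (f x) (g x) := by
  rw [L2.inner_def]
  refine integral_congr_ae ?_
  filter_upwards [coeFn_squareLp 2 f, coeFn_squareLp 2 g] with x h1 h2
  rw [h1, h2]

theorem norm_squareLp_two_sq {E : Type*} [NormedAddCommGroup E] [InnerProductSpace ℝ E]
    (f : C(ℝ × ℝ, E)) : ‖squareLp E 2 f‖ ^ 2 = ∫ x in unitSquare, ‖f x‖ ^ 2 := by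
  rw [← real_inner_self_eq_norm_sq, inner_squareLp]
  simp only [real_inner_self_eq_norm_sq]

theorem norm_squareLp_four_pow (f : C(ℝ × ℝ, E)) :
    ‖squareLp E 4 f‖ ^ 4 = ∫ x in unitSquare, ‖f x‖ ^ 4 := by
  have h := (memLp_squareMeasure f.continuous 4).eLpNorm_eq_integral_rpow_norm (by simp) (by simp)
  have h2 : ‖squareLp E 4 f‖ = (∫ x in unitSquare, ‖f x‖ ^ 4) ^ ((4 : ℝ)⁻¹) := by
    rw [squareLp_apply, Lp.norm_toLp, h, ENNReal.toReal_ofReal (by positivity)]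
    have : (ENNReal.toReal 4) = (4 : ℕ) := by simp
    simp only [this, Real.rpow_natCast]
    rfl
  rw [h2, ← Real.rpow_natCast, ← Real.rpow_mul (integral_nonneg fun x => by positivity)]
  norm_num

theorem holderL_squareLp (B : E →L[ℝ] F →L[ℝ] G) (f : C(ℝ × ℝ, E)) (g : C(ℝ × ℝ, F))
    (k : C(ℝ × ℝ, G)) (hk : ∀ x, k x = B (f x) (g x)) :
    B.holderL squareMeasure 4 4 2 (squareLp E 4 f) (squareLp F 4 g) = squareLp G 2 k := by
  refine Lp.ext ?_
  refine (B.coeFn_holder _ _).trans ?_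
  filter_upwards [coeFn_squareLp 4 f, coeFn_squareLp 4 g, coeFn_squareLp 2 k] with x h1 h2 h3
  rw [h1, h2, h3, hk]

end SquareLp

end

section

open scoped ContDiff Topology
open Filter Set

section Fields

/-- The fiber of a field configuration: the connection, as a complex number, and the section. -/
abbrev FieldFiber : Type := EuclideanSpace ℂ (Fin 2)

/-- The fiber containing the first-order derivatives entering the energy density. -/
abbrev JetFiber : Type := EuclideanSpace ℂ (Fin 5)

/-- The first coefficient of the reference connection of degree `d`; the second vanishes. -/
def refConn (d : ℤ) (x : ℝ × ℝ) : ℝ := -(2 * Real.pi * d * x.2)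

theorem contDiff_refConn (d : ℤ) : ContDiff ℝ ∞ (refConn d) :=
  (contDiff_const.mul contDiff_snd).neg

variable {d : ℤ}

/-- The value of a field configuration. -/
def fieldVal (s : smoothFields d) (x : ℝ × ℝ) : FieldFiber :=
  !₂[(s.1.1 x : ℂ) + I * s.1.2.1 x, s.1.2.2 x]

/-- The covariant jet of a field configuration, with a mass term of weight `α`. -/
def fieldJet (α : ℝ) (s : smoothFields d) (x : ℝ × ℝ) : JetFiber :=
  !₂[(curv s.1.1 s.1.2.1 x : ℂ) + I * (pd1 s.1.1 x + pd2 s.1.2.1 x : ℝ),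
    D1 (refConn d) s.1.2.2 x, pd2 s.1.2.2 x, 0, (√α : ℂ) * ((s.1.1 x : ℂ) + I * s.1.2.1 x)]

theorem contDiff_fieldVal (s : smoothFields d) : ContDiff ℝ ∞ (fieldVal s) := by
  obtain ⟨s, ⟨h1, -⟩, ⟨h2, -⟩, h3, -⟩ := s
  refine (contDiff_piLp 2).2 fun i => ?_
  fin_cases i
  · exact (Complex.ofRealCLM.contDiff.comp h1).add
      (contDiff_const.mul (Complex.ofRealCLM.contDiff.comp h2))
  · exact h3

theorem continuous_fieldJet (α : ℝ) (s : smoothFields d) : Continuous (fieldJet α s) := by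
  obtain ⟨s, ⟨h1, -⟩, ⟨h2, -⟩, h3, -⟩ := s
  have c1 := h1.continuous
  have c2 := h2.continuous
  have c3 := (h1.curv h2).continuous
  have c4 := h1.pd1.continuous
  have c5 := h2.pd2.continuous
  have c6 := (h3.D1 (contDiff_refConn d)).continuous
  have c7 := h3.pd2.continuous
  refine (PiLp.continuous_toLp 2 _).comp (continuous_pi fun i => ?_)
  fin_cases i
  · exact (Complex.continuous_ofReal.comp c3).add
      (continuous_const.mul (Complex.continuous_ofReal.comp (c4.add c5)))
  · exact c6
  · exact c7
  · exact continuous_const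
  · exact continuous_const.mul ((Complex.continuous_ofReal.comp c1).add
      (continuous_const.mul (Complex.continuous_ofReal.comp c2)))

/-- `fieldVal` as a linear map. -/
def valMap (d : ℤ) : smoothFields d →ₗ[ℝ] C(ℝ × ℝ, FieldFiber) where
  toFun s := ⟨fieldVal s, (contDiff_fieldVal s).continuous⟩
  map_add' s t := by
    ext x i
    fin_cases i
    · simp [fieldVal]; ring
    · simp [fieldVal]
  map_smul' r s := by
    ext x i
    fin_cases i
    · simp [fieldVal]; ring
    · simp [fieldVal]

/-- `fieldJet` as a linear map. -/
def jetMap (d : ℤ) (α : ℝ) : smoothFields d →ₗ[ℝ] C(ℝ × ℝ, JetFiber) where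
  toFun s := ⟨fieldJet α s, continuous_fieldJet α s⟩
  map_add' s t := by
    obtain ⟨s, ⟨h1, -⟩, ⟨h2, -⟩, h3, -⟩ := s
    obtain ⟨t, ⟨k1, -⟩, ⟨k2, -⟩, k3, -⟩ := t
    have dd : ∀ {E : Type} [NormedAddCommGroup E] [NormedSpace ℝ E] {k : ℝ × ℝ → E},
      ContDiff ℝ ∞ k → Differentiable ℝ k := fun h => h.differentiable (by simp)
    ext x i
    have e1 : pd1 (s.1 + t.1) x = pd1 s.1 x + pd1 t.1 x := pd1_add (dd h1 x) (dd k1 x)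
    have e2 : pd2 (s.1 + t.1) x = pd2 s.1 x + pd2 t.1 x := pd2_add (dd h1 x) (dd k1 x)
    have e3 : pd1 (s.2.1 + t.2.1) x = pd1 s.2.1 x + pd1 t.2.1 x := pd1_add (dd h2 x) (dd k2 x)
    have e4 : pd2 (s.2.1 + t.2.1) x = pd2 s.2.1 x + pd2 t.2.1 x := pd2_add (dd h2 x) (dd k2 x)
    have e5 : pd1 (s.2.2 + t.2.2) x = pd1 s.2.2 x + pd1 t.2.2 x := pd1_add (dd h3 x) (dd k3 x)
    have e6 : pd2 (s.2.2 + t.2.2) x = pd2 s.2.2 x + pd2 t.2.2 x := pd2_add (dd h3 x) (dd k3 x)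
    fin_cases i
    · simp [fieldJet, curv, e1, e2, e3, e4]; ring
    · simp [fieldJet, D1, e5]; ring
    · simp [fieldJet, e6]
    · simp [fieldJet]
    · simp [fieldJet]; ring
  map_smul' r s := by
    obtain ⟨s, ⟨h1, -⟩, ⟨h2, -⟩, h3, -⟩ := s
    have dd : ∀ {E : Type} [NormedAddCommGroup E] [NormedSpace ℝ E] {k : ℝ × ℝ → E},
      ContDiff ℝ ∞ k → Differentiable ℝ k := fun h => h.differentiable (by simp)
    ext x i
    have e1 : pd1 (r • s.1) x = r • pd1 s.1 x := pd1_const_smul r (dd h1 x)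
    have e2 : pd2 (r • s.1) x = r • pd2 s.1 x := pd2_const_smul r (dd h1 x)
    have e3 : pd1 (r • s.2.1) x = r • pd1 s.2.1 x := pd1_const_smul r (dd h2 x)
    have e4 : pd2 (r • s.2.1) x = r • pd2 s.2.1 x := pd2_const_smul r (dd h2 x)
    have e5 : pd1 (r • s.2.2) x = r • pd1 s.2.2 x := pd1_const_smul r (dd h3 x)
    have e6 : pd2 (r • s.2.2) x = r • pd2 s.2.2 x := pd2_const_smul r (dd h3 x)
    fin_cases i
    · simp [fieldJet, curv, e1, e2, e3, e4]; ring
    · simp [fieldJet, D1, e5]; ring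
    · simp [fieldJet, e6]
    · simp [fieldJet]
    · simp [fieldJet]; ring

/-- The pointwise bilinear coupling. -/
def fiberCoupling (β : ℝ) : FieldFiber →L[ℝ] FieldFiber →L[ℝ] JetFiber :=
  LinearMap.toContinuousBilinearMap <| LinearMap.mk₂ ℝ
    (fun v w => (!₂[0, I * (v 0).re * w 1, I * (v 0).im * w 1,
      ((√(β / 2) * inner ℝ (v 1) (w 1) : ℝ) : ℂ), 0] : JetFiber))
    (fun u v w => by
      ext i
      fin_cases i
      · simp
      · simp; ring
      · simp; ring
      · simp; ring
      · simp)
    (fun c u v => by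
      ext i
      fin_cases i
      · simp
      · simp; ring
      · simp; ring
      · simp; ring
      · simp)
    (fun u v w => by
      ext i
      fin_cases i
      · simp
      · simp; ring
      · simp; ring
      · simp; ring
      · simp)
    (fun c u v => by
      ext i
      fin_cases i
      · simp
      · simp; ring
      · simp; ring
      · simp; ring
      · simp)

theorem fiberCoupling_apply (β : ℝ) (v w : FieldFiber) : fiberCoupling β v w =
    !₂[0, I * (v 0).re * w 1, I * (v 0).im * w 1,
      ((√(β / 2) * inner ℝ (v 1) (w 1) : ℝ) : ℂ), 0] := rfl

end Fields

end

section

open scoped ContDiff Topology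
open Filter Set

section Estimates

variable {d : ℤ}

theorem norm_sq_add_I_mul (a b : ℝ) : ‖(a : ℂ) + I * b‖ ^ 2 = a ^ 2 + b ^ 2 := by
  rw [Complex.sq_norm, Complex.normSq_apply]
  simp
  ring

theorem norm_sq_fieldFiber (v : FieldFiber) :
    ‖v‖ ^ 2 = (v 0).re ^ 2 + (v 0).im ^ 2 + ‖v 1‖ ^ 2 := by
  rw [EuclideanSpace.norm_sq_eq, Fin.sum_univ_two, Complex.sq_norm (v 0), Complex.normSq_apply]
  ring

theorem norm_fieldVal_sq (s : smoothFields d) (x : ℝ × ℝ) :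
    ‖fieldVal s x‖ ^ 2 = s.1.1 x ^ 2 + s.1.2.1 x ^ 2 + ‖s.1.2.2 x‖ ^ 2 := by
  rw [norm_sq_fieldFiber]
  simp [fieldVal]

theorem norm_fieldJet_sq {α : ℝ} (hα : 0 ≤ α) (s : smoothFields d) (x : ℝ × ℝ) :
    ‖fieldJet α s x‖ ^ 2 = curv s.1.1 s.1.2.1 x ^ 2 + (pd1 s.1.1 x + pd2 s.1.2.1 x) ^ 2
      + ‖D1 (refConn d) s.1.2.2 x‖ ^ 2 + ‖pd2 s.1.2.2 x‖ ^ 2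
      + α * (s.1.1 x ^ 2 + s.1.2.1 x ^ 2) := by
  have h4 : ‖(√α : ℂ) * ((s.1.1 x : ℂ) + I * s.1.2.1 x)‖ ^ 2
      = α * (s.1.1 x ^ 2 + s.1.2.1 x ^ 2) := by
    rw [norm_mul, mul_pow, norm_sq_add_I_mul, Complex.norm_real, Real.norm_eq_abs, sq_abs,
      Real.sq_sqrt hα]
  rw [EuclideanSpace.norm_sq_eq, Fin.sum_univ_five]
  simp only [fieldJet]
  rw [← h4, ← norm_sq_add_I_mul (curv _ _ x)]
  simp

theorem norm_pd1_fieldVal_sq (s : smoothFields d) (x : ℝ × ℝ) : ‖pd1 (fieldVal s) x‖ ^ 2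
    = pd1 s.1.1 x ^ 2 + pd1 s.1.2.1 x ^ 2 + ‖pd1 s.1.2.2 x‖ ^ 2 := by
  have h0 := pd1_clm_comp ((EuclideanSpace.proj (𝕜 := ℂ) (0 : Fin 2)).restrictScalars ℝ)
    (contDiff_fieldVal s)
  have h1 := congrFun (pd1_clm_comp
    ((EuclideanSpace.proj (𝕜 := ℂ) (1 : Fin 2)).restrictScalars ℝ) (contDiff_fieldVal s)) x
  have c0 : ContDiff ℝ ∞ fun y => fieldVal s y 0 := (contDiff_piLp 2).1 (contDiff_fieldVal s) 0
  have hre := congrFun (pd1_clm_comp Complex.reCLM c0) x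
  have him := congrFun (pd1_clm_comp Complex.imCLM c0) x
  have e0 : pd1 (fun y => fieldVal s y 0) x = (pd1 (fieldVal s) x) 0 := congrFun h0 x
  rw [norm_sq_fieldFiber, ← e0]
  simp only [Complex.reCLM_apply, Complex.imCLM_apply] at hre him
  rw [← hre, ← him, show (pd1 (fieldVal s) x) 1 = pd1 s.1.2.2 x from h1.symm]
  simp [fieldVal]

theorem norm_pd2_fieldVal_sq (s : smoothFields d) (x : ℝ × ℝ) : ‖pd2 (fieldVal s) x‖ ^ 2
    = pd2 s.1.1 x ^ 2 + pd2 s.1.2.1 x ^ 2 + ‖pd2 s.1.2.2 x‖ ^ 2 := by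
  have h0 := pd2_clm_comp ((EuclideanSpace.proj (𝕜 := ℂ) (0 : Fin 2)).restrictScalars ℝ)
    (contDiff_fieldVal s)
  have h1 := congrFun (pd2_clm_comp
    ((EuclideanSpace.proj (𝕜 := ℂ) (1 : Fin 2)).restrictScalars ℝ) (contDiff_fieldVal s)) x
  have c0 : ContDiff ℝ ∞ fun y => fieldVal s y 0 := (contDiff_piLp 2).1 (contDiff_fieldVal s) 0
  have hre := congrFun (pd2_clm_comp Complex.reCLM c0) x
  have him := congrFun (pd2_clm_comp Complex.imCLM c0) x
  have e0 : pd2 (fun y => fieldVal s y 0) x = (pd2 (fieldVal s) x) 0 := congrFun h0 x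
  rw [norm_sq_fieldFiber, ← e0]
  simp only [Complex.reCLM_apply, Complex.imCLM_apply] at hre him
  rw [← hre, ← him, show (pd2 (fieldVal s) x) 1 = pd2 s.1.2.2 x from h1.symm]
  simp [fieldVal]

/-- The constant comparing the ordinary gradient with the covariant jet. -/
def gradConst (d : ℤ) : ℝ := 2 + 8 * Real.pi ^ 2 * d ^ 2

theorem norm_pd1_sq_le (ψ : ℝ × ℝ → ℂ) {x : ℝ × ℝ} (hx : x ∈ unitSquare) :
    ‖pd1 ψ x‖ ^ 2 ≤ 2 * ‖D1 (refConn d) ψ x‖ ^ 2 + 8 * Real.pi ^ 2 * d ^ 2 * ‖ψ x‖ ^ 2 := by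
  have e : pd1 ψ x = D1 (refConn d) ψ x - I * (refConn d x : ℂ) * ψ x := by
    rw [D1]
    ring
  have h1 : ‖pd1 ψ x‖ ≤ ‖D1 (refConn d) ψ x‖ + |refConn d x| * ‖ψ x‖ := by
    rw [e]
    refine (norm_sub_le _ _).trans (le_of_eq ?_)
    rw [norm_mul, norm_mul, Complex.norm_I, one_mul, Complex.norm_real, Real.norm_eq_abs]
  have h2 : (|refConn d x|) ^ 2 ≤ 4 * Real.pi ^ 2 * d ^ 2 := by
    have hx2 : 0 ≤ x.2 ∧ x.2 ≤ 1 := ⟨hx.1.2, hx.2.2⟩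
    have : x.2 ^ 2 ≤ 1 := by nlinarith
    rw [sq_abs, refConn]
    have : 0 ≤ 4 * Real.pi ^ 2 * (d : ℝ) ^ 2 := by positivity
    nlinarith
  calc ‖pd1 ψ x‖ ^ 2 ≤ (‖D1 (refConn d) ψ x‖ + |refConn d x| * ‖ψ x‖) ^ 2 := by gcongr
    _ ≤ 2 * ‖D1 (refConn d) ψ x‖ ^ 2 + 2 * (|refConn d x|) ^ 2 * ‖ψ x‖ ^ 2 := by
        nlinarith [sq_nonneg (‖D1 (refConn d) ψ x‖ - |refConn d x| * ‖ψ x‖)]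
    _ ≤ _ := by nlinarith [sq_nonneg (‖ψ x‖)]

theorem integral_norm_grad_fieldVal_sq_le {α : ℝ} (hα : 0 ≤ α) (s : smoothFields d) :
    (∫ x in unitSquare, ‖pd1 (fieldVal s) x‖ ^ 2) + ∫ x in unitSquare, ‖pd2 (fieldVal s) x‖ ^ 2
      ≤ gradConst d * ((∫ x in unitSquare, ‖fieldJet α s x‖ ^ 2)
        + ∫ x in unitSquare, ‖fieldVal s x‖ ^ 2) := by
  have cv := (contDiff_fieldVal s).continuous
  have cj := continuous_fieldJet α s
  have cp1 := (contDiff_fieldVal s).pd1.continuous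
  have cp2 := (contDiff_fieldVal s).pd2.continuous
  obtain ⟨⟨h1, p1, q1⟩, ⟨h2, p2, q2⟩, h3, -⟩ := s.2
  have c11 := h1.pd1.continuous
  have c12 := h1.pd2.continuous
  have c21 := h2.pd1.continuous
  have c22 := h2.pd2.continuous
  have c31 := h3.pd1.continuous
  have c32 := h3.pd2.continuous
  have c3 := h3.continuous
  have cc := (h1.curv h2).continuous
  have cD := (h3.D1 (contDiff_refConn d)).continuous
  have hcd := integral_gradient_eq_curl_div h1 h2 p1 q1 p2 q2
  have k1 : Continuous fun x => ‖pd1 (fieldVal s) x‖ ^ 2 := by fun_prop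
  have k2 : Continuous fun x => ‖pd2 (fieldVal s) x‖ ^ 2 := by fun_prop
  have k3 : Continuous fun x => ‖fieldJet α s x‖ ^ 2 := by fun_prop
  have k4 : Continuous fun x => ‖fieldVal s x‖ ^ 2 := by fun_prop
  have k5 : Continuous fun x => pd1 s.1.1 x ^ 2 + pd2 s.1.1 x ^ 2 + pd1 s.1.2.1 x ^ 2
      + pd2 s.1.2.1 x ^ 2 := by fun_prop
  have k6 : Continuous fun x => curv s.1.1 s.1.2.1 x ^ 2 + (pd1 s.1.1 x + pd2 s.1.2.1 x) ^ 2 := by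
    fun_prop
  have k7 : Continuous fun x => ‖pd1 s.1.2.2 x‖ ^ 2 + ‖pd2 s.1.2.2 x‖ ^ 2 := by fun_prop
  have k8 : Continuous fun x => ‖fieldJet α s x‖ ^ 2 + ‖fieldVal s x‖ ^ 2 := k3.add k4
  rw [← integral_add k1.integrableOn_unitSquare k2.integrableOn_unitSquare,
    ← integral_add k3.integrableOn_unitSquare k4.integrableOn_unitSquare, ← integral_const_mul]
  have e1 : ∀ x, ‖pd1 (fieldVal s) x‖ ^ 2 + ‖pd2 (fieldVal s) x‖ ^ 2
      = (pd1 s.1.1 x ^ 2 + pd2 s.1.1 x ^ 2 + pd1 s.1.2.1 x ^ 2 + pd2 s.1.2.1 x ^ 2)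
        + (‖pd1 s.1.2.2 x‖ ^ 2 + ‖pd2 s.1.2.2 x‖ ^ 2) := fun x => by
    rw [norm_pd1_fieldVal_sq, norm_pd2_fieldVal_sq]
    ring
  simp_rw [e1]
  rw [integral_add k5.integrableOn_unitSquare k7.integrableOn_unitSquare, hcd,
    ← integral_add k6.integrableOn_unitSquare k7.integrableOn_unitSquare]
  refine setIntegral_unitSquare_mono (k6.add k7) (continuous_const.mul k8) fun x hx => ?_
  have h := norm_pd1_sq_le (d := d) s.1.2.2 hx
  rw [norm_fieldJet_sq hα, norm_fieldVal_sq, gradConst]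
  have hp : 0 ≤ 8 * Real.pi ^ 2 * (d : ℝ) ^ 2 := by positivity
  set K := 8 * Real.pi ^ 2 * (d : ℝ) ^ 2
  nlinarith [sq_nonneg (curv s.1.1 s.1.2.1 x), sq_nonneg (pd1 s.1.1 x + pd2 s.1.2.1 x),
    sq_nonneg (s.1.1 x), sq_nonneg (s.1.2.1 x), sq_nonneg ‖s.1.2.2 x‖,
    sq_nonneg ‖D1 (refConn d) s.1.2.2 x‖, sq_nonneg ‖pd2 s.1.2.2 x‖,
    mul_nonneg hp (sq_nonneg (curv s.1.1 s.1.2.1 x)),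
    mul_nonneg hp (sq_nonneg (pd1 s.1.1 x + pd2 s.1.2.1 x)),
    mul_nonneg hp (sq_nonneg (s.1.1 x)), mul_nonneg hp (sq_nonneg (s.1.2.1 x)),
    mul_nonneg hp (sq_nonneg ‖s.1.2.2 x‖), mul_nonneg hp (sq_nonneg ‖D1 (refConn d) s.1.2.2 x‖),
    mul_nonneg hp (sq_nonneg ‖pd2 s.1.2.2 x‖),
    mul_nonneg hα (sq_nonneg (s.1.1 x)), mul_nonneg hα (sq_nonneg (s.1.2.1 x)),
    mul_nonneg hp (mul_nonneg hα (sq_nonneg (s.1.1 x))),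
    mul_nonneg hp (mul_nonneg hα (sq_nonneg (s.1.2.1 x)))]

end Estimates

end

section

open scoped ContDiff Topology
open Filter Set

section FieldSpace

variable (d : ℤ) (α : ℝ)

/-- The field configurations embedded in `L²` through their values and covariant jets. -/
def graphMap : smoothFields d →ₗ[ℝ]
    WithLp 2 (Lp JetFiber 2 squareMeasure × Lp FieldFiber 2 squareMeasure) :=
  (WithLp.linearEquiv 2 ℝ
    (Lp JetFiber 2 squareMeasure × Lp FieldFiber 2 squareMeasure)).symm.toLinearMap ∘ₗ
    LinearMap.prod (squareLp JetFiber 2 ∘ₗ jetMap d α) (squareLp FieldFiber 2 ∘ₗ valMap d)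

/-- The Hilbert space of field configurations of degree `d` with square integrable derivatives. -/
def fieldSpace : Submodule ℝ
    (WithLp 2 (Lp JetFiber 2 squareMeasure × Lp FieldFiber 2 squareMeasure)) :=
  (LinearMap.range (graphMap d α)).topologicalClosure

instance : CompleteSpace (fieldSpace d α) :=
  (Submodule.isClosed_topologicalClosure _).completeSpace_coe

/-- The dense inclusion of smooth field configurations. -/
def fieldEmb : smoothFields d →ₗ[ℝ] fieldSpace d α :=
  (graphMap d α).codRestrict (fieldSpace d α) fun s =>
    Submodule.le_topologicalClosure _ (LinearMap.mem_range_self _ s)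

theorem denseRange_fieldEmb : DenseRange (fieldEmb d α) := by
  intro u
  rw [closure_subtype]
  have h : (Subtype.val '' range (fieldEmb d α)) = LinearMap.range (graphMap d α) := by
    rw [← range_comp]
    rfl
  rw [h]
  exact u.2

/-- The jet of a field configuration in the Hilbert space. -/
def jetCLM : fieldSpace d α →L[ℝ] Lp JetFiber 2 squareMeasure :=
  (WithLp.fstL 2 ℝ (Lp JetFiber 2 squareMeasure) (Lp FieldFiber 2 squareMeasure)).comp
    (fieldSpace d α).subtypeL

/-- The value of a field configuration in the Hilbert space. -/
def valCLM : fieldSpace d α →L[ℝ] Lp FieldFiber 2 squareMeasure :=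
  (WithLp.sndL 2 ℝ (Lp JetFiber 2 squareMeasure) (Lp FieldFiber 2 squareMeasure)).comp
    (fieldSpace d α).subtypeL

theorem norm_fieldSpace_sq (u : fieldSpace d α) :
    ‖u‖ ^ 2 = ‖jetCLM d α u‖ ^ 2 + ‖valCLM d α u‖ ^ 2 :=
  WithLp.prod_norm_sq_eq_of_L2 u.1

variable {d}

theorem jetCLM_fieldEmb (s : smoothFields d) :
    jetCLM d α (fieldEmb d α s) = squareLp JetFiber 2 (jetMap d α s) := rfl

theorem valCLM_fieldEmb (s : smoothFields d) :
    valCLM d α (fieldEmb d α s) = squareLp FieldFiber 2 (valMap d s) := rfl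

theorem norm_valCLM_sq (s : smoothFields d) :
    ‖valCLM d α (fieldEmb d α s)‖ ^ 2 = ∫ x in unitSquare, ‖fieldVal s x‖ ^ 2 := by
  rw [valCLM_fieldEmb, norm_squareLp_two_sq]
  rfl

theorem norm_jetCLM_sq (s : smoothFields d) :
    ‖jetCLM d α (fieldEmb d α s)‖ ^ 2 = ∫ x in unitSquare, ‖fieldJet α s x‖ ^ 2 := by
  rw [jetCLM_fieldEmb, norm_squareLp_two_sq]
  rfl

variable {α}

theorem gradConst_nonneg (d : ℤ) : 0 ≤ gradConst d := by
  unfold gradConst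
  positivity

theorem integral_grad_le_norm (hα : 0 ≤ α) (s : smoothFields d) :
    (∫ x in unitSquare, ‖pd1 (fieldVal s) x‖ ^ 2) + ∫ x in unitSquare, ‖pd2 (fieldVal s) x‖ ^ 2
      ≤ gradConst d * ‖fieldEmb d α s‖ ^ 2 := by
  rw [norm_fieldSpace_sq, norm_jetCLM_sq, norm_valCLM_sq]
  exact integral_norm_grad_fieldVal_sq_le hα s

theorem norm_valCLM_le (u : fieldSpace d α) : ‖valCLM d α u‖ ≤ ‖u‖ := by
  have := norm_fieldSpace_sq d α u
  exact le_of_pow_le_pow_left₀ (n := 2) (by norm_num) (norm_nonneg _)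
    (by nlinarith [sq_nonneg ‖jetCLM d α u‖])

theorem norm_squareLp_four_pow_le (hα : 0 ≤ α) (s : smoothFields d) :
    ‖squareLp FieldFiber 4 (valMap d s)‖ ^ 4
      ≤ 4 * (1 + gradConst d) * ‖valCLM d α (fieldEmb d α s)‖ ^ 2 * ‖fieldEmb d α s‖ ^ 2 := by
  have h := integral_norm_pow_four_le ((contDiff_fieldVal s).of_le (by exact_mod_cast le_top))
  have hg := integral_grad_le_norm hα s
  have hv := norm_valCLM_le (fieldEmb d α s)
  rw [norm_squareLp_four_pow]
  rw [← norm_valCLM_sq α] at h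
  refine h.trans ?_
  have : ‖valCLM d α (fieldEmb d α s)‖ ^ 2 ≤ ‖fieldEmb d α s‖ ^ 2 := by gcongr
  nlinarith [sq_nonneg ‖valCLM d α (fieldEmb d α s)‖]

theorem norm_squareLp_four_le (hα : 0 ≤ α) (s : smoothFields d) :
    ‖squareLp FieldFiber 4 (valMap d s)‖ ≤ 4 * (1 + gradConst d) * ‖fieldEmb d α s‖ := by
  have h := norm_squareLp_four_pow_le hα s
  have hg := gradConst_nonneg d
  have hv := norm_valCLM_le (fieldEmb d α s)
  have hK : 1 ≤ 4 * (1 + gradConst d) := by linarith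
  refine le_of_pow_le_pow_left₀ (n := 4) (by norm_num) (by positivity) (h.trans ?_)
  calc _ ≤ 4 * (1 + gradConst d) * ‖fieldEmb d α s‖ ^ 2 * ‖fieldEmb d α s‖ ^ 2 := by gcongr
    _ = (4 * (1 + gradConst d)) ^ 1 * ‖fieldEmb d α s‖ ^ 4 := by ring
    _ ≤ (4 * (1 + gradConst d)) ^ 4 * ‖fieldEmb d α s‖ ^ 4 := by
        gcongr
        norm_num
    _ = _ := by ring

variable (d α) in
/-- The value of a field configuration as an `L⁴` function. -/
def valCLM4 : fieldSpace d α →L[ℝ] Lp FieldFiber 4 squareMeasure :=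
  (squareLp FieldFiber 4 ∘ₗ valMap d).extendOfNorm (fieldEmb d α)

theorem valCLM4_fieldEmb (hα : 0 ≤ α) (s : smoothFields d) :
    valCLM4 d α (fieldEmb d α s) = squareLp FieldFiber 4 (valMap d s) :=
  LinearMap.extendOfNorm_eq (denseRange_fieldEmb d α) ⟨_, norm_squareLp_four_le hα⟩ s

theorem norm_valCLM_le_norm_valCLM4 (hα : 0 ≤ α) (u : fieldSpace d α) :
    ‖valCLM d α u‖ ≤ 1 * ‖valCLM4 d α u‖ := by
  rw [one_mul]
  refine (denseRange_fieldEmb d α).induction_on u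
    (isClosed_le (valCLM d α).continuous.norm (valCLM4 d α).continuous.norm) fun s => ?_
  rw [valCLM4_fieldEmb hα]
  refine le_of_pow_le_pow_left₀ (n := 4) (by norm_num) (norm_nonneg _) ?_
  rw [norm_squareLp_four_pow, show 4 = 2 * 2 from rfl, pow_mul, norm_valCLM_sq]
  have c := (contDiff_fieldVal s).continuous
  refine (sq_setIntegral_le (f := fun x => ‖fieldVal s x‖ ^ 2) (by fun_prop)).trans (le_of_eq ?_)
  refine integral_congr_ae (ae_of_all _ fun x => ?_)
  simp only [valMap, LinearMap.coe_mk, AddHom.coe_mk, ContinuousMap.coe_mk]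
  ring

end FieldSpace

end

section

open scoped ContDiff Topology
open Filter Set

section CellIntegrals

variable {E : Type*} [NormedAddCommGroup E] [InnerProductSpace ℝ E] [CompleteSpace E]

theorem norm_setIntegral_Lp_le (s : Set (ℝ × ℝ)) (hs : MeasurableSet s)
    (f : Lp E 2 squareMeasure) : ‖∫ x in s, f x ∂squareMeasure‖ ≤ ‖f‖ := by
  set c := ∫ x in s, f x ∂squareMeasure with hc
  have h := L2.inner_indicatorConstLp_eq_inner_setIntegral (𝕜 := ℝ) hs
    (measure_ne_top squareMeasure s) c f
  rw [← hc, real_inner_self_eq_norm_sq] at h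
  have h1 := real_inner_le_norm (indicatorConstLp 2 hs (measure_ne_top squareMeasure s) c) f
  have h2 : ‖indicatorConstLp 2 hs (measure_ne_top squareMeasure s) c‖ ≤ ‖c‖ := by
    refine norm_indicatorConstLp_le.trans (mul_le_of_le_one_right (norm_nonneg _) ?_)
    exact Real.rpow_le_one measureReal_nonneg measureReal_le_one (by positivity)
  have h3 := mul_le_mul_of_nonneg_right h2 (norm_nonneg f)
  rcases eq_or_lt_of_le (norm_nonneg c) with h0 | h0
  · rw [← h0]
    exact norm_nonneg _
  · nlinarith

/-- Integration over a subset of the fundamental domain. -/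
def setIntegralCLM (s : Set (ℝ × ℝ)) (hs : MeasurableSet s) : Lp E 2 squareMeasure →L[ℝ] E :=
  LinearMap.mkContinuous
    { toFun := fun f => ∫ x in s, f x ∂squareMeasure
      map_add' := fun f g => by
        rw [← integral_add ((Lp.memLp f).integrable (by norm_num)).integrableOn
          ((Lp.memLp g).integrable (by norm_num)).integrableOn]
        exact integral_congr_ae (ae_restrict_of_ae (Lp.coeFn_add f g))
      map_smul' := fun c f => by
        rw [RingHom.id_apply, ← integral_smul]
        exact integral_congr_ae (ae_restrict_of_ae (Lp.coeFn_smul c f)) } 1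
    (fun f => by
      rw [one_mul]
      exact norm_setIntegral_Lp_le s hs f)

theorem setIntegralCLM_squareLp {a b c d : ℝ} (hab : a ≤ b) (hcd : c ≤ d) (ha : 0 ≤ a) (hb : b ≤ 1)
    (hc : 0 ≤ c) (hd : d ≤ 1) (hs : MeasurableSet (Icc a b ×ˢ Icc c d)) (f : C(ℝ × ℝ, E)) :
    setIntegralCLM (Icc a b ×ˢ Icc c d) hs (squareLp E 2 f)
      = ∫ s in a..b, ∫ t in c..d, f (s, t) := by
  rw [← setIntegral_rectangle f.continuous hab hcd]
  have h1 : setIntegralCLM (Icc a b ×ˢ Icc c d) hs (squareLp E 2 f)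
      = ∫ x in Icc a b ×ˢ Icc c d, squareLp E 2 f x ∂squareMeasure := rfl
  rw [h1, integral_congr_ae (ae_restrict_of_ae (coeFn_squareLp 2 f)), squareMeasure,
    Measure.restrict_restrict hs, inter_eq_self_of_subset_left]
  rw [unitSquare_eq]
  exact prod_mono (Icc_subset_Icc ha hb) (Icc_subset_Icc hc hd)

end CellIntegrals

section Ehrling

variable {d : ℤ} {α : ℝ}

/-- The cell `[j/N, (j+1)/N] × [k/N, (k+1)/N]`. -/
def gridCell (N : ℕ) (p : Fin N × Fin N) : Set (ℝ × ℝ) :=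
  Icc ((p.1 : ℕ) / N : ℝ) ((p.1 : ℕ) / N + 1 / N) ×ˢ Icc ((p.2 : ℕ) / N : ℝ) ((p.2 : ℕ) / N + 1 / N)

theorem measurableSet_gridCell (N : ℕ) (p : Fin N × Fin N) : MeasurableSet (gridCell N p) :=
  measurableSet_Icc.prod measurableSet_Icc

variable (d α) in
/-- The integrals of a field configuration over the cells of the grid of mesh `1/N`. -/
def gridMap (N : ℕ) : fieldSpace d α →L[ℝ] PiLp 2 (fun _ : Fin N × Fin N => FieldFiber) :=
  (PiLp.continuousLinearEquiv 2 ℝ (fun _ : Fin N × Fin N => FieldFiber)).symm.toContinuousLinearMap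
    ∘L ContinuousLinearMap.pi fun p =>
      (setIntegralCLM (gridCell N p) (measurableSet_gridCell N p)) ∘L valCLM d α

theorem norm_gridMap_sq (N : ℕ) (s : smoothFields d) : ‖gridMap d α N (fieldEmb d α s)‖ ^ 2
    = ∑ j ∈ Finset.range N, ∑ k ∈ Finset.range N,
        ‖∫ x in (j / N : ℝ)..j / N + 1 / N, ∫ y in (k / N : ℝ)..k / N + 1 / N,
          fieldVal s (x, y)‖ ^ 2 := by
  have hle : ∀ j : Fin N, ((j : ℕ) / N + 1 / N : ℝ) ≤ 1 := fun j => by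
    have h : ((j : ℕ) : ℝ) + 1 ≤ N := by exact_mod_cast j.2
    rw [← add_div]
    exact div_le_one_of_le₀ h (by positivity)
  have hle' : ∀ j : Fin N, ((j : ℕ) / N : ℝ) ≤ (j : ℕ) / N + 1 / N := fun j => by
    have : (0 : ℝ) ≤ 1 / N := by positivity
    linarith
  rw [PiLp.norm_sq_eq_of_L2, Fintype.sum_prod_type, Finset.sum_range]
  refine Finset.sum_congr rfl fun j _ => ?_
  rw [Finset.sum_range]
  refine Finset.sum_congr rfl fun k _ => ?_
  have h := setIntegralCLM_squareLp (hle' j) (hle' k) (by positivity) (hle j) (by positivity)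
    (hle k) (measurableSet_gridCell N (j, k)) (valMap d s)
  exact congrArg (fun z => ‖z‖ ^ 2) h

theorem norm_valCLM_sq_le_grid (hα : 0 ≤ α) {N : ℕ} (hN : 0 < N) (s : smoothFields d) :
    ‖valCLM d α (fieldEmb d α s)‖ ^ 2 ≤ 4 * gradConst d / N ^ 2 * ‖fieldEmb d α s‖ ^ 2
      + 2 * N ^ 2 * ‖gridMap d α N (fieldEmb d α s)‖ ^ 2 := by
  rw [norm_valCLM_sq, norm_gridMap_sq]
  refine (poincare_sum_squares ((contDiff_fieldVal s).of_le (by exact_mod_cast le_top)) hN).trans ?_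
  have h := integral_grad_le_norm hα s
  refine add_le_add ?_ le_rfl
  calc _ ≤ 4 / (N : ℝ) ^ 2 * (gradConst d * ‖fieldEmb d α s‖ ^ 2) := by gcongr
    _ = _ := by ring

theorem norm_valCLM4_le_grid (hα : 0 ≤ α) {ε : ℝ} (hε : 0 < ε) :
    ∃ N : ℕ, ∃ M : ℝ, 0 ≤ M ∧ ∀ u, ‖valCLM4 d α u‖ ≤ ε * ‖u‖ + M * ‖gridMap d α N u‖ := by
  have hg := gradConst_nonneg d
  set K := 1 + gradConst d with hK
  have hK1 : 1 ≤ K := by linarith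
  obtain ⟨N, hN⟩ := exists_nat_gt (32 * K ^ 2 / ε ^ 4 + 1)
  have hpos : 0 < 32 * K ^ 2 / ε ^ 4 := by positivity
  have hN1 : (1 : ℝ) < N := by linarith
  have hN0 : 0 < N := by
    have : (0 : ℝ) < N := by linarith
    exact_mod_cast this
  have hNε : 16 * K ^ 2 / (N : ℝ) ^ 2 ≤ ε ^ 4 / 2 := by
    rw [div_le_div_iff₀ (by positivity) (by norm_num)]
    have h1 : 32 * K ^ 2 / ε ^ 4 ≤ N := by linarith
    rw [div_le_iff₀ (by positivity)] at h1
    have h2 : (N : ℝ) ≤ N ^ 2 := by nlinarith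
    have h3 : (N : ℝ) * ε ^ 4 ≤ N ^ 2 * ε ^ 4 := by gcongr
    linarith
  set C := 8 * K * (N : ℝ) ^ 2 with hC
  have hC0 : 0 ≤ C := by positivity
  refine ⟨N, 1 + C ^ 2 / (2 * ε ^ 4), by positivity, fun u => ?_⟩
  refine (denseRange_fieldEmb d α).induction_on u (isClosed_le (valCLM4 d α).continuous.norm
    ((continuous_const.mul continuous_norm).add
      (continuous_const.mul (gridMap d α N).continuous.norm))) fun s => ?_
  have h1 := norm_squareLp_four_pow_le hα s
  have h2 := norm_valCLM_sq_le_grid hα hN0 s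
  rw [← valCLM4_fieldEmb hα, ← hK] at h1
  set j := ‖valCLM4 d α (fieldEmb d α s)‖
  set e := ‖fieldEmb d α s‖ with he
  set t := ‖gridMap d α N (fieldEmb d α s)‖
  have he0 : 0 ≤ e := norm_nonneg _
  have ht0 : 0 ≤ t := norm_nonneg _
  have h3 : j ^ 4 ≤ ε ^ 4 * e ^ 4 + C ^ 2 / (2 * ε ^ 4) * t ^ 4 := by
    have a1 : j ^ 4 ≤ 4 * K * (4 * K / N ^ 2 * e ^ 2 + 2 * N ^ 2 * t ^ 2) * e ^ 2 := by
      refine h1.trans ?_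
      gcongr
      refine h2.trans ?_
      gcongr
      linarith
    have a2 : 4 * K * (4 * K / N ^ 2 * e ^ 2 + 2 * N ^ 2 * t ^ 2) * e ^ 2
        = 16 * K ^ 2 / (N : ℝ) ^ 2 * e ^ 4 + C * t ^ 2 * e ^ 2 := by
      rw [hC]
      ring
    have a3 : 16 * K ^ 2 / (N : ℝ) ^ 2 * e ^ 4 ≤ ε ^ 4 / 2 * e ^ 4 := by gcongr
    have a4 : C * t ^ 2 * e ^ 2 ≤ ε ^ 4 / 2 * e ^ 4 + C ^ 2 / (2 * ε ^ 4) * t ^ 4 := by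
      have hp : 0 < 2 * ε ^ 4 := by positivity
      have : 0 ≤ (ε ^ 4 * e ^ 2 - C * t ^ 2) ^ 2 / (2 * ε ^ 4) := by positivity
      have e2 : (ε ^ 4 * e ^ 2 - C * t ^ 2) ^ 2 / (2 * ε ^ 4)
          = ε ^ 4 / 2 * e ^ 4 + C ^ 2 / (2 * ε ^ 4) * t ^ 4 - C * t ^ 2 * e ^ 2 := by
        field_simp
        ring
      linarith
    linarith
  set m := C ^ 2 / (2 * ε ^ 4) with hm
  have hm0 : 0 ≤ m := by positivity
  refine le_of_pow_le_pow_left₀ (n := 4) (by norm_num) (by positivity) (h3.trans ?_)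
  have h5 : m ≤ (1 + m) ^ 4 := by nlinarith [pow_nonneg hm0 2, pow_nonneg hm0 3, pow_nonneg hm0 4]
  calc _ ≤ (ε * e) ^ 4 + ((1 + m) * t) ^ 4 := by
        rw [mul_pow, mul_pow]
        gcongr
    _ ≤ _ := by
        have p1 : 0 ≤ ε * e := by positivity
        have p2 : 0 ≤ (1 + m) * t := by positivity
        set x := ε * e
        set y := (1 + m) * t
        have : (x + y) ^ 4 = x ^ 4 + y ^ 4 + (4 * x ^ 3 * y + 6 * x ^ 2 * y ^ 2 + 4 * x * y ^ 3) := by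
          ring
        rw [this]
        have : 0 ≤ 4 * x ^ 3 * y + 6 * x ^ 2 * y ^ 2 + 4 * x * y ^ 3 := by positivity
        linarith

theorem ehrlingCompact_valCLM4 (hα : 0 ≤ α) : EhrlingCompact (valCLM4 d α) := by
  intro ε hε
  obtain ⟨N, M, hM, h⟩ := norm_valCLM4_le_grid (d := d) hα hε
  let e := (stdOrthonormalBasis ℝ (PiLp 2 (fun _ : Fin N × Fin N => FieldFiber))).repr
  refine ⟨_, M • (e.toContinuousLinearEquiv.toContinuousLinearMap ∘L gridMap d α N), fun u => ?_⟩
  refine (h u).trans (le_of_eq ?_)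
  have h1 : (M • (e.toContinuousLinearEquiv.toContinuousLinearMap ∘L gridMap d α N)) u
      = M • e (gridMap d α N u) := rfl
  rw [h1, norm_smul, e.norm_map, Real.norm_of_nonneg hM]

end Ehrling

end

section

open scoped ContDiff Topology
open Filter Set

section Formulas

variable {d : ℤ}

/-- A field pair as a field configuration relative to the reference connection. -/
def FieldPair.toFields (P : FieldPair d) : smoothFields d :=
  ⟨(P.b1, P.a2, P.φ), ⟨P.contDiff_b1, P.periodic1_b1, P.periodic2_b1⟩,
    ⟨P.smooth_a2, P.per1_a2, P.per2_a2⟩, P.smooth_φ, P.per1_φ, P.per2_φ⟩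

/-- The inhomogeneous term coming from the external field and the reference curvature. -/
def sourceJet (d : ℤ) (F : C(ℝ × ℝ, ℝ)) : C(ℝ × ℝ, JetFiber) :=
  ⟨fun x => !₂[((2 * Real.pi * d - F x : ℝ) : ℂ), 0, 0, 0, 0], by
    refine (PiLp.continuous_toLp 2 _).comp (continuous_pi fun i => ?_)
    fin_cases i
    · exact Complex.continuous_ofReal.comp (continuous_const.sub F.continuous)
    all_goals exact continuous_const⟩

/-- The pointwise coupling of two continuous configurations. -/
def couplingMap (β : ℝ) (f g : C(ℝ × ℝ, FieldFiber)) : C(ℝ × ℝ, JetFiber) :=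
  ⟨fun x => fiberCoupling β (f x) (g x), by fun_prop⟩

/-- The coupling as a bilinear map from `L⁴` to `L²`. -/
def couplingL (β : ℝ) : Lp FieldFiber 4 squareMeasure →L[ℝ] Lp FieldFiber 4 squareMeasure →L[ℝ]
    Lp JetFiber 2 squareMeasure :=
  (fiberCoupling β).holderL squareMeasure 4 4 2

theorem couplingL_squareLp (β : ℝ) (f g : C(ℝ × ℝ, FieldFiber)) :
    couplingL β (squareLp FieldFiber 4 f) (squareLp FieldFiber 4 g)
      = squareLp JetFiber 2 (couplingMap β f g) :=
  holderL_squareLp (fiberCoupling β) f g (couplingMap β f g) fun _ => rfl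

variable {α β : ℝ} (hα : 0 ≤ α) (F : C(ℝ × ℝ, ℝ))

include hα in
theorem quadMap_fieldEmb (s : smoothFields d) :
    quadMap (jetCLM d α) (valCLM4 d α) (couplingL β) (squareLp JetFiber 2 (sourceJet d F))
      (fieldEmb d α s)
      = squareLp JetFiber 2 (jetMap d α s + sourceJet d F
          + couplingMap β (valMap d s) (valMap d s)) := by
  rw [quadMap, valCLM4_fieldEmb hα, couplingL_squareLp, jetCLM_fieldEmb, map_add, map_add]

/-- The full nonlinear jet of a field pair. -/
def FieldPair.totalJet (P : FieldPair d) (α β : ℝ) (F : C(ℝ × ℝ, ℝ)) : C(ℝ × ℝ, JetFiber) :=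
  jetMap d α P.toFields + sourceJet d F + couplingMap β (valMap d P.toFields) (valMap d P.toFields)

theorem FieldPair.totalJet_apply (P : FieldPair d) (x : ℝ × ℝ) : P.totalJet α β F x =
    !₂[((curv P.a1 P.a2 x - F x : ℝ) : ℂ) + I * (pd1 P.b1 x + pd2 P.a2 x : ℝ), D1 P.a1 P.φ x,
      D2 P.a2 P.φ x, ((√(β / 2) * ‖P.φ x‖ ^ 2 : ℝ) : ℂ), (√α : ℂ) * ((P.b1 x : ℂ) + I * P.a2 x)] := by
  have e : P.totalJet α β F x = fieldJet α P.toFields x + sourceJet d F x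
    + fiberCoupling β (fieldVal P.toFields x) (fieldVal P.toFields x) := rfl
  rw [e, fiberCoupling_apply]
  ext i
  fin_cases i
  · simp [fieldJet, sourceJet, curv, FieldPair.toFields, P.pd2_b1]
    ring
  · simp [fieldJet, sourceJet, fieldVal, D1, refConn, FieldPair.toFields, FieldPair.b1]
    ring
  · simp [fieldJet, sourceJet, fieldVal, D2, FieldPair.toFields]
  · simp [fieldJet, sourceJet, fieldVal, FieldPair.toFields]
  · simp [fieldJet, sourceJet, FieldPair.toFields]

/-- The derivative of the full jet of a field pair in the direction of a field configuration. -/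
def FieldPair.varJet (P : FieldPair d) (α β : ℝ) (s : smoothFields d) : C(ℝ × ℝ, JetFiber) :=
  jetMap d α s + (couplingMap β (valMap d P.toFields) (valMap d s)
    + couplingMap β (valMap d s) (valMap d P.toFields))

theorem FieldPair.varJet_apply (P : FieldPair d) (s : smoothFields d) (x : ℝ × ℝ) :
    P.varJet α β s x =
    !₂[(curv s.1.1 s.1.2.1 x : ℂ) + I * (pd1 s.1.1 x + pd2 s.1.2.1 x : ℝ),
      D1 P.a1 s.1.2.2 x + I * s.1.1 x * P.φ x, D2 P.a2 s.1.2.2 x + I * s.1.2.1 x * P.φ x,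
      ((√(β / 2) * (2 * inner ℝ (P.φ x) (s.1.2.2 x)) : ℝ) : ℂ),
      (√α : ℂ) * ((s.1.1 x : ℂ) + I * s.1.2.1 x)] := by
  have e : P.varJet α β s x = fieldJet α s x
    + (fiberCoupling β (fieldVal P.toFields x) (fieldVal s x)
      + fiberCoupling β (fieldVal s x) (fieldVal P.toFields x)) := rfl
  rw [e, fiberCoupling_apply, fiberCoupling_apply]
  ext i
  fin_cases i
  · simp [fieldJet]
  · simp [fieldJet, fieldVal, D1, refConn, FieldPair.toFields, FieldPair.b1]
    ring
  · simp [fieldJet, fieldVal, D2, FieldPair.toFields]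
    ring
  · simp [fieldJet, fieldVal, FieldPair.toFields, real_inner_comm (P.φ x)]
    ring
  · simp [fieldJet]

theorem inner_add_I_mul (a b c e : ℝ) :
    inner ℝ ((a : ℂ) + I * b) ((c : ℂ) + I * e) = a * c + b * e := by
  rw [Complex.inner]
  simp
  ring

theorem inner_sqrt_mul {r : ℝ} (hr : 0 ≤ r) (z w : ℂ) :
    inner ℝ ((√r : ℂ) * z) ((√r : ℂ) * w) = r * inner ℝ z w := by
  rw [← Complex.real_smul, ← Complex.real_smul, inner_smul_left, inner_smul_right, ← mul_assoc]
  simp [Real.mul_self_sqrt hr]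

include hα in
theorem FieldPair.inner_totalJet_varJet (hβ : 0 ≤ β) (P : FieldPair d) (s : smoothFields d)
    (x : ℝ × ℝ) : inner ℝ (P.totalJet α β F x) (P.varJet α β s x)
      = ((curv P.a1 P.a2 x - F x) * curv s.1.1 s.1.2.1 x
        + inner ℝ (D1 P.a1 P.φ x) (D1 P.a1 s.1.2.2 x + I * s.1.1 x * P.φ x)
        + inner ℝ (D2 P.a2 P.φ x) (D2 P.a2 s.1.2.2 x + I * s.1.2.1 x * P.φ x)
        + (β * ‖P.φ x‖ ^ 2 - α) * inner ℝ (P.φ x) (s.1.2.2 x))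
        + (pd1 P.b1 x + pd2 P.a2 x) * (pd1 s.1.1 x + pd2 s.1.2.1 x)
        + α * inner ℝ (fieldVal P.toFields x) (fieldVal s x) := by
  rw [P.totalJet_apply, P.varJet_apply, PiLp.inner_apply, PiLp.inner_apply, Fin.sum_univ_five,
    Fin.sum_univ_two]
  have h0 : (0 : ℝ) ≤ β / 2 := by positivity
  have h3 : inner ℝ (((√(β / 2) * ‖P.φ x‖ ^ 2 : ℝ) : ℂ))
      (((√(β / 2) * (2 * inner ℝ (P.φ x) (s.1.2.2 x)) : ℝ) : ℂ))
      = β * ‖P.φ x‖ ^ 2 * inner ℝ (P.φ x) (s.1.2.2 x) := by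
    rw [Complex.inner, Complex.conj_ofReal, ← Complex.ofReal_mul, Complex.ofReal_re]
    have := Real.mul_self_sqrt h0
    linear_combination (‖P.φ x‖ ^ 2 * (2 * inner ℝ (P.φ x) (s.1.2.2 x))) * this
  simp only [fieldVal, FieldPair.toFields, PiLp.toLp_apply, Matrix.cons_val_zero,
    Matrix.cons_val_one, Matrix.cons_val]
  rw [inner_add_I_mul, h3, inner_sqrt_mul hα, inner_add_I_mul]
  ring

include hα in
theorem FieldPair.norm_totalJet_sq (hβ : 0 ≤ β) (P : FieldPair d) (x : ℝ × ℝ) :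
    ‖P.totalJet α β F x‖ ^ 2 = ((curv P.a1 P.a2 x - F x) ^ 2 + ‖D1 P.a1 P.φ x‖ ^ 2
        + ‖D2 P.a2 P.φ x‖ ^ 2 - α * ‖P.φ x‖ ^ 2 + (β / 2) * ‖P.φ x‖ ^ 4)
      + (pd1 P.b1 x + pd2 P.a2 x) ^ 2 + α * ‖fieldVal P.toFields x‖ ^ 2 := by
  rw [norm_fieldVal_sq, P.totalJet_apply, EuclideanSpace.norm_sq_eq, Fin.sum_univ_five]
  have h0 : (0 : ℝ) ≤ β / 2 := by positivity
  simp only [FieldPair.toFields, Matrix.cons_val_zero,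
    Matrix.cons_val_one, Matrix.cons_val]
  rw [norm_sq_add_I_mul, norm_mul, mul_pow, norm_sq_add_I_mul, Complex.norm_real,
    Complex.norm_real, Real.norm_eq_abs, Real.norm_eq_abs, sq_abs, sq_abs, Real.sq_sqrt hα, mul_pow,
    Real.sq_sqrt h0]
  ring

theorem setIntegral_unitSquare_add_add {f g h : ℝ × ℝ → ℝ} (hf : Continuous f) (hg : Continuous g)
    (hh : Continuous h) : ∫ x in unitSquare, (f x + g x + h x)
      = (∫ x in unitSquare, f x) + (∫ x in unitSquare, g x) + ∫ x in unitSquare, h x := by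
  rw [← integral_add hf.integrableOn_unitSquare hg.integrableOn_unitSquare]
  exact integral_add (hf.add hg).integrableOn_unitSquare hh.integrableOn_unitSquare

theorem FieldPair.continuous_div (P : FieldPair d) :
    Continuous fun x => pd1 P.b1 x + pd2 P.a2 x :=
  P.contDiff_b1.pd1.continuous.add P.smooth_a2.pd2.continuous

include hα in
theorem FieldPair.quarticEnergy_toFields (hβ : 0 ≤ β) (P : FieldPair d) :
    quarticEnergy α (jetCLM d α) (valCLM d α) (valCLM4 d α) (couplingL β)
      (squareLp JetFiber 2 (sourceJet d F)) (fieldEmb d α P.toFields)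
      = energy α β F P + 1 / 2 * ∫ x in unitSquare, (pd1 P.b1 x + pd2 P.a2 x) ^ 2 := by
  have c0 := P.smooth_φ.continuous
  have c1 := (P.smooth_φ.D1 P.smooth_a1).continuous
  have c2 := (P.smooth_φ.D2 P.smooth_a2).continuous
  have c3 := (P.smooth_a1.curv P.smooth_a2).continuous
  have c4 := P.continuous_div
  have c5 := (contDiff_fieldVal P.toFields).continuous
  have k1 : Continuous fun x => (curv P.a1 P.a2 x - F x) ^ 2 + ‖D1 P.a1 P.φ x‖ ^ 2
      + ‖D2 P.a2 P.φ x‖ ^ 2 - α * ‖P.φ x‖ ^ 2 + (β / 2) * ‖P.φ x‖ ^ 4 := by fun_prop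
  have k2 : Continuous fun x => (pd1 P.b1 x + pd2 P.a2 x) ^ 2 := by fun_prop
  have k3 : Continuous fun x => α * ‖fieldVal P.toFields x‖ ^ 2 := by fun_prop
  have e : quadMap (jetCLM d α) (valCLM4 d α) (couplingL β) (squareLp JetFiber 2 (sourceJet d F))
      (fieldEmb d α P.toFields) = squareLp JetFiber 2 (P.totalJet α β F) :=
    quadMap_fieldEmb hα F P.toFields
  rw [quarticEnergy, e, norm_squareLp_two_sq, norm_valCLM_sq, energy]
  simp_rw [P.norm_totalJet_sq hα F hβ]
  rw [setIntegral_unitSquare_add_add k1 k2 k3, integral_const_mul]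
  ring

include hα in
theorem FieldPair.quarticDeriv_toFields (hβ : 0 ≤ β) {P : FieldPair d} (hF : ExternalField d F)
    (hP : IsGLSolution α β F P) (s : smoothFields d) :
    quarticDeriv α (jetCLM d α) (valCLM d α) (valCLM4 d α) (couplingL β)
      (squareLp JetFiber 2 (sourceJet d F)) (fieldEmb d α P.toFields) (fieldEmb d α s)
      = ∫ x in unitSquare, (pd1 P.b1 x + pd2 P.a2 x) * (pd1 s.1.1 x + pd2 s.1.2.1 x) := by
  obtain ⟨⟨h1, -⟩, ⟨h2, -⟩, h3, -⟩ := s.2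
  have n1 := h1.continuous
  have n2 := h2.continuous
  have n3 := h3.continuous
  have n4 := (h1.curv h2).continuous
  have n5 := (h3.D1 P.smooth_a1).continuous
  have n6 := (h3.D2 P.smooth_a2).continuous
  have n7 := h1.pd1.continuous.add h2.pd2.continuous
  have c0 := P.smooth_φ.continuous
  have c1 := (P.smooth_φ.D1 P.smooth_a1).continuous
  have c2 := (P.smooth_φ.D2 P.smooth_a2).continuous
  have c3 := (P.smooth_a1.curv P.smooth_a2).continuous
  have c4 := P.continuous_div
  have c5 := (contDiff_fieldVal P.toFields).continuous
  have c6 := (contDiff_fieldVal s).continuous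
  have k1 : Continuous fun x => (curv P.a1 P.a2 x - F x) * curv s.1.1 s.1.2.1 x
        + inner ℝ (D1 P.a1 P.φ x) (D1 P.a1 s.1.2.2 x + I * s.1.1 x * P.φ x)
        + inner ℝ (D2 P.a2 P.φ x) (D2 P.a2 s.1.2.2 x + I * s.1.2.1 x * P.φ x)
        + (β * ‖P.φ x‖ ^ 2 - α) * inner ℝ (P.φ x) (s.1.2.2 x) := by fun_prop
  have k2 : Continuous fun x => (pd1 P.b1 x + pd2 P.a2 x) * (pd1 s.1.1 x + pd2 s.1.2.1 x) :=
    c4.mul n7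
  have k3 : Continuous fun x => α * inner ℝ (fieldVal P.toFields x) (fieldVal s x) := by fun_prop
  have e : quadMap (jetCLM d α) (valCLM4 d α) (couplingL β) (squareLp JetFiber 2 (sourceJet d F))
      (fieldEmb d α P.toFields) = squareLp JetFiber 2 (P.totalJet α β F) :=
    quadMap_fieldEmb hα F P.toFields
  have e2 : jetCLM d α (fieldEmb d α s)
      + (couplingL β (valCLM4 d α (fieldEmb d α P.toFields)) (valCLM4 d α (fieldEmb d α s))
        + couplingL β (valCLM4 d α (fieldEmb d α s)) (valCLM4 d α (fieldEmb d α P.toFields)))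
      = squareLp JetFiber 2 (P.varJet α β s) := by
    rw [valCLM4_fieldEmb hα, valCLM4_fieldEmb hα, couplingL_squareLp, couplingL_squareLp,
      jetCLM_fieldEmb, ← map_add, ← map_add]
    rfl
  have e3 : inner ℝ (valCLM d α (fieldEmb d α P.toFields)) (valCLM d α (fieldEmb d α s))
      = ∫ x in unitSquare, inner ℝ (fieldVal P.toFields x) (fieldVal s x) := by
    rw [valCLM_fieldEmb, valCLM_fieldEmb, inner_squareLp]
    rfl
  rw [quarticDeriv, e, e2, e3, inner_squareLp]
  simp_rw [P.inner_totalJet_varJet hα F hβ]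
  rw [setIntegral_unitSquare_add_add k1 k2 k3, integral_const_mul,
    weak_form hF hP s.2]
  ring

include hα in
theorem FieldPair.abs_quarticDeriv_toFields_le (hβ : 0 ≤ β) {P : FieldPair d}
    (hF : ExternalField d F) (hP : IsGLSolution α β F P) {ε : ℝ} (hε : 0 ≤ ε)
    (h : ∀ x, |pd1 P.b1 x + pd2 P.a2 x| ≤ ε) (s : smoothFields d) :
    |quarticDeriv α (jetCLM d α) (valCLM d α) (valCLM4 d α) (couplingL β)
      (squareLp JetFiber 2 (sourceJet d F)) (fieldEmb d α P.toFields) (fieldEmb d α s)|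
      ≤ ε * ‖fieldEmb d α s‖ := by
  rw [FieldPair.quarticDeriv_toFields hα F hβ hF hP]
  obtain ⟨⟨h1, -⟩, ⟨h2, -⟩, -⟩ := s.2
  have c1 := h1.pd1.continuous.add h2.pd2.continuous
  have c2 := P.continuous_div
  have cj := continuous_fieldJet α s
  refine abs_le_of_sq_le_sq (le_trans (sq_setIntegral_le (c2.mul c1)) ?_) (by positivity)
  calc _ ≤ ∫ x in unitSquare, ε ^ 2 * ‖fieldJet α s x‖ ^ 2 := by
        refine setIntegral_unitSquare_mono ((c2.mul c1).pow 2) (by fun_prop) fun x _ => ?_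
        rw [mul_pow]
        refine mul_le_mul (sq_le_sq' ?_ ?_) ?_ (sq_nonneg _) (sq_nonneg _)
        · exact (abs_le.1 (h x)).1
        · exact (abs_le.1 (h x)).2
        · rw [norm_fieldJet_sq hα]
          have := mul_nonneg hα (add_nonneg (sq_nonneg (s.1.1 x)) (sq_nonneg (s.1.2.1 x)))
          nlinarith [sq_nonneg (curv s.1.1 s.1.2.1 x), sq_nonneg ‖D1 (refConn d) s.1.2.2 x‖,
            sq_nonneg ‖pd2 s.1.2.2 x‖]
    _ ≤ (ε * ‖fieldEmb d α s‖) ^ 2 := by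
        rw [integral_const_mul, ← norm_jetCLM_sq, mul_pow, norm_fieldSpace_sq]
        gcongr
        linarith [sq_nonneg ‖valCLM d α (fieldEmb d α s)‖]

end Formulas

end

section

open scoped ContDiff Topology
open Filter Set

section Bounds

variable {d : ℤ} {α β : ℝ}

theorem poincare_mean {f : ℝ × ℝ → ℝ} (hf : ContDiff ℝ 1 f) :
    ∫ x in unitSquare, f x ^ 2 ≤
      4 * ((∫ x in unitSquare, pd1 f x ^ 2) + ∫ x in unitSquare, pd2 f x ^ 2)
        + 2 * (∫ x in unitSquare, f x) ^ 2 := by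
  have h := poincare_sum_squares hf one_pos
  have e : ∫ x in unitSquare, f x = ∫ s in (0 : ℝ)..1, ∫ t in (0 : ℝ)..1, f (s, t) := by
    rw [unitSquare_eq]
    exact setIntegral_rectangle hf.continuous zero_le_one zero_le_one
  simpa [← e] using h

theorem integral_pow_four_le_of_mean {f : ℝ × ℝ → ℝ} (hf : ContDiff ℝ 1 f) {G m : ℝ}
    (hG : (∫ x in unitSquare, pd1 f x ^ 2) + ∫ x in unitSquare, pd2 f x ^ 2 ≤ G)
    (hm : |∫ x in unitSquare, f x| ≤ m) :
    ∫ x in unitSquare, f x ^ 2 ≤ 4 * G + 2 * m ^ 2 ∧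
      ∫ x in unitSquare, f x ^ 4 ≤ 4 * (4 * G + 2 * m ^ 2) * (5 * G + 2 * m ^ 2) := by
  have h1 := poincare_mean hf
  have h2 := integral_norm_pow_four_le hf
  have hm2 : (∫ x in unitSquare, f x) ^ 2 ≤ m ^ 2 := sq_le_sq' (abs_le.1 hm).1 (abs_le.1 hm).2
  have n0 : 0 ≤ ∫ x in unitSquare, f x ^ 2 := integral_nonneg fun _ => sq_nonneg _
  have n1 : 0 ≤ ∫ x in unitSquare, pd1 f x ^ 2 := integral_nonneg fun _ => sq_nonneg _
  have n2 : 0 ≤ ∫ x in unitSquare, pd2 f x ^ 2 := integral_nonneg fun _ => sq_nonneg _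
  have h3 : ∫ x in unitSquare, f x ^ 2 ≤ 4 * G + 2 * m ^ 2 := by linarith
  refine ⟨h3, ?_⟩
  have e : ∀ x, |f x| ^ 4 = f x ^ 4 := fun x => Even.pow_abs (by decide) _
  simp only [Real.norm_eq_abs, sq_abs, e] at h2
  refine h2.trans ?_
  refine mul_le_mul (by linarith) (by linarith) (by linarith) (by linarith)

theorem norm_D1_refConn_sq_le (P : FieldPair d) (x : ℝ × ℝ) : ‖D1 (refConn d) P.φ x‖ ^ 2
    ≤ 2 * ‖D1 P.a1 P.φ x‖ ^ 2 + P.b1 x ^ 4 + ‖P.φ x‖ ^ 4 := by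
  have e : D1 (refConn d) P.φ x = D1 P.a1 P.φ x - I * (P.b1 x : ℂ) * P.φ x := by
    simp only [D1, refConn, FieldPair.b1]
    push_cast
    ring
  have h : ‖D1 (refConn d) P.φ x‖ ≤ ‖D1 P.a1 P.φ x‖ + |P.b1 x| * ‖P.φ x‖ := by
    rw [e]
    refine (norm_sub_le _ _).trans (le_of_eq ?_)
    rw [norm_mul, norm_mul, Complex.norm_I, one_mul, Complex.norm_real, Real.norm_eq_abs]
  have e4 : P.b1 x ^ 4 = |P.b1 x| ^ 4 := by rw [Even.pow_abs (by decide)]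
  rw [e4]
  have h2 : ‖D1 (refConn d) P.φ x‖ ^ 2 ≤ (‖D1 P.a1 P.φ x‖ + |P.b1 x| * ‖P.φ x‖) ^ 2 := by gcongr
  nlinarith [sq_nonneg (‖D1 P.a1 P.φ x‖ - |P.b1 x| * ‖P.φ x‖),
    sq_nonneg (|P.b1 x| ^ 2 - ‖P.φ x‖ ^ 2)]

theorem norm_pd2_sq_le (P : FieldPair d) (x : ℝ × ℝ) : ‖pd2 P.φ x‖ ^ 2
    ≤ 2 * ‖D2 P.a2 P.φ x‖ ^ 2 + P.a2 x ^ 4 + ‖P.φ x‖ ^ 4 := by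
  have e : pd2 P.φ x = D2 P.a2 P.φ x - I * (P.a2 x : ℂ) * P.φ x := by
    simp only [D2]
    ring
  have h : ‖pd2 P.φ x‖ ≤ ‖D2 P.a2 P.φ x‖ + |P.a2 x| * ‖P.φ x‖ := by
    rw [e]
    refine (norm_sub_le _ _).trans (le_of_eq ?_)
    rw [norm_mul, norm_mul, Complex.norm_I, one_mul, Complex.norm_real, Real.norm_eq_abs]
  have e4 : P.a2 x ^ 4 = |P.a2 x| ^ 4 := by rw [Even.pow_abs (by decide)]
  rw [e4]
  have h2 : ‖pd2 P.φ x‖ ^ 2 ≤ (‖D2 P.a2 P.φ x‖ + |P.a2 x| * ‖P.φ x‖) ^ 2 := by gcongr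
  nlinarith [sq_nonneg (‖D2 P.a2 P.φ x‖ - |P.a2 x| * ‖P.φ x‖),
    sq_nonneg (|P.a2 x| ^ 2 - ‖P.φ x‖ ^ 2)]

theorem setIntegral_unitSquare_add {f g : ℝ × ℝ → ℝ} (hf : Continuous f) (hg : Continuous g) :
    ∫ x in unitSquare, (f x + g x) = (∫ x in unitSquare, f x) + ∫ x in unitSquare, g x :=
  integral_add hf.integrableOn_unitSquare hg.integrableOn_unitSquare

theorem integral_curv_b1_sq_le (hα : 0 < α) (hβ : 0 < β) {F₀ : ℝ × ℝ → ℝ}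
    (hF₀ : ExternalField d F₀) {P : FieldPair d} (hP : IsGLSolution α β F₀ P) :
    ∫ x in unitSquare, curv P.b1 P.a2 x ^ 2 ≤ 2 * (8 * (α / β) * (α ^ 2 / β))
      + 2 * ∫ x in unitSquare, (F₀ x - 2 * Real.pi * d) ^ 2 := by
  have h := hP.integral_curv_sub_sq_le hα hβ hF₀
  have c1 := (P.contDiff_b1.curv P.smooth_a2).continuous
  have c2 := (P.smooth_a1.curv P.smooth_a2).continuous
  have c3 := hF₀.1.continuous
  have k1 : Continuous fun x => 2 * (curv P.a1 P.a2 x - F₀ x) ^ 2 := by fun_prop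
  have k2 : Continuous fun x => 2 * (F₀ x - 2 * Real.pi * d) ^ 2 := by fun_prop
  calc _ ≤ ∫ x in unitSquare, (2 * (curv P.a1 P.a2 x - F₀ x) ^ 2
        + 2 * (F₀ x - 2 * Real.pi * d) ^ 2) := by
        refine setIntegral_unitSquare_mono (c1.pow 2) (k1.add k2) fun x _ => ?_
        have e : curv P.b1 P.a2 x = (curv P.a1 P.a2 x - F₀ x) + (F₀ x - 2 * Real.pi * d) := by
          simp only [curv, P.pd2_b1]
          ring
        rw [e]
        nlinarith [sq_nonneg ((curv P.a1 P.a2 x - F₀ x) - (F₀ x - 2 * Real.pi * d))]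
    _ ≤ _ := by
        rw [setIntegral_unitSquare_add k1 k2, integral_const_mul, integral_const_mul]
        linarith

theorem integral_fieldJet_toFields_le (hα : 0 ≤ α) (P : FieldPair d) :
    ∫ x in unitSquare, ‖fieldJet α P.toFields x‖ ^ 2 ≤
      (∫ x in unitSquare, curv P.b1 P.a2 x ^ 2)
      + (∫ x in unitSquare, (pd1 P.b1 x + pd2 P.a2 x) ^ 2)
      + 2 * ((∫ x in unitSquare, ‖D1 P.a1 P.φ x‖ ^ 2) + ∫ x in unitSquare, ‖D2 P.a2 P.φ x‖ ^ 2)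
      + ((∫ x in unitSquare, P.b1 x ^ 4) + ∫ x in unitSquare, P.a2 x ^ 4)
      + 2 * (∫ x in unitSquare, ‖P.φ x‖ ^ 4)
      + α * ((∫ x in unitSquare, P.b1 x ^ 2) + ∫ x in unitSquare, P.a2 x ^ 2) := by
  have cj := continuous_fieldJet α P.toFields
  have c0 := P.smooth_φ.continuous
  have c1 := (P.smooth_φ.D1 P.smooth_a1).continuous
  have c2 := (P.smooth_φ.D2 P.smooth_a2).continuous
  have c3 := (P.contDiff_b1.curv P.smooth_a2).continuous
  have c4 := P.continuous_div
  have c5 := P.contDiff_b1.continuous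
  have c6 := P.smooth_a2.continuous
  have k1 : Continuous fun x => curv P.b1 P.a2 x ^ 2 := by fun_prop
  have k2 : Continuous fun x => (pd1 P.b1 x + pd2 P.a2 x) ^ 2 := by fun_prop
  have k3 : Continuous fun x => ‖D1 P.a1 P.φ x‖ ^ 2 := by fun_prop
  have k4 : Continuous fun x => ‖D2 P.a2 P.φ x‖ ^ 2 := by fun_prop
  have k5 : Continuous fun x => P.b1 x ^ 4 := by fun_prop
  have k6 : Continuous fun x => P.a2 x ^ 4 := by fun_prop
  have k7 : Continuous fun x => ‖P.φ x‖ ^ 4 := by fun_prop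
  have k8 : Continuous fun x => P.b1 x ^ 2 := by fun_prop
  have k9 : Continuous fun x => P.a2 x ^ 2 := by fun_prop
  rw [← setIntegral_unitSquare_add k3 k4, ← setIntegral_unitSquare_add k5 k6,
    ← setIntegral_unitSquare_add k8 k9, ← integral_const_mul, ← integral_const_mul,
    ← integral_const_mul, ← setIntegral_unitSquare_add k1 k2,
    ← setIntegral_unitSquare_add (by fun_prop) (by fun_prop),
    ← setIntegral_unitSquare_add (by fun_prop) (by fun_prop),
    ← setIntegral_unitSquare_add (by fun_prop) (by fun_prop),
    ← setIntegral_unitSquare_add (by fun_prop) (by fun_prop)]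
  refine setIntegral_unitSquare_mono (by fun_prop) (by fun_prop) fun x _ => ?_
  rw [norm_fieldJet_sq hα]
  have h1 := norm_D1_refConn_sq_le P x
  have h2 := norm_pd2_sq_le P x
  simp only [FieldPair.toFields]
  linarith

theorem exists_norm_toFields_le (hα : 0 < α) (hβ : 0 < β) {F₀ : ℝ × ℝ → ℝ}
    (hF₀ : ExternalField d F₀) : ∃ R : ℝ, ∀ P : FieldPair d, IsGLSolution α β F₀ P →
      (∀ x, |pd1 P.b1 x + pd2 P.a2 x| ≤ 1) → |∫ x in unitSquare, P.b1 x| ≤ 2 * Real.pi →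
      |∫ x in unitSquare, P.a2 x| ≤ 2 * Real.pi → ‖fieldEmb d α P.toFields‖ ≤ R := by
  set A := 2 * (8 * (α / β) * (α ^ 2 / β)) + 2 * ∫ x in unitSquare, (F₀ x - 2 * Real.pi * d) ^ 2
    with hA
  set G := A + 1 with hG
  set B := 4 * G + 2 * (2 * Real.pi) ^ 2 with hB
  set B' := 4 * (4 * G + 2 * (2 * Real.pi) ^ 2) * (5 * G + 2 * (2 * Real.pi) ^ 2) with hB'
  refine ⟨√(A + 1 + 2 * (α ^ 2 / β) + (B' + B') + 2 * (α / β) ^ 2 + α * (B + B)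
    + (B + B + α / β)), fun P hP hdiv hm1 hm2 => Real.le_sqrt_of_sq_le ?_⟩
  obtain ⟨b1, b2, b3⟩ := hP.bounds hα hβ hF₀
  have hcurl := integral_curv_b1_sq_le hα hβ hF₀ hP
  rw [← hA] at hcurl
  have c4 := P.continuous_div
  have hdiv2 : ∫ x in unitSquare, (pd1 P.b1 x + pd2 P.a2 x) ^ 2 ≤ 1 := by
    rw [← setIntegral_unitSquare_const (1 : ℝ)]
    refine setIntegral_unitSquare_mono (by fun_prop) continuous_const fun x _ => ?_
    exact (sq_le_one_iff_abs_le_one _).2 (hdiv x)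
  have hgrad := integral_gradient_eq_curl_div P.contDiff_b1 P.smooth_a2 P.periodic1_b1
    P.periodic2_b1 P.per1_a2 P.per2_a2
  have c1 := (P.contDiff_b1.curv P.smooth_a2).continuous
  have g1 := P.contDiff_b1.pd1.continuous
  have g2 := P.contDiff_b1.pd2.continuous
  have g3 := P.smooth_a2.pd1.continuous
  have g4 := P.smooth_a2.pd2.continuous
  have k1 : Continuous fun x => curv P.b1 P.a2 x ^ 2 := by fun_prop
  have k2 : Continuous fun x => (pd1 P.b1 x + pd2 P.a2 x) ^ 2 := by fun_prop
  rw [setIntegral_unitSquare_add k1 k2,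
    setIntegral_unitSquare_add (by fun_prop) (by fun_prop),
    setIntegral_unitSquare_add (by fun_prop) (by fun_prop),
    setIntegral_unitSquare_add (by fun_prop) (by fun_prop)] at hgrad
  have n1 : 0 ≤ ∫ x in unitSquare, pd1 P.b1 x ^ 2 := integral_nonneg fun _ => sq_nonneg _
  have n2 : 0 ≤ ∫ x in unitSquare, pd2 P.b1 x ^ 2 := integral_nonneg fun _ => sq_nonneg _
  have n3 : 0 ≤ ∫ x in unitSquare, pd1 P.a2 x ^ 2 := integral_nonneg fun _ => sq_nonneg _
  have n4 : 0 ≤ ∫ x in unitSquare, pd2 P.a2 x ^ 2 := integral_nonneg fun _ => sq_nonneg _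
  have l1 : ∀ {f : ℝ × ℝ → ℝ}, ContDiff ℝ ∞ f → ContDiff ℝ 1 f :=
    fun h => h.of_le (by exact_mod_cast le_top)
  obtain ⟨e1, e2⟩ := integral_pow_four_le_of_mean (l1 P.contDiff_b1) (G := G) (by linarith) hm1
  obtain ⟨f1, f2⟩ := integral_pow_four_le_of_mean (l1 P.smooth_a2) (G := G) (by linarith) hm2
  rw [← hB] at e1 f1
  rw [← hB'] at e2 f2
  have hj := integral_fieldJet_toFields_le hα.le P
  have hv : ∫ x in unitSquare, ‖fieldVal P.toFields x‖ ^ 2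
      = (∫ x in unitSquare, P.b1 x ^ 2) + (∫ x in unitSquare, P.a2 x ^ 2)
        + ∫ x in unitSquare, ‖P.φ x‖ ^ 2 := by
    simp_rw [norm_fieldVal_sq]
    have q1 := P.contDiff_b1.continuous
    have q2 := P.smooth_a2.continuous
    have q3 := P.smooth_φ.continuous
    exact setIntegral_unitSquare_add_add (f := fun x => P.b1 x ^ 2) (g := fun x => P.a2 x ^ 2)
      (h := fun x => ‖P.φ x‖ ^ 2) (by fun_prop) (by fun_prop) (by fun_prop)
  have hαB : α * ((∫ x in unitSquare, P.b1 x ^ 2) + ∫ x in unitSquare, P.a2 x ^ 2)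
      ≤ α * (B + B) := by gcongr
  rw [norm_fieldSpace_sq, norm_jetCLM_sq, norm_valCLM_sq]
  linarith

end Bounds

end

/-- the set of critical values of the Ginzburg–Landau energy is finite. -/
theorem statement12 (α β : ℝ) (hα : 0 < α) (hβ : 0 < β) (d : ℤ) (F₀ : ℝ × ℝ → ℝ)
    (hF₀ : ExternalField d F₀) :
    { t : ℝ | ∃ P : FieldPair d, IsGLSolution α β F₀ P ∧ t = energy α β F₀ P }.Finite := by
  let F : C(ℝ × ℝ, ℝ) := ⟨F₀, hF₀.1.continuous⟩
  obtain ⟨R, hR⟩ := exists_norm_toFields_le hα hβ hF₀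
  refine (finite_quarticEnergy_levels α (jetCLM d α) (valCLM d α) (valCLM4 d α) (couplingL β)
    (squareLp JetFiber 2 (sourceJet d F)) (norm_fieldSpace_sq d α) zero_le_one
    (norm_valCLM_le_norm_valCLM4 hα.le) (ehrlingCompact_valCLM4 hα.le)
    (denseRange_fieldEmb d α) R).subset ?_
  rintro t ⟨P, hP, rfl⟩ ε hε
  obtain ⟨Q, hQ, hE, hdiv, hm1, hm2⟩ := hP.exists_gauge (lt_min hε one_pos)
  have hdε : ∀ x, |pd1 Q.b1 x + pd2 Q.a2 x| ≤ ε := fun x => (hdiv x).trans (min_le_left _ _)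
  have hd1 : ∀ x, |pd1 Q.b1 x + pd2 Q.a2 x| ≤ 1 := fun x => (hdiv x).trans (min_le_right _ _)
  refine ⟨fieldEmb d α Q.toFields, hR Q hQ hd1 hm1 hm2, ?_, ?_⟩
  · have hq := Q.quarticEnergy_toFields hα.le F hβ.le
    rw [hq, ← hE]
    have c := Q.continuous_div
    have n : 0 ≤ ∫ x in unitSquare, (pd1 Q.b1 x + pd2 Q.a2 x) ^ 2 :=
      integral_nonneg fun _ => sq_nonneg _
    have n1 : ∫ x in unitSquare, (pd1 Q.b1 x + pd2 Q.a2 x) ^ 2 ≤ ε := by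
      rw [← setIntegral_unitSquare_const ε]
      refine setIntegral_unitSquare_mono (by fun_prop) continuous_const fun x _ => ?_
      rw [← sq_abs]
      nlinarith [hdε x, hd1 x, abs_nonneg (pd1 Q.b1 x + pd2 Q.a2 x)]
    have e : energy α β F Q + 1 / 2 * (∫ x in unitSquare, (pd1 Q.b1 x + pd2 Q.a2 x) ^ 2)
        - energy α β F₀ Q = 1 / 2 * ∫ x in unitSquare, (pd1 Q.b1 x + pd2 Q.a2 x) ^ 2 :=
      add_sub_cancel_left _ _
    rw [e, abs_of_nonneg (by positivity)]
    linarith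
  · rintro _ ⟨s, rfl⟩
    exact FieldPair.abs_quarticDeriv_toFields_le hα.le F hβ.le hF₀ hQ hε.le hdε s
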